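/- Let K be a number field. For any finite family (Ē_i)_{i=1,…,n} of nonzero hermitian 𝒪_K-lattices, one has μ_max(Ē_1 ⊗ ⋯ ⊗ Ē_n) ≤ Σ_{i=1}^n ( μ_max(Ē_i) + ([K:ℚ]/2)·log rk(Ē_i) ). -/

import Mathlib

open scoped NumberField ComplexOrder Classical

noncomputable section

/-- The hermitian pairing on complex coordinate vectors determined by the (Gram) matrix `M`:
`⟨u, v⟩ = ∑ conj(uᵢ) · Mᵢⱼ · vⱼ` (antilinear in the first variable). -/
def cForm {ι : Type} [Fintype ι] (M : Matrix ι ι ℂ) (u v : ι → ℂ) : ℂ :=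
  ∑ i, ∑ j, (starRingEnd ℂ) (u i) * M i j * v j

/-- The hermitian pairing, at the complex embedding `σ` of `K`, of two `K`-rational
coordinate vectors, for the metric with Gram matrix `M` at `σ`. -/
def eForm {K : Type} [Field K] {ι : Type} [Fintype ι] (M : Matrix ι ι ℂ)
    (σ : K →+* ℂ) (u v : ι → K) : ℂ :=
  cForm M (fun i => σ (u i)) (fun i => σ (v i))

/-- The arithmetic degree of a (finitely generated) `𝒪_K`-submodule `F` of `K^ι`, for the
hermitian metrics on `K^ι` whose Gram matrix at the complex embedding `σ` is `H σ`, with the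
induced metrics on `F`.  It is computed from a `K`-linearly independent family `x` of elements
of `F` spanning the same `K`-subspace as `F`:
`deg F = log #(F / (𝒪_K x₁ + ⋯ + 𝒪_K x_s)) - ∑_σ log ‖x₁ ∧ ⋯ ∧ x_s‖_σ`,
where `‖x₁ ∧ ⋯ ∧ x_s‖_σ` is the square root of the Gram determinant of `x` at `σ`.
(For `F` of rank one this is the usual `deg F = log #(F/𝒪_K ℓ) - ∑_v ε_v log ‖ℓ‖_v`, the sum
running over all complex embeddings; the general case agrees with `deg F = deg (det F)`,
where `det F = Λ^s F` carries the Gram-determinant metrics.) -/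
def hDeg (K : Type) [Field K] [NumberField K] {ι : Type} [Fintype ι]
    (H : (K →+* ℂ) → Matrix ι ι ℂ) (F : Submodule (𝓞 K) (ι → K)) : ℝ :=
  if h : ∃ p : (s : ℕ) × (Fin s → ι → K), 0 < p.1 ∧ (∀ a, p.2 a ∈ F) ∧
      LinearIndependent K p.2 ∧ ∀ y ∈ F, y ∈ Submodule.span K (Set.range p.2) then
    Real.log (Nat.card
        (↥F ⧸ Submodule.comap F.subtype (Submodule.span (𝓞 K) (Set.range h.choose.2))))
      - ∑ᶠ σ : K →+* ℂ, Real.log (Real.sqrt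
          ((Matrix.of fun a b => eForm (H σ) σ (h.choose.2 a) (h.choose.2 b)).det.re))
  else 0

/-- The rank of an `𝒪_K`-submodule `F` of `K^ι`: the dimension of the `K`-subspace
it spans. -/
def hRank (K : Type) [Field K] [NumberField K] {ι : Type} [Fintype ι]
    (F : Submodule (𝓞 K) (ι → K)) : ℕ :=
  Module.finrank K ↥(Submodule.span K (F : Set (ι → K)))

/-- The slope of a nonzero `𝒪_K`-submodule of `K^ι` with the induced metrics:
degree divided by rank. -/
def hMu (K : Type) [Field K] [NumberField K] {ι : Type} [Fintype ι]
    (H : (K →+* ℂ) → Matrix ι ι ℂ) (F : Submodule (𝓞 K) (ι → K)) : ℝ :=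
  hDeg K H F / hRank K F

/-- The maximal slope `μ_max` of the hermitian `𝒪_K`-lattice `E ⊆ K^ι`: the supremum of the
slopes of its nonzero `𝒪_K`-submodules (of any rank), with the induced metrics. -/
def hMuMax (K : Type) [Field K] [NumberField K] {ι : Type} [Fintype ι]
    (H : (K →+* ℂ) → Matrix ι ι ℂ) (E : Submodule (𝓞 K) (ι → K)) : ℝ :=
  sSup { m : ℝ | ∃ F : Submodule (𝓞 K) (ι → K), F ≠ ⊥ ∧ F ≤ E ∧ m = hMu K H F }

/-- The compatibility of the family of Gram matrices `H` with complex conjugation: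
the metric at the conjugate embedding is the conjugate metric (so that the data of `H`
amounts to a euclidean/hermitian metric at each archimedean place of `K`). -/
def ConjCompatible (K : Type) [Field K] {ι : Type} [Fintype ι]
    (H : (K →+* ℂ) → Matrix ι ι ℂ) : Prop :=
  ∀ σ : K →+* ℂ, H ((starRingEnd ℂ).comp σ) = (H σ).map (starRingEnd ℂ)

/-- The arithmetic degree of a nonzero rank-one hermitian `𝒪_K'`-lattice, presented as a
nonzero finitely generated `𝒪_{K'}`-submodule `L` of `K'` whose metric at the complex
embedding `σ` is `‖y‖_σ² = g σ · |σ(y)|²`: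
`deg L = log #(L/𝒪_{K'} ℓ) - ∑_σ log ‖ℓ‖_σ` for a nonzero `ℓ ∈ L`. -/
def degLine (K' : Type) [Field K'] [NumberField K']
    (L : Submodule (𝓞 K') K') (g : (K' →+* ℂ) → ℝ) : ℝ :=
  if h : ∃ x : K', x ∈ L ∧ x ≠ 0 then
    Real.log (Nat.card
        (↥L ⧸ Submodule.comap L.subtype (Submodule.span (𝓞 K') {h.choose})))
      - ∑ᶠ σ : K' →+* ℂ, Real.log (Real.sqrt (g σ * Complex.normSq (σ h.choose)))
  else 0

/-- The quotient metric induced at the embedding `σ` on a rank-one quotient of the hermitian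
lattice `(K'^ι, H')` via the `K'`-linear surjection `ψ : K'^ι → K'`:
`‖1‖² = inf { ⟨e, e⟩_{H' σ} | ψ_σ(e) = 1 }` (infimum over the fibre of `1` in `ℂ^ι`). -/
def quotMetric {K' : Type} [Field K'] {ι : Type} [Fintype ι] [DecidableEq ι]
    (H' : (K' →+* ℂ) → Matrix ι ι ℂ) (ψ : (ι → K') →ₗ[K'] K') (σ : K' →+* ℂ) : ℝ :=
  sInf { t : ℝ | ∃ e : ι → ℂ, (∑ i, σ (ψ (Pi.single i 1)) * e i) = 1 ∧
    t = (cForm (H' σ) e e).re }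

/-- Base change of an `𝒪_K`-lattice `E ⊆ K^ι` to the ring of integers of a finite
extension `K'` of `K`: the `𝒪_{K'}`-span of the image of `E` in `K'^ι`. -/
def baseChange (K K' : Type) [Field K] [NumberField K] [Field K'] [NumberField K']
    [Algebra K K'] {ι : Type} [Fintype ι] (E : Submodule (𝓞 K) (ι → K)) :
    Submodule (𝓞 K') (ι → K') :=
  Submodule.span (𝓞 K') ((fun v i => algebraMap K K' (v i)) '' (E : Set (ι → K)))

/-- The metrics on the base change to `K'` of a hermitian lattice over `K` with metrics `H`:
the Gram matrix at an embedding `σ'` of `K'` is the Gram matrix of `H` at the induced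
embedding of `K`. -/
def baseChangeMetric (K K' : Type) [Field K] [Field K'] [Algebra K K'] {ι : Type}
    (H : (K →+* ℂ) → Matrix ι ι ℂ) : (K' →+* ℂ) → Matrix ι ι ℂ :=
  fun σ' => H (σ'.comp (algebraMap K K'))

/-- A hermitian `𝒪_K`-lattice `E ⊆ K^ι` (with metrics `H`) is nef if for every finite
extension `K'/K`, every rank-one quotient of `E ⊗_{𝒪_K} 𝒪_{K'}`, with the quotient metrics,
has nonnegative arithmetic degree.  A rank-one quotient is the image of `E ⊗ 𝒪_{K'}` under a
`K'`-linear form `ψ` on `K'^ι` (every rank-one quotient of the full lattice `E ⊗ 𝒪_{K'}`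
arises this way, with the quotient metrics given by `quotMetric`). -/
def IsNef (K : Type) [Field K] [NumberField K] {ι : Type} [Fintype ι] [DecidableEq ι]
    (H : (K →+* ℂ) → Matrix ι ι ℂ) (E : Submodule (𝓞 K) (ι → K)) : Prop :=
  ∀ (K' : Type) [Field K'] [NumberField K'] [Algebra K K'],
    ∀ ψ : (ι → K') →ₗ[K'] K',
      Submodule.map (ψ.restrictScalars (𝓞 K')) (baseChange K K' E) ≠ ⊥ →
      0 ≤ degLine K' (Submodule.map (ψ.restrictScalars (𝓞 K')) (baseChange K K' E))
            (quotMetric (baseChangeMetric K K' H) ψ)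

end

set_option linter.unusedSectionVars false

noncomputable section
namespace TensorSlope

section PolynomialSide
open MvPolynomial

section Frames
variable {k : Type} [Field k] [NumberField k] {τ : Type} [Fintype τ]

/-- Extension of coefficients from integral polynomials. -/
abbrev toK (b : MvPolynomial τ (𝓞 k)) : MvPolynomial τ k :=
  map (algebraMap (𝓞 k) k) b

/-- Homogeneous polynomials of degree `n` bounded by the `n`-th power of `N`. -/
def polyBall (N : (τ → ℂ) → ℝ) (n : ℕ) : Set (MvPolynomial τ ℂ) :=
  {c | c.IsHomogeneous n ∧ ∀ v, ‖eval v c‖ ≤ N v ^ n}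

/-- An integral basis of the degree `n` part of the quotient by `J`, together with bounded
archimedean bases, whose total log determinant is at least `v`. -/
def Frame (N : (k →+* ℂ) → (τ → ℂ) → ℝ) (J : Ideal (MvPolynomial τ k)) (n : ℕ)
    (I : Type) [Fintype I] (v : ℝ) : Prop :=
  ∃ b : I → MvPolynomial τ (𝓞 k), (∀ i, (b i).IsHomogeneous n) ∧
    (∀ t : I → k, ∑ i, C (t i) * toK (b i) ∈ J → t = 0) ∧
    (∀ f : MvPolynomial τ k, f.IsHomogeneous n → ∃ t : I → k, f - ∑ i, C (t i) * toK (b i) ∈ J) ∧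
    ∃ M : (k →+* ℂ) → Matrix I I ℂ,
      (∀ σ, (M σ).det ≠ 0 ∧ ∀ i, ∃ c ∈ polyBall (N σ) n,
        c - ∑ j, C (M σ i j) * map σ (toK (b j)) ∈ J.map (map σ)) ∧
      v ≤ ∑ σ, Real.log ‖(M σ).det‖

theorem polyBall_mul {N : (τ → ℂ) → ℝ} {n m : ℕ} {p q : MvPolynomial τ ℂ}
    (hp : p ∈ polyBall N n) (hq : q ∈ polyBall N m) : p * q ∈ polyBall N (n + m) := by
  refine ⟨hp.1.mul hq.1, fun v => ?_⟩
  rw [map_mul, norm_mul, pow_add]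
  exact mul_le_mul (hp.2 v) (hq.2 v) (norm_nonneg _) ((norm_nonneg _).trans (hp.2 v))

theorem Frame.mono {N : (k →+* ℂ) → (τ → ℂ) → ℝ} {J : Ideal (MvPolynomial τ k)} {n : ℕ}
    {I : Type} [Fintype I] {v w : ℝ} (h : Frame N J n I v) (hw : w ≤ v) : Frame N J n I w := by
  obtain ⟨b, h1, h2, h3, M, h4, h5⟩ := h
  exact ⟨b, h1, h2, h3, M, h4, hw.trans h5⟩

theorem Frame.reindex {N : (k →+* ℂ) → (τ → ℂ) → ℝ} {J : Ideal (MvPolynomial τ k)} {n : ℕ}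
    {I I' : Type} [Fintype I] [Fintype I'] (e : I ≃ I') {v : ℝ} (h : Frame N J n I v) :
    Frame N J n I' v := by
  obtain ⟨b, h1, h2, h3, M, h4, h5⟩ := h
  refine ⟨b ∘ e.symm, fun i => h1 _, fun t ht => ?_, fun f hf => ?_,
    fun σ => (M σ).submatrix e.symm e.symm, fun σ => ⟨?_, fun i => ?_⟩, ?_⟩
  · have := h2 (t ∘ e) (by
      rw [← e.symm.sum_comp]
      simpa using ht)
    funext i
    simpa using congrFun this (e.symm i)
  · obtain ⟨t, ht⟩ := h3 f hf
    refine ⟨t ∘ e.symm, ?_⟩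
    rw [← e.symm.sum_comp] at ht
    exact ht
  · rw [Matrix.det_submatrix_equiv_self]
    exact (h4 σ).1
  · obtain ⟨c, hc, hc'⟩ := (h4 σ).2 (e.symm i)
    refine ⟨c, hc, ?_⟩
    rw [← e.symm.sum_comp] at hc'
    exact hc'
  · simpa [Matrix.det_submatrix_equiv_self] using h5

/-- Homogeneous polynomials over `ℂ` are combinations of the base change of any family
spanning the homogeneous polynomials modulo `J`. -/
theorem exists_sub_sum_mem_map {J : Ideal (MvPolynomial τ k)} {n : ℕ}
    {I : Type} [Fintype I] {b : I → MvPolynomial τ k}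
    (h : ∀ f : MvPolynomial τ k, f.IsHomogeneous n → ∃ t : I → k, f - ∑ i, C (t i) * b i ∈ J)
    (σ : k →+* ℂ) (g : MvPolynomial τ ℂ) (hg : g.IsHomogeneous n) :
    ∃ t : I → ℂ, g - ∑ i, C (t i) * map σ (b i) ∈ J.map (map σ) := by
  have h' : ∀ m ∈ g.support, ∃ t : I → k, monomial m 1 - ∑ i, C (t i) * b i ∈ J := by
    intro m hm
    apply h
    apply isHomogeneous_monomial
    rw [Finsupp.degree_eq_weight_one]
    exact hg (mem_support_iff.mp hm)
  choose! t ht using h'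
  let W : Submodule ℂ (MvPolynomial τ ℂ) :=
    Submodule.span ℂ (Set.range fun i => map σ (b i)) ⊔ (J.map (map σ)).restrictScalars ℂ
  have hW : g ∈ W := by
    rw [g.as_sum]
    refine Submodule.sum_mem _ fun m hm => ?_
    have h1 : monomial m (coeff m g) = coeff m g • (map σ (∑ i, C (t m i) * b i) +
        map σ (monomial m 1 - ∑ i, C (t m i) * b i)) := by
      rw [← map_add, add_sub_cancel, map_monomial, map_one, smul_monomial, smul_eq_mul, mul_one]
    rw [h1]
    refine Submodule.smul_mem _ _ (Submodule.add_mem_sup ?_ ?_)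
    · rw [map_sum]
      refine Submodule.sum_mem _ fun i _ => ?_
      rw [map_mul, map_C, ← smul_eq_C_mul]
      exact Submodule.smul_mem _ _ (Submodule.subset_span ⟨i, rfl⟩)
    · exact Ideal.mem_map_of_mem _ (ht m hm)
  obtain ⟨x, hx, y, hy, hxy⟩ := Submodule.mem_sup.mp hW
  obtain ⟨u, hu⟩ := (Submodule.mem_span_range_iff_exists_fun ℂ).mp hx
  refine ⟨u, ?_⟩
  have h2 : ∑ i, C (u i) * map σ (b i) = x := by
    rw [← hu]
    exact Finset.sum_congr rfl fun i _ => (smul_eq_C_mul _ _).symm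
  rw [h2, ← hxy, add_sub_cancel_left]
  exact hy

/-- The colon ideal `(J : a)`. -/
def colonI (J : Ideal (MvPolynomial τ k)) (a : MvPolynomial τ k) : Ideal (MvPolynomial τ k) :=
  Submodule.comap (LinearMap.mulLeft (MvPolynomial τ k) a) J

theorem mem_colonI {J : Ideal (MvPolynomial τ k)} {a f : MvPolynomial τ k} :
    f ∈ colonI J a ↔ a * f ∈ J := Iff.rfl

/-- Homogeneity of an ideal for the degree grading. -/
def IsHom {R : Type} [CommRing R] (J : Ideal (MvPolynomial τ R)) : Prop :=
  ∀ f ∈ J, ∀ n, homogeneousComponent n f ∈ J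

end Frames

section Union
variable {k : Type} [Field k] [NumberField k] {τ : Type} [Fintype τ]

attribute [local instance] MvPolynomial.gradedAlgebra in
theorem isHom_iff {R : Type} [CommRing R] {J : Ideal (MvPolynomial τ R)} :
    IsHom J ↔ J.IsHomogeneous (homogeneousSubmodule τ R) := by
  constructor
  · intro h n f hf
    have := h f hf n
    rw [← decomposition.decompose'_apply] at this
    exact this
  · intro h f hf n
    exact homogeneousComponent_mem_of_mem h hf n

attribute [local instance] MvPolynomial.gradedAlgebra in
theorem isHom_span {R : Type} [CommRing R] {s : Set (MvPolynomial τ R)}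
    (h : ∀ f ∈ s, ∃ n, f.IsHomogeneous n) : IsHom (Ideal.span s) :=
  isHom_iff.mpr (Ideal.homogeneous_span _ _ fun f hf => by
    obtain ⟨n, hn⟩ := h f hf
    exact ⟨n, hn⟩)

attribute [local instance] MvPolynomial.gradedAlgebra in
theorem IsHom.sup {R : Type} [CommRing R] {I J : Ideal (MvPolynomial τ R)}
    (hI : IsHom I) (hJ : IsHom J) : IsHom (I ⊔ J) :=
  isHom_iff.mpr ((isHom_iff.mp hI).sup (isHom_iff.mp hJ))

theorem IsHom.eq_span {R : Type} [CommRing R] {J : Ideal (MvPolynomial τ R)} (hJ : IsHom J) :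
    J = Ideal.span {f | f ∈ J ∧ ∃ n, f.IsHomogeneous n} := by
  apply le_antisymm
  · intro f hf
    rw [← sum_homogeneousComponent f]
    exact Ideal.sum_mem _ fun n _ => Ideal.subset_span
      ⟨hJ f hf n, n, homogeneousComponent_isHomogeneous n f⟩
  · exact Ideal.span_le.mpr fun f hf => hf.1

theorem IsHom.map {R R' : Type} [CommRing R] [CommRing R'] {J : Ideal (MvPolynomial τ R)}
    (hJ : IsHom J) (σ : R →+* R') : IsHom (J.map (MvPolynomial.map σ)) := by
  rw [hJ.eq_span, Ideal.map_span]
  apply isHom_span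
  rintro _ ⟨f, ⟨-, n, hn⟩, rfl⟩
  exact ⟨n, hn.map σ⟩

theorem homogeneousComponent_mul_of_left {R : Type} [CommRing R] {a : MvPolynomial τ R} {e : ℕ}
    (ha : a.IsHomogeneous e) (f : MvPolynomial τ R) (n : ℕ) :
    homogeneousComponent (n + e) (a * f) = a * homogeneousComponent n f := by
  conv_lhs => rw [← sum_homogeneousComponent f, Finset.mul_sum, map_sum]
  have h : ∀ i, homogeneousComponent (n + e) (a * homogeneousComponent i f) =
      if i = n then a * homogeneousComponent n f else 0 := by
    intro i
    have h1 : (a * homogeneousComponent i f).IsHomogeneous (e + i) :=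
      ha.mul (homogeneousComponent_isHomogeneous i f)
    rw [homogeneousComponent_of_mem h1]
    by_cases hi : i = n
    · subst hi
      simp [add_comm]
    · rw [if_neg hi, if_neg (by omega)]
  simp only [h]
  rw [Finset.sum_ite_eq']
  split_ifs with h2
  · rfl
  · rw [homogeneousComponent_eq_zero _ _ (by simpa using h2), mul_zero]

theorem IsHom.colonI {J : Ideal (MvPolynomial τ k)} (hJ : IsHom J) {a : MvPolynomial τ k} {e : ℕ}
    (ha : a.IsHomogeneous e) : IsHom (colonI J a) := by
  intro f hf n
  rw [mem_colonI, ← homogeneousComponent_mul_of_left ha]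
  exact hJ _ hf _

/-- Homogeneous elements of `J + (a)` in degree `n + e` are, modulo `J`, multiples of `a` by
homogeneous elements of degree `n`. -/
theorem exists_homogeneous_sub_mem {R : Type} [CommRing R] {J : Ideal (MvPolynomial τ R)}
    (hJ : IsHom J) {a : MvPolynomial τ R} {e n : ℕ} (ha : a.IsHomogeneous e)
    {f : MvPolynomial τ R} (hf : f.IsHomogeneous (n + e)) (h : f ∈ J ⊔ Ideal.span {a}) :
    ∃ g : MvPolynomial τ R, g.IsHomogeneous n ∧ f - a * g ∈ J := by
  obtain ⟨j, hj, x, hx, rfl⟩ := Submodule.mem_sup.mp h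
  obtain ⟨g, rfl⟩ := Ideal.mem_span_singleton.mp hx
  refine ⟨homogeneousComponent n g, homogeneousComponent_isHomogeneous _ _, ?_⟩
  rw [← homogeneousComponent_eq_self hf, map_add, homogeneousComponent_mul_of_left ha,
    add_sub_cancel_right]
  exact hJ j hj _

theorem Frame.union {N : (k →+* ℂ) → (τ → ℂ) → ℝ} {J : Ideal (MvPolynomial τ k)} (hJ : IsHom J)
    {n e : ℕ} {I I' : Type} [Fintype I] [Fintype I'] {v v' : ℝ} {a : MvPolynomial τ (𝓞 k)}
    (ha : a.IsHomogeneous e) {A : ℝ} (hA : 0 < A)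
    (hlift : ∀ σ, ∃ p, C ((A : ℂ)⁻¹) * p ∈ polyBall (N σ) e ∧
      p - map σ (toK a) ∈ J.map (map σ))
    (h : Frame N (colonI J (toK a)) n I v)
    (h' : Frame N (J ⊔ Ideal.span {toK a}) (n + e) I' v') :
    Frame N J (n + e) (I ⊕ I')
      (v + v' - Fintype.card I * (Module.finrank ℚ k * Real.log A)) := by
  obtain ⟨b, b1, b2, b3, M, M1, M2⟩ := h
  obtain ⟨b', b1', b2', b3', M', M1', M2'⟩ := h'
  have haK : (toK a).IsHomogeneous e := ha.map _
  have hmapsup : ∀ σ : k →+* ℂ, (J ⊔ Ideal.span {toK a}).map (map σ) =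
      J.map (map σ) ⊔ Ideal.span {map σ (toK a)} := by
    intro σ
    rw [Ideal.map_sup, Ideal.map_span, Set.image_singleton]
  have key : ∀ (σ : k →+* ℂ) (x), x ∈ (colonI J (toK a)).map (map σ) →
      map σ (toK a) * x ∈ J.map (map σ) := by
    intro σ x hx
    have : (colonI J (toK a)).map (map σ) ≤
        Submodule.comap (LinearMap.mulLeft (MvPolynomial τ ℂ) (map σ (toK a))) (J.map (map σ)) := by
      rw [Ideal.map_le_iff_le_comap]
      intro y hy
      change map σ (toK a) * map σ y ∈ J.map (map σ)
      rw [← map_mul]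
      exact Ideal.mem_map_of_mem _ hy
    exact this hx
  have hM' : ∀ σ i, ∃ t : I → ℂ, ∃ c ∈ polyBall (N σ) (n + e),
      c - (∑ j, C (t j) * (map σ (toK a) * map σ (toK (b j))) +
        ∑ j, C (M' σ i j) * map σ (toK (b' j))) ∈ J.map (map σ) := by
    intro σ i
    obtain ⟨c, hc, hc'⟩ := (M1' σ).2 i
    rw [hmapsup] at hc'
    have hom : (c - ∑ j, C (M' σ i j) * map σ (toK (b' j))).IsHomogeneous (n + e) := by
      refine hc.1.sub (IsHomogeneous.sum _ _ _ fun j _ => ?_)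
      simpa using (isHomogeneous_C τ (M' σ i j)).mul (((b1' j).map (algebraMap (𝓞 k) k)).map σ)
    obtain ⟨g, hg, hg'⟩ := exists_homogeneous_sub_mem (hJ.map σ) (haK.map σ) hom hc'
    obtain ⟨t, ht⟩ := exists_sub_sum_mem_map b3 σ g hg
    refine ⟨t, c, hc, ?_⟩
    have := Ideal.add_mem _ hg' (key σ _ ht)
    convert this using 1
    rw [mul_sub, Finset.mul_sum]
    simp only [mul_left_comm]
    ring
  choose p hp hp' using hlift
  choose T cT hcT hcT' using hM'
  refine ⟨Sum.elim (fun i => a * b i) b', ?_, ?_, ?_,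
    fun σ => Matrix.fromBlocks ((A : ℂ)⁻¹ • M σ) 0 (Matrix.of (T σ)) (M' σ), ?_, ?_⟩
  · rintro (i | i)
    · rw [add_comm n e]
      exact ha.mul (b1 i)
    · exact b1' i
  · intro t ht
    simp only [Fintype.sum_sum_type, Sum.elim_inl, Sum.elim_inr, map_mul] at ht
    have e1 : ∑ i, C (t (Sum.inl i)) * (toK a * toK (b i)) =
        toK a * ∑ i, C (t (Sum.inl i)) * toK (b i) := by
      rw [Finset.mul_sum]
      exact Finset.sum_congr rfl fun i _ => by ring
    rw [e1] at ht
    have h1 : (fun i => t (Sum.inr i)) = 0 := by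
      apply b2'
      have h3 : toK a * ∑ i, C (t (Sum.inl i)) * toK (b i) ∈ J ⊔ Ideal.span {toK a} :=
        Ideal.mem_sup_right (Ideal.mul_mem_right _ _ (Ideal.mem_span_singleton_self _))
      exact (Ideal.add_mem_iff_right _ h3).mp (Ideal.mem_sup_left ht)
    have h2 : (fun i => t (Sum.inl i)) = 0 := by
      apply b2
      rw [mem_colonI]
      have : ∀ i, t (Sum.inr i) = 0 := fun i => congrFun h1 i
      simpa [this] using ht
    funext i
    rcases i with i | i
    · exact congrFun h2 i
    · exact congrFun h1 i
  · intro f hf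
    obtain ⟨t', ht'⟩ := b3' f hf
    have hom : (f - ∑ j, C (t' j) * toK (b' j)).IsHomogeneous (n + e) := by
      refine hf.sub (IsHomogeneous.sum _ _ _ fun j _ => ?_)
      simpa using (isHomogeneous_C τ (t' j)).mul ((b1' j).map (algebraMap (𝓞 k) k))
    obtain ⟨g, hg, hg'⟩ := exists_homogeneous_sub_mem hJ haK hom ht'
    obtain ⟨t, ht⟩ := b3 g hg
    refine ⟨Sum.elim t t', ?_⟩
    have := Ideal.add_mem _ hg' (mem_colonI.mp ht)
    convert this using 1
    simp only [Fintype.sum_sum_type, Sum.elim_inl, Sum.elim_inr, map_mul]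
    rw [mul_sub, Finset.mul_sum]
    simp only [mul_left_comm]
    ring
  · intro σ
    refine ⟨?_, ?_⟩
    · have h1 : (Matrix.fromBlocks ((A : ℂ)⁻¹ • M σ) 0 (Matrix.of (T σ)) (M' σ)).det ≠ 0 := by
        rw [Matrix.det_fromBlocks_zero₁₂, Matrix.det_smul]
        refine mul_ne_zero (mul_ne_zero (pow_ne_zero _ ?_) (M1 σ).1) (M1' σ).1
        exact inv_ne_zero (by exact_mod_cast hA.ne')
      convert h1
    · rintro (i | i)
      · obtain ⟨c, hc, hc'⟩ := (M1 σ).2 i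
        refine ⟨C ((A : ℂ)⁻¹) * p σ * c, ?_, ?_⟩
        · rw [add_comm n e]
          exact polyBall_mul (hp σ) hc
        · have h1 := Ideal.mul_mem_left _ (C ((A : ℂ)⁻¹)) (key σ _ hc')
          have h2 := Ideal.mul_mem_left _ (C ((A : ℂ)⁻¹) * c) (hp' σ)
          have := Ideal.add_mem _ h1 h2
          convert this using 1
          simp only [Fintype.sum_sum_type, Sum.elim_inl, Sum.elim_inr, map_mul,
            Matrix.fromBlocks_apply₁₁, Matrix.fromBlocks_apply₁₂, Matrix.smul_apply,
            Matrix.zero_apply, map_zero, zero_mul, Finset.sum_const_zero, add_zero, smul_eq_mul]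
          have : ∑ j, C ((A : ℂ)⁻¹) * C (M σ i j) * (map σ (toK a) * map σ (toK (b j))) =
              C ((A : ℂ)⁻¹) * map σ (toK a) * ∑ j, C (M σ i j) * map σ (toK (b j)) := by
            rw [Finset.mul_sum]
            exact Finset.sum_congr rfl fun i _ => by ring
          rw [this]
          ring
      · refine ⟨cT σ i, hcT σ i, ?_⟩
        simpa only [Fintype.sum_sum_type, Sum.elim_inl, Sum.elim_inr, map_mul,
          Matrix.fromBlocks_apply₂₁, Matrix.fromBlocks_apply₂₂, Matrix.of_apply] using hcT' σ i
  · have hA' : ∀ σ : k →+* ℂ, Real.log ‖(Matrix.fromBlocks ((A : ℂ)⁻¹ • M σ) 0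
        (Matrix.of (T σ)) (M' σ)).det‖ = Real.log ‖(M σ).det‖ + Real.log ‖(M' σ).det‖ -
          Fintype.card I * Real.log A := by
      intro σ
      rw [Matrix.det_fromBlocks_zero₁₂, Matrix.det_smul, norm_mul, norm_mul, norm_pow, norm_inv,
        Complex.norm_real, Real.norm_of_nonneg hA.le,
        Real.log_mul (mul_ne_zero (by positivity) (norm_ne_zero_iff.mpr (M1 σ).1))
          (norm_ne_zero_iff.mpr (M1' σ).1),
        Real.log_mul (by positivity) (norm_ne_zero_iff.mpr (M1 σ).1), Real.log_pow, Real.log_inv]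
      ring
    beta_reduce
    rw [Finset.sum_congr rfl (g := fun σ => Real.log ‖(M σ).det‖ + Real.log ‖(M' σ).det‖ -
      Fintype.card I * Real.log A) fun σ _ => by convert hA' σ]
    simp only [Finset.sum_sub_distrib, Finset.sum_add_distrib, Finset.sum_const,
      Finset.card_univ, nsmul_eq_mul, NumberField.Embeddings.card]
    linarith

end Union

section Trivial
variable {k : Type} [Field k] [NumberField k] {τ : Type} [Fintype τ]

/-- Properties of a family of norms: lower bounds, norming linear forms, and invariance under
complex conjugation. -/
structure GoodNorm (N : (k →+* ℂ) → (τ → ℂ) → ℝ) : Prop where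
  nonneg : ∀ σ v, 0 ≤ N σ v
  lower : ∀ σ, ∃ c : ℝ, 0 < c ∧ ∀ v i, ‖v i‖ ≤ c * N σ v
  peak : ∀ σ v, ∃ L : τ → ℂ, (∀ w, ‖∑ i, L i * w i‖ ≤ N σ w) ∧ ‖∑ i, L i * v i‖ = N σ v
  conj : ∀ σ v, N ((starRingEnd ℂ).comp σ) (fun i => starRingEnd ℂ (v i)) = N σ v

theorem norm_eval_le {p : MvPolynomial τ ℂ} {n : ℕ} (hp : p.IsHomogeneous n) {v : τ → ℂ} {R : ℝ}
    (hv : ∀ i, ‖v i‖ ≤ R) : ‖eval v p‖ ≤ (∑ m ∈ p.support, ‖coeff m p‖) * R ^ n := by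
  rw [eval_eq, Finset.sum_mul]
  refine (norm_sum_le _ _).trans (Finset.sum_le_sum fun m hm => ?_)
  rw [norm_mul]
  refine mul_le_mul_of_nonneg_left ?_ (norm_nonneg _)
  rw [norm_prod, IsHomogeneous.degree_eq_sum_deg_support hp hm]
  simp only [norm_pow]
  refine (Finset.prod_le_prod (fun i _ => by positivity)
    fun i _ => pow_le_pow_left₀ (norm_nonneg _) (hv i) _).trans ?_
  rw [Finset.prod_pow_eq_pow_sum]

theorem exists_polyBall {N : (k →+* ℂ) → (τ → ℂ) → ℝ} (hN : GoodNorm N) (σ : k →+* ℂ)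
    {p : MvPolynomial τ ℂ} {n : ℕ} (hp : p.IsHomogeneous n) :
    ∃ B : ℝ, 0 < B ∧ ∀ A : ℝ, B ≤ A → C ((A : ℂ)⁻¹) * p ∈ polyBall (N σ) n := by
  obtain ⟨c, hc, hcN⟩ := hN.lower σ
  refine ⟨(∑ m ∈ p.support, ‖coeff m p‖) * c ^ n + 1, by positivity, fun A hA =>
    ⟨hp.C_mul _, fun v => ?_⟩⟩
  have hA0 : 0 < A := lt_of_lt_of_le (by positivity) hA
  rw [map_mul, eval_C, norm_mul, norm_inv, Complex.norm_real, Real.norm_of_nonneg hA0.le,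
    inv_mul_le_iff₀ hA0]
  refine (norm_eval_le hp (hcN v)).trans ?_
  rw [mul_pow, ← mul_assoc]
  exact mul_le_mul_of_nonneg_right (by linarith) (pow_nonneg (hN.nonneg _ _) _)

/-- A common archimedean bound for finitely many polynomials. -/
theorem exists_polyBall_uniform {N : (k →+* ℂ) → (τ → ℂ) → ℝ} (hN : GoodNorm N) {I : Type}
    [Finite I] {n : ℕ} (p : (k →+* ℂ) → I → MvPolynomial τ ℂ)
    (hp : ∀ σ i, (p σ i).IsHomogeneous n) :
    ∃ A : ℝ, 0 < A ∧ ∀ σ i, C ((A : ℂ)⁻¹) * p σ i ∈ polyBall (N σ) n := by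
  have := Fintype.ofFinite I
  choose B hB hB' using fun σ i => exists_polyBall hN σ (hp σ i)
  refine ⟨∑ σ, ∑ i, B σ i + 1, add_pos_of_nonneg_of_pos (Finset.sum_nonneg fun σ _ =>
    Finset.sum_nonneg fun i _ => (hB σ i).le) one_pos, fun σ i => hB' σ i _ ?_⟩
  have h1 := Finset.single_le_sum (f := B σ) (fun i _ => (hB σ i).le) (Finset.mem_univ i)
  have h2 := Finset.single_le_sum (f := fun σ => ∑ i, B σ i)
    (fun σ _ => Finset.sum_nonneg fun i _ => (hB σ i).le) (Finset.mem_univ σ)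
  linarith

theorem exists_integral_multiple {n : ℕ} {f : MvPolynomial τ k} (hf : f.IsHomogeneous n) :
    ∃ d : 𝓞 k, d ≠ 0 ∧ ∃ g : MvPolynomial τ (𝓞 k), g.IsHomogeneous n ∧
      toK g = C (algebraMap (𝓞 k) k d) * f := by
  obtain ⟨d, hd⟩ := IsLocalization.exist_integer_multiples (nonZeroDivisors (𝓞 k)) f.support
    (fun m => coeff m f)
  have : ∀ m, ∃ y : 𝓞 k, m ∈ f.support →
      algebraMap (𝓞 k) k y = algebraMap (𝓞 k) k d * coeff m f := by
    intro m
    by_cases hm : m ∈ f.support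
    · obtain ⟨y, hy⟩ := hd m hm
      exact ⟨y, fun _ => by rw [hy, Algebra.smul_def]⟩
    · exact ⟨0, fun h => absurd h hm⟩
  choose y hy using this
  refine ⟨d, nonZeroDivisors.ne_zero d.2, ∑ m ∈ f.support, monomial m (y m),
    IsHomogeneous.sum _ _ _ fun m hm => isHomogeneous_monomial _ ?_, ?_⟩
  · rw [Finsupp.degree_eq_weight_one]
    exact hf (mem_support_iff.mp hm)
  · conv_rhs => rw [f.as_sum, Finset.mul_sum]
    refine (map_sum (map (algebraMap (𝓞 k) k)) _ _).trans ?_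
    refine Finset.sum_congr rfl fun m hm => ?_
    rw [map_monomial, hy m hm, C_mul_monomial]

/-- The degree `n` part of the quotient by `J`. -/
def gradedPiece (J : Ideal (MvPolynomial τ k)) (n : ℕ) : Submodule k (MvPolynomial τ k ⧸ J) :=
  Submodule.map (Ideal.Quotient.mkₐ k J).toLinearMap (homogeneousSubmodule τ k n)

instance (J : Ideal (MvPolynomial τ k)) (n : ℕ) : FiniteDimensional k (gradedPiece J n) := by
  have : (homogeneousSubmodule τ k n).FG := homogeneousSubmodule_fg _ _ n
  exact Module.Finite.iff_fg.mpr (this.map _)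

/-- The Hilbert function. -/
def hilbFun (J : Ideal (MvPolynomial τ k)) (n : ℕ) : ℕ := Module.finrank k (gradedPiece J n)

theorem mk_mem_gradedPiece (J : Ideal (MvPolynomial τ k)) {n : ℕ} {f : MvPolynomial τ k}
    (hf : f.IsHomogeneous n) : Ideal.Quotient.mk J f ∈ gradedPiece J n := ⟨f, hf, rfl⟩

/-- A basis of the graded piece gives a basis of homogeneous polynomials modulo `J`. -/
theorem card_eq_hilbFun {J : Ideal (MvPolynomial τ k)} {n : ℕ} {I : Type} [Fintype I]
    {b : I → MvPolynomial τ k} (hb : ∀ i, (b i).IsHomogeneous n)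
    (h : ∀ t : I → k, ∑ i, C (t i) * b i ∈ J → t = 0)
    (h' : ∀ f : MvPolynomial τ k, f.IsHomogeneous n → ∃ t : I → k, f - ∑ i, C (t i) * b i ∈ J) :
    Fintype.card I = hilbFun J n := by
  let u : I → gradedPiece J n := fun i => ⟨Ideal.Quotient.mk J (b i), mk_mem_gradedPiece J (hb i)⟩
  have key : ∀ t : I → k, ((∑ i, t i • u i : gradedPiece J n) : MvPolynomial τ k ⧸ J) =
      Ideal.Quotient.mk J (∑ i, C (t i) * b i) := by
    intro t
    rw [map_sum, AddSubmonoidClass.coe_finsetSum]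
    refine Finset.sum_congr rfl fun i _ => ?_
    rw [← smul_eq_C_mul]
    rfl
  have hli : LinearIndependent k u := by
    rw [Fintype.linearIndependent_iff]
    intro t ht i
    have := h t (by rw [← Ideal.Quotient.eq_zero_iff_mem, ← key, ht]; rfl)
    exact congrFun this i
  have hsp : ⊤ ≤ Submodule.span k (Set.range u) := by
    rintro ⟨_, f, hf, rfl⟩ -
    obtain ⟨t, ht⟩ := h' f hf
    rw [Submodule.mem_span_range_iff_exists_fun]
    refine ⟨t, Subtype.ext ?_⟩
    rw [key]
    exact (Ideal.Quotient.eq.mpr ht).symm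
  rw [hilbFun, Module.finrank_eq_card_basis (Module.Basis.mk hli hsp)]

theorem Frame.card_eq {N : (k →+* ℂ) → (τ → ℂ) → ℝ} {J : Ideal (MvPolynomial τ k)} {n : ℕ}
    {I : Type} [Fintype I] {v : ℝ} (h : Frame N J n I v) : Fintype.card I = hilbFun J n := by
  obtain ⟨b, b1, b2, b3, -⟩ := h
  exact card_eq_hilbFun (fun i => (b1 i).map _) b2 b3

theorem Frame.toFin {N : (k →+* ℂ) → (τ → ℂ) → ℝ} {J : Ideal (MvPolynomial τ k)} {n : ℕ}
    {I : Type} [Fintype I] {v : ℝ} (h : Frame N J n I v) : Frame N J n (Fin (hilbFun J n)) v :=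
  h.reindex (Fintype.equivFinOfCardEq h.card_eq)

theorem Frame.exists_of_basis {N : (k →+* ℂ) → (τ → ℂ) → ℝ} (hN : GoodNorm N)
    {J : Ideal (MvPolynomial τ k)} {n : ℕ} {I : Type} [Fintype I]
    (u : Module.Basis I k (gradedPiece J n)) : ∃ v, Frame N J n I v := by
  have : ∀ i, ∃ b : MvPolynomial τ (𝓞 k), b.IsHomogeneous n ∧ ∃ d : k, d ≠ 0 ∧
      Ideal.Quotient.mk J (toK b) = d • (u i : MvPolynomial τ k ⧸ J) := by
    intro i
    obtain ⟨f, hf, hfu⟩ := (u i).2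
    obtain ⟨d, hd, g, hg, hgf⟩ := exists_integral_multiple hf
    refine ⟨g, hg, algebraMap (𝓞 k) k d, ?_, ?_⟩
    · simpa using hd
    · rw [hgf, ← smul_eq_C_mul, ← hfu]
      rfl
  choose b hb d hd hbd using this
  have key : ∀ t : I → k, Ideal.Quotient.mk J (∑ i, C (t i) * toK (b i)) =
      ((∑ i, (t i * d i) • u i : gradedPiece J n) : MvPolynomial τ k ⧸ J) := by
    intro t
    rw [map_sum, AddSubmonoidClass.coe_finsetSum]
    refine Finset.sum_congr rfl fun i _ => ?_
    rw [← smul_eq_C_mul, mul_smul]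
    change t i • Ideal.Quotient.mk J (toK (b i)) = _
    rw [hbd]
    rfl
  obtain ⟨A, hA, hAb⟩ := exists_polyBall_uniform hN (fun σ i => map σ (toK (b i)))
    (fun σ i => ((hb i).map _).map σ)
  refine ⟨_, b, hb, fun t ht => ?_, fun f hf => ?_, fun σ => ((A : ℂ)⁻¹) • (1 : Matrix _ _ ℂ),
    fun σ => ⟨?_, fun i => ⟨_, hAb σ i, ?_⟩⟩, le_rfl⟩
  · have h1 : ∑ i, (t i * d i) • u i = 0 := by
      apply Subtype.ext
      rw [← key, Ideal.Quotient.eq_zero_iff_mem.mpr ht]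
      rfl
    have h2 := Fintype.linearIndependent_iff.mp u.linearIndependent _ h1
    funext i
    exact (mul_eq_zero.mp (h2 i)).resolve_right (hd i)
  · refine ⟨fun i => u.repr ⟨_, mk_mem_gradedPiece J hf⟩ i / d i, ?_⟩
    rw [← Ideal.Quotient.eq, key]
    simp only [div_mul_cancel₀ _ (hd _)]
    rw [u.sum_repr]
  · rw [Matrix.det_smul, Matrix.det_one, mul_one]
    exact pow_ne_zero _ (inv_ne_zero (by exact_mod_cast hA.ne'))
  · convert Ideal.zero_mem (Ideal.map (map σ) J) using 1
    rw [Finset.sum_eq_single i]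
    · simp
    · intro j _ hj
      simp [Matrix.one_apply_ne' hj]
    · simp

theorem Frame.trivial {N : (k →+* ℂ) → (τ → ℂ) → ℝ} (hN : GoodNorm N)
    (J : Ideal (MvPolynomial τ k)) (n : ℕ) : ∃ v, Frame N J n (Fin (hilbFun J n)) v := by
  obtain ⟨v, hv⟩ := Frame.exists_of_basis hN (Module.finBasis k (gradedPiece J n))
  exact ⟨v, hv.toFin⟩

/-- Archimedean bound for a single integral polynomial. -/
theorem exists_lift_bound {N : (k →+* ℂ) → (τ → ℂ) → ℝ} (hN : GoodNorm N)
    (J : Ideal (MvPolynomial τ k)) {a : MvPolynomial τ (𝓞 k)} {e : ℕ} (ha : a.IsHomogeneous e) :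
    ∃ A : ℝ, 0 < A ∧ ∀ σ, ∃ p, C ((A : ℂ)⁻¹) * p ∈ polyBall (N σ) e ∧
      p - map σ (toK a) ∈ J.map (map σ) := by
  obtain ⟨A, hA, h⟩ := exists_polyBall_uniform hN (I := Unit) (fun σ _ => map σ (toK a))
    (fun σ _ => (ha.map _).map σ)
  exact ⟨A, hA, fun σ => ⟨_, h σ (), by rw [sub_self]; exact Ideal.zero_mem _⟩⟩

theorem hilbFun_add {N : (k →+* ℂ) → (τ → ℂ) → ℝ} (hN : GoodNorm N)
    {J : Ideal (MvPolynomial τ k)} (hJ : IsHom J) {a : MvPolynomial τ (𝓞 k)} {e : ℕ}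
    (ha : a.IsHomogeneous e) (n : ℕ) :
    hilbFun J (n + e) =
      hilbFun (colonI J (toK a)) n + hilbFun (J ⊔ Ideal.span {toK a}) (n + e) := by
  obtain ⟨v, hv⟩ := Frame.trivial hN (colonI J (toK a)) n
  obtain ⟨v', hv'⟩ := Frame.trivial hN (J ⊔ Ideal.span {toK a}) (n + e)
  obtain ⟨A, hA, h⟩ := exists_lift_bound hN J ha
  rw [← (Frame.union hJ ha hA h hv hv').card_eq, Fintype.card_sum, Fintype.card_fin,
    Fintype.card_fin]

/-- The union step, with index sets normalized. -/
theorem Frame.union' {N : (k →+* ℂ) → (τ → ℂ) → ℝ} {J : Ideal (MvPolynomial τ k)} (hJ : IsHom J)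
    {n e : ℕ} {v v' : ℝ} {a : MvPolynomial τ (𝓞 k)}
    (ha : a.IsHomogeneous e) {A : ℝ} (hA : 0 < A)
    (hlift : ∀ σ, ∃ p, C ((A : ℂ)⁻¹) * p ∈ polyBall (N σ) e ∧
      p - map σ (toK a) ∈ J.map (map σ))
    (h : Frame N (colonI J (toK a)) n (Fin (hilbFun (colonI J (toK a)) n)) v)
    (h' : Frame N (J ⊔ Ideal.span {toK a}) (n + e)
      (Fin (hilbFun (J ⊔ Ideal.span {toK a}) (n + e))) v') :
    Frame N J (n + e) (Fin (hilbFun J (n + e)))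
      (v + v' - hilbFun (colonI J (toK a)) n * (Module.finrank ℚ k * Real.log A)) := by
  have := (Frame.union hJ ha hA hlift h h').toFin
  rwa [Fintype.card_fin] at this

end Trivial

section Minkowski
open Matrix MeasureTheory

/-- Minkowski's theorem for a positive definite real quadratic form. -/
theorem exists_int_quadForm_le {Q : Type} [Fintype Q] [Nonempty Q] {G : Matrix Q Q ℝ}
    (hG : G.PosDef) : ∃ y : Q → ℤ, y ≠ 0 ∧
      (fun i => (y i : ℝ)) ⬝ᵥ (G *ᵥ fun i => (y i : ℝ)) ≤
        Fintype.card Q * Real.exp (Real.log G.det / Fintype.card Q) := by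
  obtain ⟨R, rfl⟩ : ∃ R : Matrix Q Q ℝ, G = Rᵀ * R := by
    open scoped MatrixOrder in
    obtain ⟨R, hR⟩ := CStarAlgebra.nonneg_iff_eq_star_mul_self.mp hG.posSemidef.nonneg
    rw [star_eq_conjTranspose, conjTranspose_eq_transpose_of_trivial] at hR
    exact ⟨R, hR⟩
  have hdet : R.det ≠ 0 := fun h => by
    have := hG.det_pos
    rw [det_mul, h, mul_zero] at this
    exact this.false
  let b : Module.Basis Q ℝ (Q → ℝ) :=
    (Pi.basisFun ℝ Q).map ((Matrix.toLin'OfInv (nonsing_inv_mul R hdet.isUnit)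
      (mul_nonsing_inv R hdet.isUnit)))
  have hb : ∀ j i, b j i = R i j := fun j i => by
    simp [b]
  set q := Fintype.card Q with hq
  have hq0 : (q : ℝ) ≠ 0 := by
    rw [hq]
    exact_mod_cast Fintype.card_ne_zero
  let c : ℝ := Real.exp (Real.log |R.det| / q)
  have hc : 0 < c := Real.exp_pos _
  have hcq : c ^ q = |R.det| := by
    rw [← Real.exp_nat_mul, mul_div_cancel₀ _ hq0, Real.exp_log (abs_pos.mpr hdet)]
  have : Nontrivial (Q → ℝ) := inferInstance
  have hvol : volume (ZSpan.fundamentalDomain b) * 2 ^ Module.finrank ℝ (Q → ℝ) ≤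
      volume (Metric.closedBall (0 : Q → ℝ) c) := by
    rw [ZSpan.volume_fundamentalDomain, Real.volume_pi_closedBall _ hc.le,
      Module.finrank_fintype_fun_eq_card, ← hq]
    have h1 : (Matrix.of b).det = R.det := by
      rw [← det_transpose]
      congr 1
      ext i j
      exact hb j i
    rw [h1, mul_pow, hcq, mul_comm, ENNReal.ofReal_mul (by positivity),
      ENNReal.ofReal_pow zero_le_two]
    simp
  have : DiscreteTopology (Submodule.span ℤ (Set.range b)).toAddSubgroup :=
    inferInstanceAs (DiscreteTopology (Submodule.span ℤ (Set.range b)))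
  have : Countable (Submodule.span ℤ (Set.range b)).toAddSubgroup :=
    inferInstanceAs (Countable (Submodule.span ℤ (Set.range b)))
  obtain ⟨x, hx0, hx⟩ := exists_ne_zero_mem_lattice_of_measure_mul_two_pow_le_measure
    (ZSpan.isAddFundamentalDomain' b volume) (fun x hx => by simpa using hx)
    (convex_closedBall (0 : Q → ℝ) c) (isCompact_closedBall _ _) hvol
  obtain ⟨x, hxL⟩ := x
  obtain ⟨y, hy⟩ := (Submodule.mem_span_range_iff_exists_fun ℤ).mp hxL
  have hxy : R *ᵥ (fun i => (y i : ℝ)) = x := by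
    rw [← hy]
    ext i
    simp [mulVec, dotProduct, hb, mul_comm]
  refine ⟨y, ?_, ?_⟩
  · rintro rfl
    apply hx0
    ext1
    simpa using hy.symm
  · rw [← mulVec_mulVec, dotProduct_mulVec, vecMul_transpose, hxy, det_mul, det_transpose]
    have h2 : ∀ i, x i * x i ≤ c ^ 2 := fun i => by
      have h3 := (norm_le_pi_norm x i).trans (mem_closedBall_zero_iff.mp hx)
      rw [Real.norm_eq_abs] at h3
      nlinarith [abs_nonneg (x i), abs_mul_abs_self (x i)]
    calc x ⬝ᵥ x ≤ ∑ _i : Q, c ^ 2 := Finset.sum_le_sum fun i _ => h2 i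
      _ = q * c ^ 2 := by rw [Finset.sum_const, nsmul_eq_mul, Finset.card_univ]
      _ = _ := by
        rw [← Real.exp_nat_mul, Real.log_mul hdet hdet, Real.log_abs]
        congr 2
        push_cast
        ring

/-- Minkowski's theorem for a system of complex linear forms stable under conjugation. -/
theorem exists_int_linearForm_le {P Q : Type} [Fintype P] [Fintype Q] [Nonempty Q]
    {T : Matrix P Q ℂ} (π : P ≃ P) (hπ : ∀ p q, T (π p) q = starRingEnd ℂ (T p q))
    (e : Q ≃ P) (hdet : (T.submatrix e id).det ≠ 0) : ∃ y : Q → ℤ, y ≠ 0 ∧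
      ∑ p, ‖∑ q, T p q * (y q : ℂ)‖ ^ 2 ≤ Fintype.card Q *
        Real.exp (2 * Real.log ‖(T.submatrix e id).det‖ / Fintype.card Q) := by
  set T' := T.submatrix e id with hT'
  have hG : ∀ i j, (T'ᴴ * T') i j = ∑ p, starRingEnd ℂ (T p i) * T p j := fun i j => by
    rw [mul_apply, ← e.sum_comp]
    rfl
  have hre : ∀ i j, (T'ᴴ * T') i j = (((T'ᴴ * T') i j).re : ℂ) := fun i j => by
    rw [eq_comm, ← Complex.conj_eq_iff_re, hG, map_sum]
    conv_rhs => rw [← π.sum_comp]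
    refine Finset.sum_congr rfl fun p _ => ?_
    rw [hπ, hπ, map_mul]
  set G : Matrix Q Q ℝ := Matrix.of fun i j => ((T'ᴴ * T') i j).re with hGdef
  have hGT : G.map (algebraMap ℝ ℂ) = T'ᴴ * T' := by
    ext i j
    exact (hre i j).symm
  have hquad : ∀ x : Q → ℝ, x ⬝ᵥ (G *ᵥ x) = ∑ p, ‖∑ q, T p q * (x q : ℂ)‖ ^ 2 := fun x => by
    have h1 : (((x ⬝ᵥ (G *ᵥ x) : ℝ)) : ℂ) = ((∑ p, ‖∑ q, T p q * (x q : ℂ)‖ ^ 2 : ℝ) : ℂ) := by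
      have h2 : ((x ⬝ᵥ (G *ᵥ x) : ℝ) : ℂ) =
          (fun q => (x q : ℂ)) ⬝ᵥ (G.map (algebraMap ℝ ℂ) *ᵥ fun q => (x q : ℂ)) := by
        simp [dotProduct, mulVec]
      have h3 : (fun q => (x q : ℂ)) ᵥ* T'ᴴ = star (T' *ᵥ fun q => (x q : ℂ)) := by
        rw [star_mulVec]
        congr 1
        ext q
        simp
      rw [h2, hGT, ← mulVec_mulVec, dotProduct_mulVec, h3, Complex.ofReal_sum, ← e.sum_comp]
      refine Finset.sum_congr rfl fun q _ => ?_
      rw [Complex.ofReal_pow, ← Complex.conj_mul']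
      rfl
    exact_mod_cast h1
  have hdetG : ((G.det : ℝ) : ℂ) = (‖T'.det‖ ^ 2 : ℝ) := by
    have := RingHom.map_det (algebraMap ℝ ℂ) G
    rw [RingHom.mapMatrix_apply, hGT, det_mul, det_conjTranspose] at this
    rw [Complex.ofReal_pow, ← Complex.conj_mul']
    exact this
  have hdetG' : G.det = ‖T'.det‖ ^ 2 := by exact_mod_cast hdetG
  have hpos : G.PosDef := by
    refine .of_dotProduct_mulVec_pos ?_ fun x hx => ?_
    · ext i j
      rw [conjTranspose_apply, star_trivial, hGdef, of_apply, of_apply, hG, hG, Complex.re_sum,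
        Complex.re_sum]
      refine Finset.sum_congr rfl fun p _ => ?_
      rw [← Complex.conj_re, map_mul, Complex.conj_conj, mul_comm]
    · rw [star_trivial, hquad]
      refine lt_of_le_of_ne (by positivity) fun h0 => hx ?_
      have h1 := (Finset.sum_eq_zero_iff_of_nonneg (fun p _ => by positivity)).mp h0.symm
      have h2 : T' *ᵥ (fun q => (x q : ℂ)) = 0 := by
        ext q
        have := h1 (e q) (Finset.mem_univ _)
        simpa [mulVec, dotProduct, hT'] using this
      have h3 := eq_zero_of_mulVec_eq_zero hdet h2
      funext q
      simpa using congrFun h3 q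
  obtain ⟨y, hy, hy'⟩ := exists_int_quadForm_le hpos
  refine ⟨y, hy, ?_⟩
  rw [hquad, hdetG', Real.log_pow] at hy'
  exact_mod_cast hy'

end Minkowski

section Small
open NumberField Module
variable {k : Type} [Field k] [NumberField k] {τ : Type} [Fintype τ]

theorem polyBall_conj {N : (k →+* ℂ) → (τ → ℂ) → ℝ} (hN : GoodNorm N) {σ : k →+* ℂ} {n : ℕ}
    {c : MvPolynomial τ ℂ} (hc : c ∈ polyBall (N σ) n) :
    map (starRingEnd ℂ) c ∈ polyBall (N ((starRingEnd ℂ).comp σ)) n := by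
  refine ⟨hc.1.map _, fun v => ?_⟩
  have h1 : eval v (map (starRingEnd ℂ) c) =
      starRingEnd ℂ (eval (fun i => starRingEnd ℂ (v i)) c) := by
    rw [eval_map, eval₂_eq', eval_eq', map_sum]
    simp
  rw [h1, RCLike.norm_conj]
  convert hc.2 _ using 2
  rw [← hN.conj σ]
  simp

/-- The archimedean conditions in the definition of a frame. -/
def ArchBasis (N : (k →+* ℂ) → (τ → ℂ) → ℝ) (J : Ideal (MvPolynomial τ k)) (n : ℕ)
    {I : Type} [Fintype I] (b : I → MvPolynomial τ (𝓞 k)) (σ : k →+* ℂ) (M : Matrix I I ℂ) : Prop :=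
  M.det ≠ 0 ∧ ∀ i, ∃ c ∈ polyBall (N σ) n,
        c - ∑ j, C (M i j) * map σ (toK (b j)) ∈ J.map (map σ)

theorem det_map_conj {I : Type} [Fintype I] (M : Matrix I I ℂ) :
    (M.map (starRingEnd ℂ)).det = starRingEnd ℂ M.det :=
  (RingHom.map_det (starRingEnd ℂ) M).symm

theorem conj_comp_conj (σ : k →+* ℂ) :
    (starRingEnd ℂ).comp ((starRingEnd ℂ).comp σ) = σ := by
  ext x
  simp

theorem ArchBasis.conj {N : (k →+* ℂ) → (τ → ℂ) → ℝ} (hN : GoodNorm N)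
    {J : Ideal (MvPolynomial τ k)} {n : ℕ} {I : Type} [Fintype I]
    {b : I → MvPolynomial τ (𝓞 k)} {σ : k →+* ℂ} {M : Matrix I I ℂ} (h : ArchBasis N J n b σ M) :
    ArchBasis N J n b ((starRingEnd ℂ).comp σ) (M.map (starRingEnd ℂ)) := by
  refine ⟨by rw [det_map_conj]; exact (map_ne_zero _).mpr h.1, fun i => ?_⟩
  obtain ⟨c, hc, hc'⟩ := h.2 i
  refine ⟨_, polyBall_conj hN hc, ?_⟩
  have h1 := Ideal.mem_map_of_mem (map (starRingEnd ℂ)) hc'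
  have h2 : (map (σ := τ) (starRingEnd ℂ)).comp (map σ) = map ((starRingEnd ℂ).comp σ) :=
    RingHom.ext fun x => map_map _ _ _
  rw [Ideal.map_map, h2] at h1
  convert h1 using 1
  rw [map_sub]
  congr 1
  refine .trans ?_ (map_sum (map (starRingEnd ℂ)) _ _).symm
  simp [map_map, RingHom.comp_assoc]

theorem ArchBasis.exists_symm [IsTotallyComplex k] {N : (k →+* ℂ) → (τ → ℂ) → ℝ} (hN : GoodNorm N)
    {J : Ideal (MvPolynomial τ k)} {n : ℕ} {I : Type} [Fintype I]
    {b : I → MvPolynomial τ (𝓞 k)} {M : (k →+* ℂ) → Matrix I I ℂ}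
    (h : ∀ σ, ArchBasis N J n b σ (M σ)) :
    ∃ M' : (k →+* ℂ) → Matrix I I ℂ, (∀ σ, ArchBasis N J n b σ (M' σ)) ∧
      (∀ σ, M' ((starRingEnd ℂ).comp σ) = (M' σ).map (starRingEnd ℂ)) ∧
      ∑ σ, Real.log ‖(M σ).det‖ ≤ ∑ σ, Real.log ‖(M' σ).det‖ := by
  let P : (k →+* ℂ) → Matrix I I ℂ := fun σ =>
    if ‖(M ((starRingEnd ℂ).comp σ)).det‖ ≤ ‖(M σ).det‖ then M σ
    else (M ((starRingEnd ℂ).comp σ)).map (starRingEnd ℂ)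
  have hP1 : ∀ σ, ArchBasis N J n b σ (P σ) := fun σ => by
    by_cases hc : ‖(M ((starRingEnd ℂ).comp σ)).det‖ ≤ ‖(M σ).det‖
    · simpa only [P, if_pos hc] using h σ
    · simp only [P, if_neg hc]
      have := (h ((starRingEnd ℂ).comp σ)).conj hN
      rwa [conj_comp_conj] at this
  have hP2 : ∀ σ, ‖(M σ).det‖ ≤ ‖(P σ).det‖ ∧
      ‖(M ((starRingEnd ℂ).comp σ)).det‖ ≤ ‖(P σ).det‖ := fun σ => by
    by_cases hc : ‖(M ((starRingEnd ℂ).comp σ)).det‖ ≤ ‖(M σ).det‖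
    · simp only [P, if_pos hc]
      exact ⟨le_rfl, hc⟩
    · simp only [P, if_neg hc, det_map_conj, RCLike.norm_conj]
      exact ⟨(not_le.mp hc).le, le_rfl⟩
  let M' : (k →+* ℂ) → Matrix I I ℂ := fun σ =>
    if σ = (InfinitePlace.mk σ).embedding then P σ
    else (P ((starRingEnd ℂ).comp σ)).map (starRingEnd ℂ)
  refine ⟨M', fun σ => ?_, fun σ => ?_, Finset.sum_le_sum fun σ _ => ?_⟩
  · by_cases hc : σ = (InfinitePlace.mk σ).embedding
    · simpa only [M', if_pos hc] using hP1 σ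
    · simp only [M', if_neg hc]
      have := (hP1 ((starRingEnd ℂ).comp σ)).conj hN
      rwa [conj_comp_conj] at this
  · have hmk : InfinitePlace.mk ((starRingEnd ℂ).comp σ) = InfinitePlace.mk σ :=
      InfinitePlace.mk_conjugate_eq σ
    have hne : (starRingEnd ℂ).comp σ ≠ σ := fun h0 =>
      IsTotallyComplex.complexEmbedding_not_isReal σ h0
    by_cases hc : σ = (InfinitePlace.mk σ).embedding
    · have hc' : ¬ (starRingEnd ℂ).comp σ =
          (InfinitePlace.mk ((starRingEnd ℂ).comp σ)).embedding := by
        rw [hmk, ← hc]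
        exact hne
      simp only [M', if_neg hc', if_pos hc, conj_comp_conj]
    · have hc' : (starRingEnd ℂ).comp σ =
          (InfinitePlace.mk ((starRingEnd ℂ).comp σ)).embedding := by
        rw [hmk]
        rcases InfinitePlace.embedding_mk_eq σ with h1 | h1
        · exact absurd h1.symm hc
        · exact h1.symm
      simp only [M', if_pos hc', if_neg hc]
      ext i j
      simp
  · have h0 : ‖(M σ).det‖ ≤ ‖(M' σ).det‖ := by
      by_cases hc : σ = (InfinitePlace.mk σ).embedding
      · simp only [M', if_pos hc]
        exact (hP2 σ).1
      · simp only [M', if_neg hc, det_map_conj, RCLike.norm_conj]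
        have := (hP2 ((starRingEnd ℂ).comp σ)).2
        rwa [conj_comp_conj] at this
    exact Real.log_le_log (norm_pos_iff.mpr (h σ).1) h0

/-- The matrix of the embeddings of an integral basis, rows being reindexed. -/
theorem exists_equiv_det_ne_zero (k : Type) [Field k] [NumberField k] :
    ∃ f : Free.ChooseBasisIndex ℤ (𝓞 k) ≃ (k →+* ℂ),
      (Matrix.of fun γ β => f γ (RingOfIntegers.basis k β)).det ≠ 0 := by
  let f : Free.ChooseBasisIndex ℤ (𝓞 k) ≃ (k →+* ℂ) := Fintype.equivOfCardEq
    ((finrank_eq_card_basis (integralBasis k)).symm.trans (Embeddings.card k ℂ).symm)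
  refine ⟨f, ?_⟩
  let L := (canonicalEmbedding.latticeBasis k).reindex f
  have h1 := (Module.Basis.isUnit_det (Pi.basisFun ℂ (k →+* ℂ)) L).ne_zero
  rw [Module.Basis.det_apply, ← Matrix.det_submatrix_equiv_self f] at h1
  convert h1 using 2
  ext γ β
  simp [L, Module.Basis.toMatrix_apply, canonicalEmbedding.latticeBasis_apply]

open Matrix Kronecker in
/-- Integral elements with small coordinates in the archimedean bases. -/
theorem exists_small_coords {I : Type} [Fintype I] [Nonempty I] (k : Type) [Field k]
    [NumberField k] {f : Free.ChooseBasisIndex ℤ (𝓞 k) ≃ (k →+* ℂ)}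
    (hf : (Matrix.of fun γ β => f γ (RingOfIntegers.basis k β)).det ≠ 0)
    (M : (k →+* ℂ) → Matrix I I ℂ) (hM : ∀ σ, (M σ).det ≠ 0)
    (hsymm : ∀ σ, M ((starRingEnd ℂ).comp σ) = (M σ).map (starRingEnd ℂ)) :
    ∃ y : I → 𝓞 k, y ≠ 0 ∧ ∑ p : I × (k →+* ℂ), ‖∑ j, p.2 (y j) * (M p.2)⁻¹ j p.1‖ ^ 2 ≤
      (Fintype.card I * finrank ℚ k : ℕ) * Real.exp (2 * (Fintype.card I *
        Real.log ‖(Matrix.of fun γ β => f γ (RingOfIntegers.basis k β)).det‖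
          - ∑ σ, Real.log ‖(M σ).det‖) / (Fintype.card I * finrank ℚ k : ℕ)) := by
  let B := Free.ChooseBasisIndex ℤ (𝓞 k)
  set Ω : Matrix B B ℂ := Matrix.of fun γ β => f γ (RingOfIntegers.basis k β) with hΩ
  let T : Matrix (I × (k →+* ℂ)) (I × B) ℂ := Matrix.of fun p q =>
    p.2 (RingOfIntegers.basis k q.2) * (M p.2)⁻¹ q.1 p.1
  let c : (k →+* ℂ) ≃ (k →+* ℂ) :=
    ⟨fun σ => (starRingEnd ℂ).comp σ, fun σ => (starRingEnd ℂ).comp σ, conj_comp_conj,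
        conj_comp_conj⟩
  have hinv : ∀ σ, (M ((starRingEnd ℂ).comp σ))⁻¹ = (M σ)⁻¹.map (starRingEnd ℂ) := fun σ => by
    refine Matrix.inv_eq_right_inv ?_
    rw [hsymm, ← Matrix.map_mul, Matrix.mul_nonsing_inv _ (hM σ).isUnit]
    simp
  have hT : T.submatrix ((Equiv.refl I).prodCongr f) id =
      blockDiagonal (fun γ => (M (f γ))⁻¹ᵀ) * ((1 : Matrix I I ℂ) ⊗ₖ Ω) := by
    ext p q
    rw [mul_apply, Fintype.sum_prod_type]
    simp [T, blockDiagonal_apply, one_apply, hΩ, mul_comm]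
  have hdet : ‖(T.submatrix ((Equiv.refl I).prodCongr f) id).det‖ =
      (∏ σ, ‖(M σ).det‖)⁻¹ * ‖Ω.det‖ ^ Fintype.card I := by
    rw [hT, det_mul, det_blockDiagonal, det_kronecker, det_one, one_pow, one_mul, norm_mul,
      norm_pow, norm_prod, ← f.prod_comp, ← Finset.prod_inv_distrib]
    congr 1
    refine Finset.prod_congr rfl fun γ _ => ?_
    rw [det_transpose, det_nonsing_inv, Ring.inverse_eq_inv', norm_inv]
  have hdet' : ‖@Matrix.det (I × B) (fun a b => Classical.propDecidable (a = b)) _ _ _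
      (T.submatrix ((Equiv.refl I).prodCongr f) id)‖ =
      (∏ σ, ‖(M σ).det‖)⁻¹ * ‖Ω.det‖ ^ Fintype.card I := by
    convert hdet
  have hpos : 0 < ∏ σ, ‖(M σ).det‖ := Finset.prod_pos fun σ _ => norm_pos_iff.mpr (hM σ)
  have hΩ0 : 0 < ‖Ω.det‖ := norm_pos_iff.mpr hf
  have : Nonempty B := ⟨f.symm (Classical.arbitrary _)⟩
  obtain ⟨y, hy, hy'⟩ := exists_int_linearForm_le (T := T) ((Equiv.refl I).prodCongr c)
    (fun p q => by simp [T, c, hinv]) ((Equiv.refl I).prodCongr f) (by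
      rw [← norm_pos_iff]
      rw [hdet']
      positivity)
  have hcard : Fintype.card (I × B) = Fintype.card I * finrank ℚ k := by
    rw [Fintype.card_prod, finrank_eq_card_basis (integralBasis k)]
  rw [hdet', hcard, Real.log_mul (inv_pos.mpr hpos).ne' (by positivity), Real.log_inv,
    Real.log_pow, Real.log_prod (fun σ _ => (norm_pos_iff.mpr (hM σ)).ne'), neg_add_eq_sub] at hy'
  refine ⟨fun j => ∑ β, y (j, β) • RingOfIntegers.basis k β, fun h => hy ?_, ?_⟩
  · funext q
    have := Fintype.linearIndependent_iff.mp (RingOfIntegers.basis k).linearIndependent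
      (fun β => y (q.1, β)) (congrFun h q.1) q.2
    exact this
  · convert hy' using 4 with p
    rw [Fintype.sum_prod_type]
    congr 1
    funext j
    simp only [T, Matrix.of_apply, map_sum, Finset.sum_mul, zsmul_eq_mul, map_mul, map_intCast]
    refine Finset.sum_congr rfl fun β _ => ?_
    ring

/-- Minkowski's theorem for frames. -/
theorem exists_small_section (k : Type) [Field k] [NumberField k] [IsTotallyComplex k] :
    ∃ B : ℝ, ∀ {τ : Type} [Fintype τ] {N : (k →+* ℂ) → (τ → ℂ) → ℝ}, GoodNorm N →
      ∀ {J : Ideal (MvPolynomial τ k)} {n ρ : ℕ} {v : ℝ} {I : Type} [Fintype I],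
      Fintype.card I = ρ → 0 < ρ → Frame N J n I v →
      ∃ s : MvPolynomial τ (𝓞 k), s.IsHomogeneous n ∧ toK s ∉ J ∧ ∃ A : ℝ, 0 < A ∧
        finrank ℚ k * Real.log A ≤ -(v / ρ) + B + finrank ℚ k * Real.log ρ ∧
        ∀ σ, ∃ p, C ((A : ℂ)⁻¹) * p ∈ polyBall (N σ) n ∧
          p - map σ (toK s) ∈ J.map (map σ) := by
  obtain ⟨f, hf⟩ := exists_equiv_det_ne_zero k
  set ω : ℝ := Real.log ‖(Matrix.of fun γ β => f γ (RingOfIntegers.basis k β)).det‖ with hω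
  set D := finrank ℚ k with hD
  have hD0 : (0 : ℝ) < D := by exact_mod_cast finrank_pos
  refine ⟨D * Real.log D + ω, fun {τ _ N} hN {J n ρ v I _} hI hρ h => ?_⟩
  obtain ⟨b, hb, hind, -, M₀, hM₀, hv₀⟩ := h
  obtain ⟨M, hM, hsymm, hV⟩ := ArchBasis.exists_symm hN (b := b) hM₀
  have : Nonempty I := Fintype.card_pos_iff.mp (hI ▸ hρ)
  obtain ⟨y, hy, hy'⟩ := exists_small_coords k hf M (fun σ => (hM σ).1) hsymm
  rw [← hω, ← hD, hI] at hy'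
  have hρ0 : (0 : ℝ) < ρ := by exact_mod_cast hρ
  set n' : ℝ := ((ρ * D : ℕ) : ℝ) with hn'
  have hn'' : n' = ρ * D := by rw [hn']; push_cast; rfl
  have hn0 : 0 < n' := by rw [hn'']; positivity
  let A : ℝ := n' * Real.exp ((ρ * ω - v) / n')
  have hA : 0 < A := by positivity
  let z : (k →+* ℂ) → I → ℂ := fun σ i => ∑ j, σ (y j) * (M σ)⁻¹ j i
  have hz : ∀ σ, ∑ i, ‖z σ i‖ ≤ A := fun σ => by
    refine abs_le_of_sq_le_sq' ?_ hA.le |>.2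
    have h1 : ∑ i, ‖z σ i‖ ^ 2 ≤ n' * Real.exp (2 * (ρ * ω - v) / n') := by
      refine le_trans ?_ (hy'.trans ?_)
      · rw [Fintype.sum_prod_type_right]
        exact Finset.single_le_sum (f := fun σ => ∑ i, ‖z σ i‖ ^ 2)
          (fun σ _ => Finset.sum_nonneg fun i _ => by positivity) (Finset.mem_univ σ)
      · have h3 := hv₀.trans hV
        exact mul_le_mul_of_nonneg_left (Real.exp_le_exp.mpr
          (div_le_div_of_nonneg_right (by linarith) hn0.le)) hn0.le
    have h2 : (ρ : ℝ) ≤ n' := by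
      rw [hn'']
      have : (1 : ℝ) ≤ D := by exact_mod_cast finrank_pos
      nlinarith
    calc (∑ i, ‖z σ i‖) ^ 2 ≤ ρ * ∑ i, ‖z σ i‖ ^ 2 := by
          simpa [hI] using sq_sum_le_card_mul_sum_sq (s := Finset.univ) (f := fun i => ‖z σ i‖)
      _ ≤ n' * (n' * Real.exp (2 * (ρ * ω - v) / n')) := by gcongr
      _ = A ^ 2 := by
        rw [mul_pow, ← Real.exp_nat_mul, ← mul_assoc, sq]
        congr 2
        push_cast
        ring
  refine ⟨∑ j, C (y j) * b j, ?_, fun hs => hy ?_, A, hA, ?_, fun σ => ?_⟩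
  · exact IsHomogeneous.sum _ _ _ fun j _ => (hb j).C_mul _
  · have h1 := hind (fun j => algebraMap (𝓞 k) k (y j)) (by
      convert hs using 1
      refine .trans ?_ (map_sum (map (algebraMap (𝓞 k) k)) _ _).symm
      simp)
    funext j
    exact FaithfulSMul.algebraMap_injective (𝓞 k) k ((congrFun h1 j).trans (map_zero _).symm)
  · rw [Real.log_mul hn0.ne' (Real.exp_pos _).ne', Real.log_exp, hn'', Real.log_mul hρ0.ne' hD0.ne']
    refine le_of_eq ?_
    field_simp
    ring
  · choose c hc hc' using (hM σ).2
    refine ⟨∑ i, C (z σ i) * c i, ⟨?_, fun w => ?_⟩, ?_⟩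
    · exact (IsHomogeneous.sum _ _ _ fun i _ => (hc i).1.C_mul _).C_mul _
    · rw [map_mul, eval_C, map_sum, norm_mul, norm_inv, Complex.norm_real,
          Real.norm_of_nonneg hA.le,
        inv_mul_le_iff₀ hA]
      calc ‖∑ i, eval w (C (z σ i) * c i)‖ ≤ ∑ i, ‖z σ i‖ * N σ w ^ n := norm_sum_le_of_le _
            fun i _ => by
              rw [map_mul, eval_C, norm_mul]
              exact mul_le_mul_of_nonneg_left ((hc i).2 w) (norm_nonneg _)
        _ ≤ A * N σ w ^ n := by
          rw [← Finset.sum_mul]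
          exact mul_le_mul_of_nonneg_right (hz σ) (pow_nonneg (hN.nonneg _ _) _)
    · have h1 : ∀ j, ∑ i, z σ i * M σ i j = σ (y j) := fun j => by
        have : (fun i => z σ i) = Matrix.vecMul (fun j => σ (y j)) (M σ)⁻¹ := rfl
        change Matrix.vecMul (fun i => z σ i) (M σ) j = _
        rw [this, Matrix.vecMul_vecMul, Matrix.nonsing_inv_mul _ (hM σ).1.isUnit, Matrix.vecMul_one]
      have h2 : ∑ i, C (z σ i) * c i - map σ (toK (∑ j, C (y j) * b j)) =
          ∑ i, C (z σ i) * (c i - ∑ j, C (M σ i j) * map σ (toK (b j))) := by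
        have h3 : map σ (toK (∑ j, C (y j) * b j)) =
            ∑ j, C (σ (y j)) * map σ (toK (b j)) := by
          refine .trans (congrArg _ (map_sum (map (algebraMap (𝓞 k) k)) _ _)) ?_
          simp
        rw [h3]
        simp_rw [mul_sub, Finset.sum_sub_distrib, Finset.mul_sum, ← mul_assoc, ← C_mul]
        rw [Finset.sum_comm]
        simp_rw [← Finset.sum_mul, ← map_sum, h1]
      rw [h2]
      exact Ideal.sum_mem _ fun i _ => Ideal.mul_mem_left _ _ (hc' i)

end Small

section Growth
open Filter

/-- Either eventually zero or of exact polynomial order. -/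
def Growth (f : ℕ → ℕ) : Prop :=
  (∃ n₀, ∀ n ≥ n₀, f n = 0) ∨ ∃ (d : ℕ) (c₁ c₂ : ℝ) (n₀ : ℕ), 0 < c₁ ∧
    ∀ n ≥ n₀, c₁ * (n : ℝ) ^ d ≤ f n ∧ (f n : ℝ) ≤ c₂ * (n : ℝ) ^ d

theorem Growth.congr' {f g : ℕ → ℕ} (hf : Growth f) {m : ℕ} (h : ∀ n ≥ m, f n = g n) :
    Growth g := by
  rcases hf with ⟨n₀, h0⟩ | ⟨d, c₁, c₂, n₀, hc, h1⟩
  · exact .inl ⟨max n₀ m, fun n hn => by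
      rw [← h n (le_of_max_le_right hn), h0 n (le_of_max_le_left hn)]⟩
  · exact .inr ⟨d, c₁, c₂, max n₀ m, hc, fun n hn => by
      rw [← h n (le_of_max_le_right hn)]
      exact h1 n (le_of_max_le_left hn)⟩

theorem Growth.shift {f g : ℕ → ℕ} (hf : Growth f) {e : ℕ} (h : ∀ n, g (n + e) = f n) :
    Growth g := by
  have hg : ∀ n ≥ e, g n = f (n - e) := fun n hn => by rw [← h, Nat.sub_add_cancel hn]
  rcases hf with ⟨n₀, h0⟩ | ⟨d, c₁, c₂, n₀, hc, h1⟩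
  · exact .inl ⟨n₀ + e, fun n hn => by rw [hg n (by omega), h0 _ (by omega)]⟩
  · refine .inr ⟨d, c₁ / 2 ^ d, |c₂|, n₀ + 2 * e, by positivity, fun n hn => ?_⟩
    rw [hg n (by omega)]
    obtain ⟨h2, h3⟩ := h1 (n - e) (by omega)
    constructor
    · refine le_trans ?_ h2
      rw [div_mul_eq_mul_div, div_le_iff₀ (by positivity), mul_assoc, ← mul_pow]
      gcongr
      have : n ≤ (n - e) * 2 := by omega
      exact_mod_cast this
    · refine h3.trans ((mul_le_mul_of_nonneg_right (le_abs_self c₂) (by positivity)).trans ?_)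
      gcongr
      omega

theorem Growth.add {f g : ℕ → ℕ} (hf : Growth f) (hg : Growth g) : Growth fun n => f n + g n := by
  rcases hf with ⟨n₀, h0⟩ | ⟨d, c₁, c₂, n₀, hc, h1⟩
  · exact hg.congr' (m := n₀) fun n hn => by simp [h0 n hn]
  have hf : Growth f := .inr ⟨d, c₁, c₂, n₀, hc, h1⟩
  rcases hg with ⟨m₀, h0⟩ | ⟨e, b₁, b₂, m₀, hb, h2⟩
  · exact hf.congr' (m := m₀) fun n hn => by simp [h0 n hn]
  refine .inr ⟨max d e, min c₁ b₁, |c₂| + |b₂|, max 1 (max n₀ m₀), by positivity, fun n hn => ?_⟩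
  have hn1 : (1 : ℝ) ≤ n := by exact_mod_cast le_of_max_le_left hn
  obtain ⟨h3, h4⟩ := h1 n (le_of_max_le_left (le_of_max_le_right hn))
  obtain ⟨h5, h6⟩ := h2 n (le_of_max_le_right (le_of_max_le_right hn))
  push_cast
  constructor
  · rcases max_choice d e with h | h <;> rw [h]
    · have : min c₁ b₁ * (n : ℝ) ^ d ≤ c₁ * (n : ℝ) ^ d := by gcongr; exact min_le_left _ _
      have : (0 : ℝ) ≤ g n := by positivity
      linarith
    · have : min c₁ b₁ * (n : ℝ) ^ e ≤ b₁ * (n : ℝ) ^ e := by gcongr; exact min_le_right _ _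
      have : (0 : ℝ) ≤ f n := by positivity
      linarith
  · rw [add_mul]
    refine add_le_add (h4.trans ?_) (h6.trans ?_)
    · exact (mul_le_mul_of_nonneg_right (le_abs_self c₂) (by positivity)).trans
        (mul_le_mul_of_nonneg_left (pow_le_pow_right₀ hn1 (le_max_left _ _)) (abs_nonneg _))
    · exact (mul_le_mul_of_nonneg_right (le_abs_self b₂) (by positivity)).trans
        (mul_le_mul_of_nonneg_left (pow_le_pow_right₀ hn1 (le_max_right _ _)) (abs_nonneg _))

/-- Summation raises the order by one, and the average of a sequence of positive polynomial order
is smaller than its last value by a definite factor. -/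
theorem growth_sum {ρ h : ℕ → ℕ} (hρ : ∀ n, ρ (n + 1) = ρ n + h (n + 1)) {d n₀ : ℕ} {c₁ c₂ : ℝ}
    (hc : 0 < c₁) (hh : ∀ n ≥ n₀, c₁ * (n : ℝ) ^ d ≤ h n ∧ (h n : ℝ) ≤ c₂ * (n : ℝ) ^ d) :
    Growth ρ ∧ (∃ (C : ℝ) (n₁ : ℕ), ∀ n ≥ n₁, (ρ n : ℝ) ≤ C * (n : ℝ) ^ (d + 1)) ∧
    ∃ η : ℝ, 0 < η ∧ η ≤ 1 ∧ ∃ n₁, ∀ n ≥ n₁,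
      ∑ t ∈ Finset.range n, (ρ t : ℝ) ≤ (1 - η) * n * ρ n := by
  have hmono : Monotone ρ := monotone_nat_of_le_succ fun n => by rw [hρ]; omega
  have hc₂ : 0 < c₂ := by
    obtain ⟨h1, h2⟩ := hh (n₀ + 1) (by omega)
    have h3 := h1.trans h2
    have h4 : (0 : ℝ) < ((n₀ + 1 : ℕ) : ℝ) ^ d := by positivity
    exact lt_of_lt_of_le hc (le_of_mul_le_mul_right h3 h4)
  have hup : ∀ j, (ρ (n₀ + j) : ℝ) ≤ ρ n₀ + j * (c₂ * ((n₀ + j : ℕ) : ℝ) ^ d) := fun j => by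
    induction j with
    | zero => simp
    | succ j ih =>
      rw [← add_assoc, hρ]
      push_cast at ih ⊢
      have h1 := (hh (n₀ + j + 1) (by omega)).2
      push_cast at h1
      have h2 : (j : ℝ) * (c₂ * ((n₀ : ℝ) + j) ^ d) ≤ j * (c₂ * ((n₀ : ℝ) + j + 1) ^ d) := by
        refine mul_le_mul_of_nonneg_left (mul_le_mul_of_nonneg_left ?_ hc₂.le) (by positivity)
        exact pow_le_pow_left₀ (by positivity) (by linarith) d
      nlinarith
  have hlo : ∀ m ≥ n₀, ∀ j, (ρ m : ℝ) + j * (c₁ * (m : ℝ) ^ d) ≤ ρ (m + j) := fun m hm j => by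
    induction j with
    | zero => simp
    | succ j ih =>
      rw [← add_assoc, hρ]
      push_cast at ih ⊢
      have h1 := (hh (m + j + 1) (by omega)).1
      push_cast at h1
      have h2 : c₁ * (m : ℝ) ^ d ≤ c₁ * ((m : ℝ) + j + 1) ^ d := by
        gcongr
        linarith
      nlinarith
  have hup' : ∀ n ≥ n₀ + 1, (ρ n : ℝ) ≤ (ρ n₀ + c₂) * (n : ℝ) ^ (d + 1) := fun n hn => by
    have h1 := hup (n - n₀)
    rw [Nat.add_sub_cancel' (by omega)] at h1
    have hn1 : (1 : ℝ) ≤ n := by exact_mod_cast (by omega : 1 ≤ n)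
    have h2 : ((n - n₀ : ℕ) : ℝ) ≤ n := by exact_mod_cast Nat.sub_le _ _
    have h3 : ((n - n₀ : ℕ) : ℝ) * (c₂ * (n : ℝ) ^ d) ≤ n * (c₂ * (n : ℝ) ^ d) := by gcongr
    have h4 : (ρ n₀ : ℝ) ≤ ρ n₀ * (n : ℝ) ^ (d + 1) :=
      le_mul_of_one_le_right (by positivity) (one_le_pow₀ hn1)
    calc (ρ n : ℝ) ≤ ρ n₀ * (n : ℝ) ^ (d + 1) + n * (c₂ * (n : ℝ) ^ d) := by linarith
      _ = _ := by ring
  have hhalf : ∀ n ≥ 4 * n₀ + 4, (ρ (n / 2) : ℝ) + c₁ / 4 ^ (d + 1) * (n : ℝ) ^ (d + 1) ≤ ρ n :=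
    fun n hn => by
    have h1 := hlo (n / 2) (by omega) (n - n / 2)
    rw [Nat.add_sub_cancel' (by omega)] at h1
    refine le_trans ?_ h1
    have h2 : (n : ℝ) / 4 ≤ ((n - n / 2 : ℕ) : ℝ) := by
      rw [div_le_iff₀ (by norm_num)]
      exact_mod_cast (by omega : n ≤ (n - n / 2) * 4)
    have h3 : (n : ℝ) / 4 ≤ ((n / 2 : ℕ) : ℝ) := by
      rw [div_le_iff₀ (by norm_num)]
      exact_mod_cast (by omega : n ≤ (n / 2) * 4)
    have h4 : c₁ / 4 ^ (d + 1) * (n : ℝ) ^ (d + 1) = (n / 4) * (c₁ * ((n : ℝ) / 4) ^ d) := by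
      rw [div_pow]
      field_simp
      ring
    rw [h4]
    gcongr
  refine ⟨.inr ⟨d + 1, c₁ / 4 ^ (d + 1), ρ n₀ + c₂, 4 * n₀ + 4, by positivity, fun n hn =>
    ⟨?_, hup' n (by omega)⟩⟩, ⟨_, _, hup'⟩, ?_⟩
  · have := hhalf n hn
    have : (0 : ℝ) ≤ ρ (n / 2) := by positivity
    linarith
  · let κ : ℝ := c₁ / 4 ^ (d + 1) / (ρ n₀ + c₂)
    have hκ : 0 < κ := by positivity
    refine ⟨min 1 (κ / 2), by positivity, min_le_left _ _, 4 * n₀ + 4, fun n hn => ?_⟩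
    have h1 : (ρ (n / 2) : ℝ) ≤ (1 - κ) * ρ n := by
      have h2 := hhalf n hn
      have h3 : κ * ρ n ≤ c₁ / 4 ^ (d + 1) * (n : ℝ) ^ (d + 1) := by
        have := mul_le_mul_of_nonneg_left (hup' n (by omega)) hκ.le
        refine this.trans (le_of_eq ?_)
        simp only [κ]
        field_simp
      linarith
    have h2 : ∀ t ∈ Finset.range n, (ρ t : ℝ) ≤ if t ≤ n / 2 then (1 - κ) * ρ n else ρ n :=
      fun t ht => by
      split_ifs with h
      · refine le_trans ?_ h1
        exact_mod_cast hmono h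
      · exact_mod_cast hmono (Finset.mem_range.mp ht).le
    refine (Finset.sum_le_sum h2).trans ?_
    have h3 : ∀ t, (if t ≤ n / 2 then (1 - κ) * (ρ n : ℝ) else ρ n) =
        ρ n - if t ≤ n / 2 then κ * ρ n else 0 := fun t => by
      split_ifs <;> ring
    simp_rw [h3]
    rw [Finset.sum_sub_distrib, Finset.sum_const, Finset.card_range, ← Finset.sum_filter,
      Finset.sum_const, nsmul_eq_mul, nsmul_eq_mul]
    have h4 : (n : ℝ) / 2 ≤ ((Finset.range n).filter (· ≤ n / 2)).card := by
      have : Finset.range (n / 2 + 1) ⊆ (Finset.range n).filter (· ≤ n / 2) := fun t ht => by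
        rw [Finset.mem_range] at ht
        rw [Finset.mem_filter, Finset.mem_range]
        omega
      have h5 := Finset.card_le_card this
      rw [Finset.card_range] at h5
      rw [div_le_iff₀ (by norm_num)]
      exact_mod_cast (by omega : n ≤ _ * 2)
    have h5 : (n : ℝ) / 2 * (κ * ρ n) ≤
        ((Finset.range n).filter (· ≤ n / 2)).card * (κ * ρ n) := by gcongr
    have h6 : min 1 (κ / 2) * (n * ρ n : ℝ) ≤ κ / 2 * (n * ρ n) := by
      gcongr
      exact min_le_right _ _
    linarith

end Growth

section Achievable
open Module
variable {k : Type} [Field k] [NumberField k] {τ : Type} [Fintype τ]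
  {N : (k →+* ℂ) → (τ → ℂ) → ℝ} {J : Ideal (MvPolynomial τ k)}

/-- Frames of normalized degree at least `a * n - C` exist in all degrees `n`. -/
def Ach (N : (k →+* ℂ) → (τ → ℂ) → ℝ) (J : Ideal (MvPolynomial τ k)) (a : ℝ) : Prop :=
  ∃ C : ℝ, ∀ n, Frame N J n (Fin (hilbFun J n)) ((a * n - C) * hilbFun J n)

theorem Ach.mono {a b : ℝ} (h : Ach N J a) (hb : b ≤ a) : Ach N J b := by
  obtain ⟨C, hC⟩ := h
  refine ⟨C, fun n => (hC n).mono ?_⟩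
  gcongr

theorem Frame.zero_of_isEmpty {n : ℕ} {I : Type} [Fintype I] [IsEmpty I] {v : ℝ}
    (h : Frame N J n I v) : Frame N J n I 0 := by
  obtain ⟨b, h1, h2, h3, M, h4, h5⟩ := h
  refine ⟨b, h1, h2, h3, M, h4, ?_⟩
  simp [Matrix.det_isEmpty]

theorem ach_of_eventually (hN : GoodNorm N) {a C : ℝ} {n₀ : ℕ}
    (h : ∀ n ≥ n₀, Frame N J n (Fin (hilbFun J n)) ((a * n - C) * hilbFun J n)) : Ach N J a := by
  choose v hv using Frame.trivial hN J
  refine ⟨|C| + ∑ n ∈ Finset.range n₀, |a * n - v n / hilbFun J n|, fun n => ?_⟩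
  have hsum : 0 ≤ ∑ n ∈ Finset.range n₀, |a * n - v n / hilbFun J n| :=
    Finset.sum_nonneg fun _ _ => abs_nonneg _
  by_cases hn : n₀ ≤ n
  · refine (h n hn).mono (mul_le_mul_of_nonneg_right ?_ (by positivity))
    linarith [le_abs_self C]
  · have h1 := Finset.single_le_sum (f := fun n : ℕ => |a * n - v n / hilbFun J n|) (fun _ _ =>
        abs_nonneg _)
      (Finset.mem_range.mpr (not_le.mp hn))
    rcases Nat.eq_zero_or_pos (hilbFun J n) with h0 | h0
    · have : IsEmpty (Fin (hilbFun J n)) := by rw [h0]; infer_instance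
      refine (hv n).zero_of_isEmpty.mono ?_
      simp [h0]
    · refine (hv n).mono ?_
      have h2 := (le_abs_self _).trans h1
      have h3 : (0 : ℝ) < hilbFun J n := by exact_mod_cast h0
      rw [← le_div_iff₀ h3]
      linarith [abs_nonneg C]

theorem colonI_eq_self (hJ : J.IsPrime) {a : MvPolynomial τ k} (ha : a ∉ J) : colonI J a = J :=
  le_antisymm (fun _ hf => (hJ.mem_or_mem hf).resolve_left ha)
    fun _ hf => Ideal.mul_mem_left _ _ hf

/-- Multiplication by a small element `s` and lifting from `J + (s)`. -/
theorem exists_frame_of_mul (hN : GoodNorm N) (hJ : IsHom J) (hmono : Monotone (hilbFun J))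
    {s : MvPolynomial τ (𝓞 k)} {m : ℕ} (hm : 0 < m) (hs : s.IsHomogeneous m)
    (hcol : colonI J (toK s) = J) {A : ℝ} (hA : 0 < A)
    (hlift : ∀ σ, ∃ p, C ((A : ℂ)⁻¹) * p ∈ polyBall (N σ) m ∧ p - map σ (toK s) ∈ J.map (map σ))
    {α a' : ℝ} (hα : α ≤ a') (hAα : finrank ℚ k * Real.log A ≤ -(α * m))
    (ha' : Ach N (J ⊔ Ideal.span {toK s}) a') :
    ∃ C C' : ℝ, ∀ n, Frame N J n (Fin (hilbFun J n)) ((a' * n - C) * hilbFun J n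
      - (a' - α) * ∑ t ∈ Finset.range n, (hilbFun J t : ℝ) - C') := by
  obtain ⟨C₀, hC₀⟩ := ha'
  choose v hv using Frame.trivial hN J
  let C' : ℝ := ∑ n ∈ Finset.range m, |(a' * n - C₀) * hilbFun J n - v n|
  refine ⟨C₀, C', fun n => ?_⟩
  induction n using Nat.strong_induction_on with
  | _ n ih =>
    by_cases hn : n < m
    · refine (hv n).mono ?_
      have h1 := Finset.single_le_sum (f := fun n : ℕ => |(a' * n - C₀) * hilbFun J n - v n|)
        (fun _ _ => abs_nonneg _) (Finset.mem_range.mpr hn)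
      have h2 : 0 ≤ (a' - α) * ∑ t ∈ Finset.range n, (hilbFun J t : ℝ) :=
        mul_nonneg (by linarith) (Finset.sum_nonneg fun _ _ => by positivity)
      have h3 := (le_abs_self _).trans h1
      change _ ≤ C' at h3
      linarith
    · obtain ⟨n, rfl⟩ := Nat.exists_eq_add_of_le' (not_lt.mp hn)
      have h1 := ih n (by omega)
      have h2 := hC₀ (n + m)
      have h3 := hilbFun_add hN hJ hs n
      rw [hcol] at h3
      have h1' : Frame N (colonI J (toK s)) n (Fin (hilbFun (colonI J (toK s)) n))
          ((a' * n - C₀) * hilbFun J n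
            - (a' - α) * ∑ t ∈ Finset.range n, (hilbFun J t : ℝ) - C') := by
        rw [hcol]
        exact h1
      refine (Frame.union' hJ hs hA hlift h1' h2).mono ?_
      rw [hcol]
      have h4 : (hilbFun (J ⊔ Ideal.span {toK s}) (n + m) : ℝ) =
          hilbFun J (n + m) - hilbFun J n := by
        rw [h3]
        push_cast
        ring
      have h5 : (m : ℝ) * hilbFun J n + ∑ t ∈ Finset.range n, (hilbFun J t : ℝ) ≤
          ∑ t ∈ Finset.range (n + m), (hilbFun J t : ℝ) := by
        rw [Finset.sum_range_add, add_comm]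
        gcongr
        rw [← nsmul_eq_mul, ← Finset.card_range m, ← Finset.sum_const, Finset.card_range]
        exact Finset.sum_le_sum fun t _ => by exact_mod_cast hmono (Nat.le_add_right _ _)
      have h6 := mul_le_mul_of_nonneg_left h5 (sub_nonneg.mpr hα)
      have h7 := mul_le_mul_of_nonneg_left hAα (Nat.cast_nonneg (α := ℝ) (hilbFun J n))
      rw [h4]
      push_cast
      nlinarith

/-- One improvement step. -/
theorem ach_of_mul (hN : GoodNorm N) (hJ : IsHom J) (hmono : Monotone (hilbFun J))
    (hpos : ∀ n, 0 < hilbFun J n)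
    {η : ℝ} {n₁ : ℕ} (hη : ∀ n ≥ n₁, ∑ t ∈ Finset.range n, (hilbFun J t : ℝ) ≤
      (1 - η) * n * hilbFun J n)
    {s : MvPolynomial τ (𝓞 k)} {m : ℕ} (hm : 0 < m) (hs : s.IsHomogeneous m)
    (hcol : colonI J (toK s) = J) {A : ℝ} (hA : 0 < A)
    (hlift : ∀ σ, ∃ p, C ((A : ℂ)⁻¹) * p ∈ polyBall (N σ) m ∧ p - map σ (toK s) ∈ J.map (map σ))
    {α a' : ℝ} (hα : α ≤ a') (hAα : finrank ℚ k * Real.log A ≤ -(α * m))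
    (ha' : Ach N (J ⊔ Ideal.span {toK s}) a') : Ach N J (α + η * (a' - α)) := by
  obtain ⟨C₀, C', h⟩ := exists_frame_of_mul hN hJ hmono hm hs hcol hA hlift hα hAα ha'
  refine ach_of_eventually hN (C := C₀ + |C'|) (n₀ := n₁) fun n hn => (h n).mono ?_
  have h1 := mul_le_mul_of_nonneg_left (hη n hn) (sub_nonneg.mpr hα)
  have h2 : (1 : ℝ) ≤ hilbFun J n := by exact_mod_cast hpos n
  have h3 : C' ≤ |C'| * hilbFun J n :=
    (le_abs_self C').trans (le_mul_of_one_le_right (abs_nonneg _) h2)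
  nlinarith

theorem hilbFun_pos (hJp : J.IsPrime) {i : τ} (hi : (X i : MvPolynomial τ k) ∉ J) (n : ℕ) :
    0 < hilbFun J n := by
  rw [hilbFun, Module.finrank_pos_iff_exists_ne_zero]
  refine ⟨⟨_, mk_mem_gradedPiece J (isHomogeneous_X_pow i n)⟩, fun h => hi ?_⟩
  have h1 := congrArg Subtype.val h
  exact hJp.mem_of_pow_mem n (Ideal.Quotient.eq_zero_iff_mem.mp h1)

/-- The logarithm of a sequence of at most polynomial growth is sublinear. -/
theorem exists_log_le_mul {f : ℕ → ℕ} {c : ℝ} {d n₀ : ℕ}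
    (h : ∀ n ≥ n₀, (f n : ℝ) ≤ c * (n : ℝ) ^ d) {ε : ℝ} (hε : 0 < ε) (B D : ℝ) (hD : 0 ≤ D) :
    ∃ n₁, ∀ n ≥ n₁, B + D * Real.log (f n) ≤ ε * n := by
  have h1 : Filter.Tendsto (fun n : ℕ => (B + D * (Real.log (|c| + 1) + d * Real.log n)) / (n : ℝ))
      Filter.atTop (nhds 0) := by
    have h2 : Filter.Tendsto (fun n : ℕ => Real.log n / (n : ℝ)) Filter.atTop (nhds 0) :=
      (Real.isLittleO_log_id_atTop.tendsto_div_nhds_zero).comp tendsto_natCast_atTop_atTop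
    have h3 := (tendsto_const_div_atTop_nhds_zero_nat (B + D * Real.log (|c| + 1))).add
      (h2.const_mul (D * d))
    rw [mul_zero, add_zero] at h3
    refine h3.congr fun n => ?_
    ring
  have h2 := h1.eventually_le_const hε
  obtain ⟨n₁, hn⟩ := Filter.eventually_atTop.mp h2
  refine ⟨max (n₁ + 1) n₀, fun n hn' => ?_⟩
  have hn0 : 0 < n := by omega
  have hn0' : (0 : ℝ) < n := by exact_mod_cast hn0
  have h3 := hn n (by omega)
  rw [div_le_iff₀ hn0'] at h3
  refine le_trans ?_ h3
  rcases Nat.eq_zero_or_pos (f n) with h0 | h0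
  · rw [h0, Nat.cast_zero, Real.log_zero]
    have : 0 ≤ Real.log (|c| + 1) := Real.log_nonneg (by linarith [abs_nonneg c])
    have : 0 ≤ Real.log n := Real.log_natCast_nonneg n
    have : 0 ≤ D * (Real.log (|c| + 1) + d * Real.log n) := by positivity
    linarith
  · have h4 : (f n : ℝ) ≤ (|c| + 1) * (n : ℝ) ^ d :=
      (h n (by omega)).trans (mul_le_mul_of_nonneg_right (by linarith [le_abs_self c])
        (by positivity))
    have h5 := Real.log_le_log (by exact_mod_cast h0) h4
    rw [Real.log_mul (by positivity) (by positivity), Real.log_pow] at h5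
    gcongr

/-- The prime case of positive dimension. -/
theorem ach_of_isPrime [NumberField.IsTotallyComplex k] (hN : GoodNorm N) (hJ : IsHom J)
    (hJp : J.IsPrime) {i : τ} (hi : (X i : MvPolynomial τ k) ∉ J)
    {a₁ : ℝ} (hsup : ∀ J' : Ideal (MvPolynomial τ k), IsHom J' → J < J' → ∀ a < a₁, Ach N J' a)
    {d n₀ : ℕ} {c₁ c₂ : ℝ} (hc : 0 < c₁)
    (hh : ∀ n ≥ n₀, c₁ * (n : ℝ) ^ d ≤ hilbFun (J ⊔ Ideal.span {X i}) n ∧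
      (hilbFun (J ⊔ Ideal.span {X i}) n : ℝ) ≤ c₂ * (n : ℝ) ^ d) :
    Growth (hilbFun J) ∧ ∀ a < a₁, Ach N J a := by
  have hXK : toK (X i : MvPolynomial τ (𝓞 k)) = X i := map_X _ _
  have hlt : ∀ {s : MvPolynomial τ k} {e : ℕ}, s.IsHomogeneous e → s ∉ J →
      IsHom (J ⊔ Ideal.span {s}) ∧ J < J ⊔ Ideal.span {s} := fun {s e} hs hsJ =>
    ⟨hJ.sup (isHom_span fun f hf => ⟨e, by rwa [Set.mem_singleton_iff.mp hf]⟩),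
      lt_of_le_of_ne le_sup_left fun h => hsJ (h ▸ Ideal.mem_sup_right
        (Ideal.mem_span_singleton_self s))⟩
  have hcolX : colonI J (X i) = J := colonI_eq_self hJp hi
  have hρ : ∀ n, hilbFun J (n + 1) = hilbFun J n + hilbFun (J ⊔ Ideal.span {X i}) (n + 1) :=
    fun n => by
    have := hilbFun_add hN hJ (isHomogeneous_X (𝓞 k) i) n
    rwa [hXK, hcolX] at this
  have hmono : Monotone (hilbFun J) := monotone_nat_of_le_succ fun n => by rw [hρ]; omega
  have hpos := hilbFun_pos hJp hi
  obtain ⟨hg, ⟨C₂, n₂, hup⟩, η, hη0, hη1, n₁, hη⟩ := growth_sum hρ hc hh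
  refine ⟨hg, fun a ha => ?_⟩
  obtain ⟨a', ha1, ha2⟩ := exists_between ha
  obtain ⟨B, hB⟩ := exists_small_section k
  have step : ∀ b ≤ a, Ach N J b → Ach N J (b + η / 2 * (a' - a)) := by
    intro b hb ⟨C, hC⟩
    let ε := η * (a' - a) / 2
    have hε : 0 < ε := by
      have : 0 < a' - a := by linarith
      positivity
    obtain ⟨n₃, hn₃⟩ := exists_log_le_mul hup hε (C + B) (finrank ℚ k) (by positivity)
    let m := max 1 n₃
    have hm : 0 < m := by positivity
    have hρ0 : (0 : ℝ) < hilbFun J m := by exact_mod_cast hpos m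
    obtain ⟨s, hs, hsJ, A, hA, hlog, hlift⟩ := hB hN (Fintype.card_fin _) (hpos m) (hC m)
    rw [mul_div_cancel_right₀ _ hρ0.ne'] at hlog
    have hs' := hlt (hs.map _) hsJ
    have h1 := hn₃ m (le_max_right _ _)
    have h2 := ach_of_mul hN hJ hmono hpos hη hm hs (colonI_eq_self hJp hsJ) hA hlift
      (α := b - ε) (a' := a') (by linarith) (by linarith) (hsup _ hs'.1 hs'.2 a' ha2)
    refine h2.mono ?_
    have h3 : 0 ≤ η * ε := by positivity
    have h4 : η * (a' - a) ≤ η * (a' - b) := by gcongr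
    simp only [ε] at h3 ⊢
    nlinarith
  have start : ∃ b, b ≤ a ∧ Ach N J b := by
    obtain ⟨A, hA, hlift⟩ := exists_lift_bound hN J (isHomogeneous_X (𝓞 k) i)
    have hX' := hlt (isHomogeneous_X k i) hi
    let α := min a' (-(finrank ℚ k * Real.log A))
    have h1 := ach_of_mul hN hJ hmono hpos hη one_pos (isHomogeneous_X (𝓞 k) i)
      (by rw [hXK]; exact hcolX) hA hlift (α := α) (min_le_left _ _)
      (by
        have := min_le_right a' (-(finrank ℚ k * Real.log A))
        rw [Nat.cast_one, mul_one]
        linarith) (by rw [hXK]; exact hsup _ hX'.1 hX'.2 a' ha2)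
    exact ⟨min a _, min_le_left _ _, h1.mono (min_le_right _ _)⟩
  obtain ⟨b, hb, hb'⟩ := start
  have hκ : 0 < η / 2 * (a' - a) := mul_pos (by positivity) (by linarith)
  have iter : ∀ n : ℕ, Ach N J (min a (b + n * (η / 2 * (a' - a)))) := fun n => by
    induction n with
    | zero => exact hb'.mono (by simp)
    | succ n ih =>
      refine (step _ (min_le_left _ _) ih).mono ?_
      push_cast
      rcases le_total a (b + n * (η / 2 * (a' - a))) with h | h
      · rw [min_eq_left h]
        exact (min_le_left _ _).trans (by linarith)
      · rw [min_eq_right h]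
        exact (min_le_right _ _).trans (by linarith)
  obtain ⟨n, hn⟩ := Archimedean.arch (a - b) hκ
  refine (iter n).mono (le_min le_rfl ?_)
  rw [nsmul_eq_mul] at hn
  linarith

end Achievable

section Point
open Module
variable {k : Type} [Field k] [NumberField k] {τ : Type} [Fintype τ]
  {N : (k →+* ℂ) → (τ → ℂ) → ℝ} {J : Ideal (MvPolynomial τ k)}

theorem aeval_smul_of_isHomogeneous {R S : Type} [CommRing R] [CommRing S] [Algebra R S]
    {f : MvPolynomial τ R} {n : ℕ} (hf : f.IsHomogeneous n) (c : S) (v : τ → S) :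
    aeval (fun j => c * v j) f = c ^ n * aeval v f := by
  simp only [aeval_def, eval₂_eq, Finset.mul_sum]
  refine Finset.sum_congr rfl fun m hm => ?_
  rw [IsHomogeneous.degree_eq_sum_deg_support hf hm, ← Finset.prod_pow_eq_pow_sum]
  simp only [mul_pow, Finset.prod_mul_distrib]
  ring

/-- A homogeneous prime with bounded Hilbert function is the ideal of a closed point. -/
theorem exists_point (hJp : J.IsPrime) {i : τ} (hi : (X i : MvPolynomial τ k) ∉ J)
    {D : ℕ} (hD : ∀ n, hilbFun J n ≤ D) :
    ∃ (K' : Type) (_ : Field K') (_ : NumberField K') (_ : Algebra k K') (θ : τ → 𝓞 K'),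
      θ i ≠ 0 ∧
      (∀ n, ∀ f : MvPolynomial τ k, f.IsHomogeneous n →
        (aeval (fun j => (θ j : K')) f = 0 ↔ f ∈ J)) ∧
      ∀ x : K', ∃ n, ∃ f : MvPolynomial τ k, f.IsHomogeneous n ∧
        x * (θ i : K') ^ n = aeval (fun j => (θ j : K')) f := by
  have := Ideal.Quotient.isDomain J
  let L := FractionRing (MvPolynomial τ k ⧸ J)
  let q : MvPolynomial τ k →ₐ[k] L :=
    (Algebra.ofId (MvPolynomial τ k ⧸ J) L |>.restrictScalars k).comp (Ideal.Quotient.mkₐ k J)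
  have hq : ∀ f, q f = 0 ↔ f ∈ J := fun f => by
    change algebraMap (MvPolynomial τ k ⧸ J) L (Ideal.Quotient.mk J f) = 0 ↔ _
    rw [FaithfulSMul.algebraMap_eq_zero_iff, Ideal.Quotient.eq_zero_iff_mem]
  have hqi : q (X i) ≠ 0 := fun h => hi ((hq _).mp h)
  let t : τ → L := fun j => q (X j) / q (X i)
  have hti : t i = 1 := div_self hqi
  have haev : ∀ {n} {f : MvPolynomial τ k}, f.IsHomogeneous n → q f = q (X i) ^ n * aeval t f :=
    fun {n f} hf => by
    rw [← aeval_smul_of_isHomogeneous hf]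
    have : (fun j => q (X i) * t j) = fun j => q (X j) := funext fun j => mul_div_cancel₀ _ hqi
    rw [this]
    exact congrArg (· f) (aeval_unique q)
  have hint : ∀ j, IsIntegral k (t j) := fun j => by
    rw [← isAlgebraic_iff_isIntegral]
    let u : Fin (D + 1) → gradedPiece J D := fun a =>
      ⟨_, mk_mem_gradedPiece J (f := X j ^ (a : ℕ) * X i ^ (D - a)) (by
        have := (isHomogeneous_X_pow (R := k) j a).mul (isHomogeneous_X_pow (R := k) i (D - a))
        rwa [Nat.add_sub_cancel' (by omega)] at this)⟩
    have hu : ¬ LinearIndependent k u := fun h => by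
      have h1 := h.fintype_card_le_finrank
      rw [Fintype.card_fin] at h1
      have := hD D
      rw [hilbFun] at this
      omega
    rw [Fintype.not_linearIndependent_iff] at hu
    obtain ⟨g, hg, a₀, ha₀⟩ := hu
    have h1 := congrArg (fun y : gradedPiece J D => algebraMap (MvPolynomial τ k ⧸ J) L
      (y : MvPolynomial τ k ⧸ J)) hg
    have h2 : ∑ a, algebraMap k L (g a) * (q (X j) ^ (a : ℕ) * q (X i) ^ (D - a : ℕ)) = 0 := by
      refine Eq.trans ?_ (h1.trans ?_)
      · rw [AddSubmonoidClass.coe_finsetSum, map_sum]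
        refine Finset.sum_congr rfl fun a _ => ?_
        rw [← Algebra.smul_def, ← map_pow, ← map_pow, ← map_mul, ← map_smul, Submodule.coe_smul]
        rfl
      · rw [ZeroMemClass.coe_zero, map_zero]
    refine ⟨∑ a, Polynomial.C (g a) * Polynomial.X ^ (a : ℕ), fun h => ha₀ ?_, ?_⟩
    · have h3 := congrArg (fun p => Polynomial.coeff p (a₀ : ℕ)) h
      simp only [Polynomial.finsetSum_coeff, Polynomial.coeff_C_mul, Polynomial.coeff_X_pow,
        Polynomial.coeff_zero] at h3
      rw [Finset.sum_eq_single a₀] at h3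
      · simpa using h3
      · intro b _ hb
        rw [if_neg (fun h => hb (Fin.ext h.symm)), mul_zero]
      · simp
    · rw [map_sum]
      have h3 : q (X i) ^ D * ∑ a : Fin (D + 1), Polynomial.aeval (t j)
          (Polynomial.C (g a) * Polynomial.X ^ (a : ℕ)) = 0 := by
        rw [← h2, Finset.mul_sum]
        refine Finset.sum_congr rfl fun a _ => ?_
        rw [map_mul, map_pow, Polynomial.aeval_C, Polynomial.aeval_X, div_pow]
        have : q (X i) ^ D = q (X i) ^ (a : ℕ) * q (X i) ^ (D - a) := by
          rw [← pow_add, Nat.add_sub_cancel' (by omega)]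
        rw [this, mul_comm (q (X i) ^ (a : ℕ)), mul_assoc, mul_left_comm (q (X i) ^ (a : ℕ)),
          mul_div_cancel₀ _ (pow_ne_zero _ hqi)]
        ring
      exact (mul_eq_zero.mp h3).resolve_left (pow_ne_zero _ hqi)
  let K' := IntermediateField.adjoin k (Set.range t)
  have hfin : FiniteDimensional k K' := IntermediateField.finiteDimensional_adjoin (by
    rintro _ ⟨j, rfl⟩
    exact hint j)
  have hNF : NumberField K' := NumberField.of_module_finite k K'
  let t' : τ → K' := fun j => ⟨t j, IntermediateField.subset_adjoin k _ ⟨j, rfl⟩⟩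
  have ht'i : t' i = 1 := Subtype.ext hti
  have hval : ∀ f : MvPolynomial τ k, ((aeval t' f : K') : L) = aeval t f := fun f => by
    change K'.val (aeval t' f) = _
    rw [← AlgHom.comp_apply, comp_aeval]
    rfl
  obtain ⟨⟨b, hb⟩, hbt⟩ := IsLocalization.exist_integer_multiples_of_finite
    (nonZeroDivisors (𝓞 K')) t'
  choose θ hθ using hbt
  have hb0 : b ≠ 0 := nonZeroDivisors.ne_zero hb
  have hbK : (b : K') ≠ 0 := by simpa using hb0
  have hθ' : ∀ j, (θ j : K') = b * t' j := fun j => (hθ j).trans (Algebra.smul_def _ _)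
  have hθi : (θ i : K') = b := by rw [hθ', ht'i, mul_one]
  have haθ : ∀ {n} {f : MvPolynomial τ k}, f.IsHomogeneous n →
      aeval (fun j => (θ j : K')) f = (b : K') ^ n * aeval t' f := fun {n f} hf => by
    rw [← aeval_smul_of_isHomogeneous hf]
    simp only [hθ']
  refine ⟨K', inferInstance, hNF, inferInstance, θ, ?_, ?_, ?_⟩
  · intro h
    rw [h] at hθi
    exact hbK (by rw [← hθi]; simp)
  · intro n f hf
    rw [haθ hf, mul_eq_zero, or_iff_right (pow_ne_zero _ hbK), ← hq, haev hf, mul_eq_zero,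
      or_iff_right (pow_ne_zero _ hqi), ← hval]
    exact (ZeroMemClass.coe_eq_zero).symm
  · have key : ∀ y ∈ Algebra.adjoin k (Set.range t), ∃ n, ∃ f : MvPolynomial τ k,
        f.IsHomogeneous n ∧ y = aeval t f := fun y hy => by
      induction hy using Algebra.adjoin_induction with
      | mem x hx =>
        obtain ⟨j, rfl⟩ := hx
        exact ⟨1, X j, isHomogeneous_X _ _, by rw [aeval_X]⟩
      | algebraMap r => exact ⟨0, C r, isHomogeneous_C _ _, by rw [aeval_C]⟩
      | add x y _ _ hx hy =>
        obtain ⟨n, f, hf, rfl⟩ := hx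
        obtain ⟨m, g, hg, rfl⟩ := hy
        refine ⟨n + m, f * X i ^ m + g * X i ^ n, (hf.mul (isHomogeneous_X_pow _ _)).add ?_, ?_⟩
        · rw [add_comm]
          exact hg.mul (isHomogeneous_X_pow _ _)
        · simp [hti]
      | mul x y _ _ hx hy =>
        obtain ⟨n, f, hf, rfl⟩ := hx
        obtain ⟨m, g, hg, rfl⟩ := hy
        exact ⟨n + m, f * g, hf.mul hg, by rw [map_mul]⟩
    intro x
    have hx : (x : L) ∈ Algebra.adjoin k (Set.range t) := by
      rw [← IntermediateField.adjoin_toSubalgebra_of_isAlgebraic (by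
        rintro _ ⟨j, rfl⟩
        exact (hint j).isAlgebraic)]
      exact x.2
    obtain ⟨n, f, hf, hfx⟩ := key _ hx
    refine ⟨n, f, hf, ?_⟩
    rw [haθ hf, hθi, mul_comm]
    congr 1
    exact Subtype.ext (hfx.trans (hval f).symm)

/-- Values at `θ` of integral homogeneous polynomials contain all elements of the powers of the
ideal generated by `θ`, up to a fixed factor. -/
theorem exists_values {K' : Type} [Field K'] [NumberField K'] [Algebra k K'] {θ : τ → 𝓞 K'} {i : τ}
    (hi : θ i ≠ 0)
    (hgen : ∀ x : K', ∃ n, ∃ f : MvPolynomial τ k, f.IsHomogeneous n ∧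
        x * (θ i : K') ^ n = aeval (fun j => (θ j : K')) f) :
    ∃ (e : 𝓞 K') (n₁ : ℕ), e ≠ 0 ∧ ∀ n, ∀ y ∈ Ideal.span (Set.range θ) ^ n,
      ∃ f : MvPolynomial τ (𝓞 k), f.IsHomogeneous (n + n₁) ∧ aeval θ f = e * y := by
  have hcoe : ∀ f : MvPolynomial τ (𝓞 k), ((aeval θ f : 𝓞 K') : K') =
      aeval (fun j => (θ j : K')) (toK f) := fun f => by
    rw [aeval_map_algebraMap]
    exact (aeval_algebraMap_apply K' θ f).symm
  have h1 : ∀ x : 𝓞 K', ∃ (e : 𝓞 K') (n : ℕ), e ≠ 0 ∧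
      (∃ f : MvPolynomial τ (𝓞 k), f.IsHomogeneous n ∧ aeval θ f = e) ∧
      ∃ f : MvPolynomial τ (𝓞 k), f.IsHomogeneous n ∧ aeval θ f = e * x := fun x => by
    obtain ⟨n, f, hf, hfx⟩ := hgen x
    obtain ⟨d, hd, g, hg, hgf⟩ := exists_integral_multiple hf
    refine ⟨algebraMap (𝓞 k) (𝓞 K') d * θ i ^ n, n, mul_ne_zero ?_ (pow_ne_zero _ hi),
      ⟨C d * X i ^ n, (isHomogeneous_X_pow _ _).C_mul _, ?_⟩, g, hg, ?_⟩
    · simpa using hd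
    · simp
    · apply NumberField.RingOfIntegers.ext
      rw [hcoe, hgf, map_mul, aeval_C, ← hfx]
      change _ = algebraMap (𝓞 K') K' _
      rw [map_mul, map_mul, map_pow]
      rw [show algebraMap (𝓞 K') K' (algebraMap (𝓞 k) (𝓞 K') d) =
        algebraMap k K' (algebraMap (𝓞 k) k d) by
          rw [← IsScalarTower.algebraMap_apply, ← IsScalarTower.algebraMap_apply]]
      ring
  choose e m he he' hem using h1
  obtain ⟨S, hS⟩ := (Module.Finite.fg_top : (⊤ : Submodule (𝓞 k) (𝓞 K')).FG)
  have hprod : ∀ T : Finset (𝓞 K'), ∃ f : MvPolynomial τ (𝓞 k), f.IsHomogeneous (∑ x ∈ T, m x) ∧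
      aeval θ f = ∏ x ∈ T, e x := fun T => by
    choose f hf hfe using he'
    exact ⟨∏ x ∈ T, f x, IsHomogeneous.prod T f m fun x _ => hf x,
        by rw [map_prod]; simp only [hfe]⟩
  have h0 : ∀ y : 𝓞 K', ∃ f : MvPolynomial τ (𝓞 k), f.IsHomogeneous (∑ x ∈ S, m x) ∧
      aeval θ f = (∏ x ∈ S, e x) * y := fun y => by
    have hy : y ∈ Submodule.span (𝓞 k) (S : Set (𝓞 K')) := hS ▸ Submodule.mem_top
    induction hy using Submodule.span_induction with
    | mem x hx =>
      have hx : x ∈ S := hx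
      obtain ⟨f, hf, hfe⟩ := hprod (S.erase x)
      obtain ⟨g, hg, hge⟩ := hem x
      refine ⟨g * f, ?_, ?_⟩
      · rw [← Finset.add_sum_erase _ _ hx]
        exact hg.mul hf
      · rw [map_mul, hfe, hge, ← Finset.mul_prod_erase _ _ hx]
        ring
    | zero => exact ⟨0, isHomogeneous_zero _ _ _, by simp⟩
    | add x y _ _ hx hy =>
      obtain ⟨f, hf, hfe⟩ := hx
      obtain ⟨g, hg, hge⟩ := hy
      exact ⟨f + g, hf.add hg, by rw [map_add, hfe, hge, mul_add]⟩
    | smul a x _ hx =>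
      obtain ⟨f, hf, hfe⟩ := hx
      exact ⟨a • f, by rw [smul_eq_C_mul]; exact hf.C_mul _, by rw [map_smul, hfe, mul_smul_comm]⟩
  refine ⟨∏ x ∈ S, e x, ∑ x ∈ S, m x, Finset.prod_ne_zero_iff.mpr fun x _ => he x, fun n => ?_⟩
  induction n with
  | zero =>
    intro y _
    obtain ⟨f, hf, hfe⟩ := h0 y
    exact ⟨f, by rwa [zero_add], hfe⟩
  | succ n ih =>
    intro y hy
    rw [pow_succ'] at hy
    have hadd : ∀ {y y' : 𝓞 K'} {n₂ : ℕ},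
        (∃ f : MvPolynomial τ (𝓞 k), f.IsHomogeneous n₂ ∧ aeval θ f = (∏ x ∈ S, e x) * y) →
        (∃ f : MvPolynomial τ (𝓞 k), f.IsHomogeneous n₂ ∧ aeval θ f = (∏ x ∈ S, e x) * y') →
        ∃ f : MvPolynomial τ (𝓞 k), f.IsHomogeneous n₂ ∧
          aeval θ f = (∏ x ∈ S, e x) * (y + y') := by
      rintro y y' n₂ ⟨f, hf, hfe⟩ ⟨g, hg, hge⟩
      exact ⟨f + g, hf.add hg, by rw [map_add, hfe, hge, mul_add]⟩
    induction hy using Submodule.mul_induction_on' with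
    | mem_mul_mem u hu z hz =>
      induction hu using Submodule.span_induction generalizing z with
      | mem x hx =>
        obtain ⟨j, rfl⟩ := hx
        obtain ⟨f, hf, hfe⟩ := ih z hz
        refine ⟨X j * f, ?_, ?_⟩
        · rw [add_right_comm, add_comm _ 1]
          exact (isHomogeneous_X _ _).mul hf
        · rw [map_mul, aeval_X, hfe]
          ring
      | zero => exact ⟨0, isHomogeneous_zero _ _ _, by simp⟩
      | add x y _ _ hx hy =>
        rw [add_mul]
        exact hadd (hx z hz) (hy z hz)
      | smul a x _ hx =>
        obtain ⟨f, hf, hfe⟩ := hx (a * z) (Ideal.mul_mem_left _ _ hz)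
        exact ⟨f, hf, by rw [hfe, smul_eq_mul]; ring⟩
    | add x _ y _ hx hy => exact hadd hx hy

end Point

section Embeddings
open Module

theorem sum_log_norm {K : Type} [Field K] [NumberField K] {x : K} (hx : x ≠ 0) :
    ∑ σ : K →+* ℂ, Real.log ‖σ x‖ = Real.log |((Algebra.norm ℚ x : ℚ) : ℝ)| := by
  rw [← Real.log_prod fun σ _ => by simpa using hx]
  congr 1
  have h := congrArg norm (Algebra.norm_eq_prod_embeddings ℚ ℂ x)
  rw [norm_prod, ← (RingHom.equivRatAlgHom (R := K) (S := ℂ)).prod_comp] at h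
  refine Eq.trans ?_ (h.symm.trans ?_)
  · exact Finset.prod_congr rfl fun σ _ => rfl
  · rw [eq_ratCast]
    exact Complex.norm_ratCast _

theorem sum_log_norm_int {K : Type} [Field K] [NumberField K] {x : 𝓞 K} (hx : x ≠ 0) :
    ∑ σ : K →+* ℂ, Real.log ‖σ x‖ = Real.log (Ideal.absNorm (Ideal.span {x})) := by
  rw [sum_log_norm (by simpa using hx), Ideal.absNorm_span_singleton,
    ← Algebra.coe_norm_int, Rat.cast_intCast, Nat.cast_natAbs, Int.cast_abs]

theorem sum_embeddings {k K' : Type} [Field k] [NumberField k] [Field K'] [NumberField K']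
    [Algebra k K'] (F : (K' →+* ℂ) → ℝ) :
    ∑ σ' : K' →+* ℂ, F σ' =
      ∑ σ : k →+* ℂ, ∑ σ' : {σ' : K' →+* ℂ // σ'.comp (algebraMap k K') = σ}, F σ' := by
  rw [← Fintype.sum_sigma', ← (Equiv.sigmaFiberEquiv
    fun σ' : K' →+* ℂ => σ'.comp (algebraMap k K')).sum_comp]
  rfl

theorem exists_embedding_equiv {k K' : Type} [Field k] [NumberField k] [Field K'] [NumberField K']
    [Algebra k K'] (σ : k →+* ℂ) {I : Type} [Fintype I] (w : Basis I k K') :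
    ∃ e : I ≃ {σ' : K' →+* ℂ // σ'.comp (algebraMap k K') = σ},
      (Matrix.of fun l i => (e i).1 (w l)).det ≠ 0 := by
  let : Algebra k ℂ := σ.toAlgebra
  let E : (K' →ₐ[k] ℂ) ≃ {σ' : K' →+* ℂ // σ'.comp (algebraMap k K') = σ} :=
    { toFun := fun f => ⟨f, RingHom.ext fun x => f.commutes x⟩
      invFun := fun f => { f.1 with commutes' := fun x => congrArg (· x) f.2 }
      left_inv := fun f => rfl
      right_inv := fun f => rfl }
  have hcard : Fintype.card I = Fintype.card (K' →ₐ[k] ℂ) := by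
    rw [AlgHom.card, finrank_eq_card_basis w]
  let e₀ : I ≃ (K' →ₐ[k] ℂ) := Fintype.equivOfCardEq hcard
  refine ⟨e₀.trans E, fun h => ?_⟩
  have h1 := Algebra.discr_eq_det_embeddingsMatrixReindex_pow_two k ℂ w e₀
  have h2 : (Algebra.embeddingsMatrixReindex k ℂ w e₀).det = 0 := h
  rw [h2, zero_pow two_ne_zero, map_eq_zero] at h1
  exact Algebra.discr_not_zero_of_basis k w h1

theorem card_embeddings_over {k K' : Type} [Field k] [NumberField k] [Field K'] [NumberField K']
    [Algebra k K'] (σ : k →+* ℂ) :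
    Fintype.card {σ' : K' →+* ℂ // σ'.comp (algebraMap k K') = σ} = finrank k K' := by
  obtain ⟨e, -⟩ := exists_embedding_equiv σ (finBasis k K')
  rw [← Fintype.card_congr e, Fintype.card_fin]

theorem sum_embeddings_comp {k K' : Type} [Field k] [NumberField k] [Field K'] [NumberField K']
    [Algebra k K'] (F : (k →+* ℂ) → ℝ) :
    ∑ σ' : K' →+* ℂ, F (σ'.comp (algebraMap k K')) = finrank k K' * ∑ σ : k →+* ℂ, F σ := by
  rw [sum_embeddings (k := k), Finset.mul_sum]
  refine Finset.sum_congr rfl fun σ _ => ?_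
  have : ∀ σ' : {σ' : K' →+* ℂ // σ'.comp (algebraMap k K') = σ},
      F (σ'.1.comp (algebraMap k K')) = F σ := fun σ' => by rw [σ'.2]
  simp only [this, Finset.sum_const, Finset.card_univ, card_embeddings_over, nsmul_eq_mul]

end Embeddings

section PointCase
open Module
variable {k : Type} [Field k] [NumberField k] {τ : Type} [Fintype τ]
  {N : (k →+* ℂ) → (τ → ℂ) → ℝ} {J : Ideal (MvPolynomial τ k)}

/-- The normalized height with respect to `N` is at least `a` on all points over all finite
extensions. -/
def HeightBound (N : (k →+* ℂ) → (τ → ℂ) → ℝ) (a : ℝ) : Prop :=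
  ∀ (K' : Type) [Field K'] [NumberField K'] [Algebra k K'] (x : τ → 𝓞 K'), x ≠ 0 →
    a * finrank k K' ≤ ∑ σ' : K' →+* ℂ, Real.log (N (σ'.comp (algebraMap k K')) fun j => σ' (x j))
      - Real.log (Ideal.absNorm (Ideal.span (Set.range x)))

theorem polyBall_pow {N : (τ → ℂ) → ℝ} {n : ℕ} {p : MvPolynomial τ ℂ}
    (hp : p ∈ polyBall N n) (m : ℕ) : p ^ m ∈ polyBall N (n * m) :=
  ⟨hp.1.pow m, fun v => by
    rw [map_pow, norm_pow, pow_mul]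
    exact pow_le_pow_left₀ (norm_nonneg _) (hp.2 v) _⟩

theorem GoodNorm.pos (hN : GoodNorm N) (σ : k →+* ℂ) {v : τ → ℂ} (hv : v ≠ 0) : 0 < N σ v := by
  obtain ⟨c, hc, h⟩ := hN.lower σ
  obtain ⟨i, hi⟩ := Function.ne_iff.mp hv
  have h1 := h v i
  have h2 : 0 < ‖v i‖ := norm_pos_iff.mpr hi
  exact pos_of_mul_pos_right (h2.trans_le h1) hc.le

theorem exists_basis_integers (k K' : Type) [Field k] [NumberField k] [Field K'] [NumberField K']
    [Algebra k K'] : ∃ (w : Basis (Fin (finrank k K')) k K') (w' : Fin (finrank k K') → 𝓞 K'),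
      ∀ l, (w' l : K') = w l := by
  obtain ⟨⟨b, hb⟩, hbt⟩ := IsLocalization.exist_integer_multiples_of_finite
    (nonZeroDivisors (𝓞 K')) (finBasis k K')
  choose θ hθ using hbt
  have hb0 : b ≠ 0 := nonZeroDivisors.ne_zero hb
  have hbK : (b : K') ≠ 0 := by simpa using hb0
  exact ⟨(finBasis k K').map (LinearEquiv.smulOfNeZero K' K' (b : K') hbK |>.restrictScalars k),
    θ, fun l => (hθ l).trans (Algebra.smul_def _ _)⟩

theorem exists_pow_eq_span {R : Type} [CommRing R] [IsDedekindDomain R] [Fintype (ClassGroup R)]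
    {I : Ideal R} (hI : I ≠ ⊥) : ∃ h : ℕ, 0 < h ∧ ∃ α : R, I ^ h = Ideal.span {α} := by
  refine ⟨Fintype.card (ClassGroup R), Fintype.card_pos, ?_⟩
  have h1 : (I ^ Fintype.card (ClassGroup R)).IsPrincipal := by
    rw [← ClassGroup.mk0_eq_one_iff (pow_mem (mem_nonZeroDivisors_of_ne_zero hI) _),
      ← SubmonoidClass.mk_pow _ (mem_nonZeroDivisors_of_ne_zero hI), map_pow, pow_card_eq_one]
  exact h1.principal

theorem frame_of_point_values {K' : Type} [Field K'] [NumberField K'] [Algebra k K']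
    {I : Type} [Fintype I] (w : Basis I k K')
    {P : (k →+* ℂ) → I → τ → ℂ} {θ : τ → 𝓞 K'}
    (E : ∀ σ : k →+* ℂ, I ≃ {σ' : K' →+* ℂ // σ'.comp (algebraMap k K') = σ})
    (hE : ∀ σ, (Matrix.of fun l i => (E σ i).1 (w l)).det ≠ 0)
    (hPθ : ∀ σ l, P σ l = fun j => (E σ l).1 (θ j))
    (hθ : ∀ n, ∀ f : MvPolynomial τ k, f.IsHomogeneous n →
        (aeval (fun j => (θ j : K')) f = 0 ↔ f ∈ J))
    (hJ0 : ∀ σ l, ∀ g ∈ J.map (map σ), eval (P σ l) g = 0)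
    {n : ℕ} {b : I → MvPolynomial τ (𝓞 k)} (hb : ∀ l, (b l).IsHomogeneous n) {u : 𝓞 K'} (hu : u ≠ 0)
    (hbu : ∀ l, ((aeval θ (b l) : 𝓞 K') : K') = u * w l)
    {c : (k →+* ℂ) → I → MvPolynomial τ ℂ} (hc : ∀ σ i, c σ i ∈ polyBall (N σ) n)
    {y : (k →+* ℂ) → I → ℂ} (hy : ∀ σ i, y σ i ≠ 0)
    (hcy : ∀ σ i l, eval (P σ l) (c σ i) = if i = l then y σ i else 0) :
    Frame N J n I (∑ σ, (∑ i, Real.log ‖y σ i‖ -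
      Real.log ‖(Matrix.of fun l i => (E σ i).1 (w l)).det‖) -
      Real.log (Ideal.absNorm (Ideal.span {u}))) := by
  have huK : (u : K') ≠ 0 := by simpa using hu
  have hcoe : ∀ f : MvPolynomial τ (𝓞 k), ((aeval θ f : 𝓞 K') : K') =
      aeval (fun j => (θ j : K')) (toK f) := fun f => by
    rw [aeval_map_algebraMap]
    exact (aeval_algebraMap_apply K' θ f).symm
  have hev : ∀ t : I → k, aeval (fun j => (θ j : K')) (∑ l, C (t l) * toK (b l)) =
      u * ∑ l, t l • w l := fun t => by
    rw [map_sum, Finset.mul_sum]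
    refine Finset.sum_congr rfl fun l _ => ?_
    rw [map_mul, ← hcoe, hbu, algHom_C, Algebra.smul_def]
    ring
  have hhom : ∀ t : I → k, (∑ l, C (t l) * toK (b l)).IsHomogeneous n := fun t =>
    IsHomogeneous.sum _ _ _ fun l _ => by
      simpa using (isHomogeneous_C τ (t l)).mul ((hb l).map (algebraMap (𝓞 k) k))
  have hspan : ∀ f : MvPolynomial τ k, f.IsHomogeneous n →
      ∃ t : I → k, f - ∑ i, C (t i) * toK (b i) ∈ J := fun f hf => by
    refine ⟨w.repr (aeval (fun j => (θ j : K')) f / u), ?_⟩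
    rw [← hθ n _ (hf.sub (hhom _)), map_sub, hev, w.sum_repr, mul_div_cancel₀ _ huK, sub_self]
  choose M hM using fun σ i => exists_sub_sum_mem_map hspan σ (c σ i) (hc σ i).1
  have hPK : ∀ σ l (f : MvPolynomial τ k), eval (P σ l) (map σ f) =
      (E σ l).1 (aeval (fun j => (θ j : K')) f) := fun σ l f => by
    rw [hPθ, eval_map, aeval_def, hom_eval₂, (E σ l).2]
  have hprod : ∀ σ, Matrix.of (M σ) * Matrix.of (fun l i => (E σ i).1 (w l)) *
      Matrix.diagonal (fun i => (E σ i).1 u) = Matrix.diagonal (y σ) := fun σ => by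
    ext i l
    rw [Matrix.mul_diagonal, Matrix.mul_apply, Matrix.diagonal_apply, ← hcy]
    have h1 := hJ0 σ l _ (hM σ i)
    rw [map_sub, sub_eq_zero, map_sum] at h1
    rw [h1, Finset.sum_mul]
    refine Finset.sum_congr rfl fun m _ => ?_
    rw [map_mul, eval_C, hPK, ← hcoe, hbu, map_mul, Matrix.of_apply, Matrix.of_apply]
    ring
  have hdet : ∀ σ, ‖(Matrix.of (M σ)).det‖ * ‖(Matrix.of fun l i => (E σ i).1 (w l)).det‖ *
      ∏ i, ‖(E σ i).1 u‖ = ∏ i, ‖y σ i‖ := fun σ => by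
    have := congrArg (fun A => ‖A.det‖) (hprod σ)
    simpa only [Matrix.det_mul, Matrix.det_diagonal, norm_mul, norm_prod] using this
  have hyp : ∀ σ, ∏ i, ‖y σ i‖ ≠ 0 := fun σ => Finset.prod_ne_zero_iff.mpr fun i _ => by
    simpa using hy σ i
  have hMd : ∀ σ, (Matrix.of (M σ)).det ≠ 0 := fun σ h0 => hyp σ (by
    rw [← hdet, h0, norm_zero, zero_mul, zero_mul])
  have huσ : ∀ σ i, ‖(E σ i).1 u‖ ≠ 0 := fun σ i => by simpa using hu
  refine ⟨b, hb, fun t ht => ?_, hspan, fun σ => Matrix.of (M σ),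
    fun σ => ⟨hMd σ, fun i => ⟨c σ i, hc σ i, hM σ i⟩⟩, le_of_eq ?_⟩
  · rw [← hθ n _ (hhom t), hev, mul_eq_zero, or_iff_right huK] at ht
    exact funext fun l => Fintype.linearIndependent_iff.mp w.linearIndependent t ht l
  · have hlog : ∀ σ, Real.log ‖(Matrix.of (M σ)).det‖ = ∑ i, Real.log ‖y σ i‖ -
        Real.log ‖(Matrix.of fun l i => (E σ i).1 (w l)).det‖ - ∑ i, Real.log ‖(E σ i).1 u‖ :=
      fun σ => by
      have h1 := congrArg Real.log (hdet σ)
      rw [Real.log_mul (mul_ne_zero (by simpa using hMd σ) (by simpa using hE σ))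
        (Finset.prod_ne_zero_iff.mpr fun i _ => huσ σ i), Real.log_mul (by simpa using hMd σ)
        (by simpa using hE σ), Real.log_prod fun i _ => huσ σ i,
        Real.log_prod fun i _ => by simpa using hy σ i] at h1
      linarith
    simp only [hlog]
    rw [← sum_log_norm_int hu, sum_embeddings (k := k) fun σ' => Real.log ‖σ' (u : K')‖,
      Finset.sum_sub_distrib (f := fun σ => ∑ i, Real.log ‖y σ i‖ - _)]
    congr 1
    exact Finset.sum_congr rfl fun σ _ => ((E σ).sum_comp fun σ' => Real.log ‖σ'.1 u‖).symm

theorem ach_of_point (hN : GoodNorm N) (hJ : IsHom J) {a : ℝ}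
    {K' : Type} [Field K'] [NumberField K'] [Algebra k K'] {θ : τ → 𝓞 K'} {i₀ : τ}
    (hi : θ i₀ ≠ 0)
    (hθ : ∀ n, ∀ f : MvPolynomial τ k, f.IsHomogeneous n →
        (aeval (fun j => (θ j : K')) f = 0 ↔ f ∈ J))
    (hgen : ∀ x : K', ∃ n, ∃ f : MvPolynomial τ k, f.IsHomogeneous n ∧
        x * (θ i₀ : K') ^ n = aeval (fun j => (θ j : K')) f)
    (ha : a * finrank k K' ≤ ∑ σ' : K' →+* ℂ,
        Real.log (N (σ'.comp (algebraMap k K')) fun j => σ' (θ j))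
      - Real.log (Ideal.absNorm (Ideal.span (Set.range θ)))) : Ach N J a := by
  obtain ⟨e, n₁, he, hval⟩ := exists_values hi hgen
  obtain ⟨I, hIf, hIc, w, w', hw⟩ : ∃ (I : Type) (_ : Fintype I), Fintype.card I = finrank k K' ∧
      ∃ (w : Basis I k K') (w' : I → 𝓞 K'), ∀ l, (w' l : K') = w l :=
    ⟨_, inferInstance, Fintype.card_fin _, exists_basis_integers k K'⟩
  choose E hE using fun σ : k →+* ℂ => exists_embedding_equiv (K' := K') σ w
  obtain ⟨d, hd⟩ : ∃ d, d = finrank k K' := ⟨_, rfl⟩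
  have hd0 : 0 < d := hd ▸ finrank_pos
  rw [← hd] at ha hIc
  have hcoe : ∀ f : MvPolynomial τ (𝓞 k), ((aeval θ f : 𝓞 K') : K') =
      aeval (fun j => (θ j : K')) (toK f) := fun f => by
    rw [aeval_map_algebraMap]
    exact (aeval_algebraMap_apply K' θ f).symm
  let P : (σ : k →+* ℂ) → I → τ → ℂ := fun σ l j => (E σ l).1 (θ j)
  have hPK : ∀ σ l (f : MvPolynomial τ k), eval (P σ l) (map σ f) =
      (E σ l).1 (aeval (fun j => (θ j : K')) f) := fun σ l f => by
    rw [eval_map, aeval_def, hom_eval₂, (E σ l).2]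
  have hP : ∀ σ l (f : MvPolynomial τ (𝓞 k)), eval (P σ l) (map σ (toK f)) =
      (E σ l).1 (aeval θ f : 𝓞 K') := fun σ l f => by
    rw [hPK, hcoe]
  have hJ0 : ∀ σ l, ∀ g ∈ J.map (map σ), eval (P σ l) g = 0 := fun σ l g hg => by
    have h1 : J.map (map σ) ≤ RingHom.ker (eval (P σ l)) := by
      rw [Ideal.map_le_iff_le_comap]
      intro f hf
      rw [Ideal.mem_comap, RingHom.mem_ker, hPK]
      rw [← sum_homogeneousComponent f, map_sum, map_sum]
      refine Finset.sum_eq_zero fun m _ => ?_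
      rw [(hθ m _ (homogeneousComponent_isHomogeneous m f)).mpr (hJ f hf m), map_zero]
    exact h1 hg
  have hP0 : ∀ σ l, P σ l ≠ 0 := fun σ l h => hi (by
    have := congrFun h i₀
    simpa [P] using this)
  have hNP : ∀ σ l, 0 < N σ (P σ l) := fun σ l => hN.pos σ (hP0 σ l)
  let 𝔟 := Ideal.span (Set.range θ)
  have hb0 : 𝔟 ≠ ⊥ := fun h0 => hi (by
    have := Ideal.subset_span (Set.mem_range_self i₀) (α := 𝓞 K') (s := Set.range θ)
    rwa [show Ideal.span (Set.range θ) = ⊥ from h0] at this)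
  obtain ⟨h, hh0, α, hα⟩ := exists_pow_eq_span hb0
  have hα0 : α ≠ 0 := fun h0 => hb0 (by
    rw [h0, Ideal.span_singleton_eq_bot.mpr rfl] at hα
    exact eq_bot_iff.mpr (pow_eq_zero_iff hh0.ne' |>.mp hα).le)
  -- integral polynomials with prescribed values
  have hpol : ∀ j l, ∃ f : MvPolynomial τ (𝓞 k), f.IsHomogeneous (h * j + n₁) ∧
      aeval θ f = e * (α ^ j * w' l) := fun j l => by
    refine hval (h * j) _ (Ideal.mul_mem_right _ _ ?_)
    rw [pow_mul]
    exact Ideal.pow_mem_pow (hα ▸ Ideal.mem_span_singleton_self α) j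
  choose f hf hfv using hpol
  let V : (σ : k →+* ℂ) → Matrix I I ℂ := fun σ => Matrix.of fun l i => (E σ i).1 (w l)
  let q : (σ : k →+* ℂ) → I → MvPolynomial τ ℂ := fun σ i =>
    ∑ l, C (((V σ)⁻¹ i l) / (E σ i).1 e) * map σ (toK (f 0 l))
  have heσ : ∀ σ i, (E σ i).1 (e : K') ≠ 0 := fun σ i => by simpa using he
  have hqh : ∀ σ i, (q σ i).IsHomogeneous n₁ := fun σ i =>
    IsHomogeneous.sum _ _ _ fun l _ => by
      simpa using (isHomogeneous_C τ _).mul (((hf 0 l).map (algebraMap (𝓞 k) k)).map σ)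
  obtain ⟨e', he'⟩ : ∃ e' : (k →+* ℂ) → I → ℂ, ∀ σ i, e' σ i = (E σ i).1 e := ⟨_, fun _ _ => rfl⟩
  have hqv : ∀ σ i l, eval (P σ l) (q σ i) = if i = l then 1 else 0 := fun σ i l => by
    have h1 : ((V σ)⁻¹ * V σ) i l = if i = l then 1 else 0 := by
      rw [Matrix.nonsing_inv_mul _ (isUnit_iff_ne_zero.mpr (hE σ)), Matrix.one_apply]
    have h2 : eval (P σ l) (q σ i) = ((V σ)⁻¹ * V σ) i l * ((E σ l).1 e / (E σ i).1 e) := by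
      rw [map_sum, Matrix.mul_apply, Finset.sum_mul]
      refine Finset.sum_congr rfl fun m _ => ?_
      rw [map_mul, eval_C, hP, hfv, pow_zero, one_mul, show ((e * w' m : 𝓞 K') : K') =
          e * w m by rw [← hw]; rfl, map_mul]
      change _ = _ * (E σ l).1 (w m) * _
      ring
    rw [h2, h1]
    split_ifs with h3
    · rw [h3, div_self (heσ σ l), one_mul]
    · rw [zero_mul]
  obtain ⟨A, hA, hAq⟩ := exists_polyBall_uniform hN q hqh
  choose L hL hLP using fun σ i => hN.peak σ (P σ i)
  let ℓ : (σ : k →+* ℂ) → I → MvPolynomial τ ℂ := fun σ i => ∑ t, C (L σ i t) * X t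
  have hℓv : ∀ σ i v, eval v (ℓ σ i) = ∑ t, L σ i t * v t := fun σ i v => by
    simp [ℓ, map_sum]
  have hℓ : ∀ σ i, ℓ σ i ∈ polyBall (N σ) 1 := fun σ i =>
    ⟨IsHomogeneous.sum _ _ _ fun t _ => by
      simpa using (isHomogeneous_C τ _).mul (isHomogeneous_X ℂ t), fun v => by
      rw [hℓv, pow_one]
      exact hL σ i v⟩
  let Λ : ℝ := ∑ σ' : K' →+* ℂ, Real.log (N (σ'.comp (algebraMap k K')) fun j => σ' (θ j))
  have hΛ : ∑ σ, ∑ i, Real.log (N σ (P σ i)) = Λ := by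
    refine Eq.trans ?_ (sum_embeddings (k := k) _).symm
    refine Finset.sum_congr rfl fun σ _ => ?_
    rw [← (E σ).sum_comp]
    refine Finset.sum_congr rfl fun i _ => ?_
    rw [(E σ i).2]
  let B : ℝ := Real.log (Ideal.absNorm 𝔟)
  let Ω : ℝ := ∑ σ, Real.log ‖(V σ).det‖
  have hlogI : ∀ x : 𝓞 K', 0 ≤ Real.log (Ideal.absNorm (Ideal.span {x})) := fun x =>
    Real.log_natCast_nonneg _
  have hB : 0 ≤ B := Real.log_natCast_nonneg _
  have hnz : ∀ {x : 𝓞 K'}, x ≠ 0 → (Ideal.absNorm (Ideal.span {x}) : ℝ) ≠ 0 := fun {x} hx => by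
    rw [Nat.cast_ne_zero, Ne, Ideal.absNorm_eq_zero_iff, Ideal.span_singleton_eq_bot]
    exact hx
  let C₀ : ℝ := (∑ _σ : k →+* ℂ, d * Real.log A) + Ω + Real.log (Ideal.absNorm (Ideal.span {e})) +
    h * Real.log (Ideal.absNorm (Ideal.span {θ i₀}))
  have hframe : ∀ n ≥ n₁, Frame N J n I ((n - n₁ : ℕ) * (Λ - B) - C₀) := fun n hn => by
    obtain ⟨j, r, hr, hjr⟩ : ∃ j r, r < h ∧ n = h * j + n₁ + r :=
      ⟨(n - n₁) / h, (n - n₁) % h, Nat.mod_lt _ hh0, by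
        have := Nat.div_add_mod (n - n₁) h
        omega⟩
    let u : 𝓞 K' := e * α ^ j * θ i₀ ^ r
    have hu : u ≠ 0 := mul_ne_zero (mul_ne_zero he (pow_ne_zero _ hα0)) (pow_ne_zero _ hi)
    have hc : ∀ σ i, (C ((A : ℂ)⁻¹) * q σ i) * ℓ σ i ^ (n - n₁) ∈ polyBall (N σ) n := fun σ i => by
      have := polyBall_mul (hAq σ i) (polyBall_pow (hℓ σ i) (n - n₁))
      rwa [one_mul, Nat.add_sub_cancel' hn] at this
    have hAC : (A : ℂ) ≠ 0 := by exact_mod_cast hA.ne'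
    have h1 := frame_of_point_values (N := N) (J := J) w (P := P) E hE (fun _ _ => rfl) hθ hJ0
      (n := n) (b := fun l => f j l * X i₀ ^ r) (u := u)
      (c := fun σ i => (C ((A : ℂ)⁻¹) * q σ i) * ℓ σ i ^ (n - n₁))
      (y := fun σ i => (A : ℂ)⁻¹ * (∑ t, L σ i t * P σ i t) ^ (n - n₁))
      (fun l => by
        rw [hjr]
        simpa using (hf j l).mul ((isHomogeneous_X (𝓞 k) i₀).pow r)) hu
      (fun l => by
        rw [map_mul, map_pow, aeval_X, hfv, ← hw]
        simp only [u, map_mul]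
        ring) hc
      (fun σ i => mul_ne_zero (inv_ne_zero hAC) (pow_ne_zero _ (by
        rw [← norm_ne_zero_iff, hLP]; exact (hNP σ i).ne')))
      (fun σ i l => by
        rw [map_mul, map_mul, eval_C, map_pow, hℓv, hqv]
        split_ifs with h3
        · rw [h3, mul_one]
        · rw [mul_zero, zero_mul])
    refine h1.mono ?_
    have h2 : ∀ σ i, Real.log ‖(A : ℂ)⁻¹ * (∑ t, L σ i t * P σ i t) ^ (n - n₁)‖ =
        (n - n₁ : ℕ) * Real.log (N σ (P σ i)) - Real.log A := fun σ i => by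
      rw [norm_mul, norm_inv, norm_pow, hLP, Complex.norm_real, Real.norm_of_nonneg hA.le,
        Real.log_mul (inv_ne_zero hA.ne') (pow_ne_zero _ (hNP σ i).ne'), Real.log_inv, Real.log_pow]
      ring
    have h3 : Real.log (Ideal.absNorm (Ideal.span {u})) =
        Real.log (Ideal.absNorm (Ideal.span {e})) + j * (h * B) +
          r * Real.log (Ideal.absNorm (Ideal.span {θ i₀})) := by
      have : Ideal.span {u} = Ideal.span {e} * (𝔟 ^ h) ^ j * Ideal.span {θ i₀} ^ r := by
        rw [hα, Ideal.span_singleton_pow, Ideal.span_singleton_pow,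
          Ideal.span_singleton_mul_span_singleton, Ideal.span_singleton_mul_span_singleton]
      have hb1 : (Ideal.absNorm 𝔟 : ℝ) ≠ 0 := by
        rw [Nat.cast_ne_zero, Ne, Ideal.absNorm_eq_zero_iff]; exact hb0
      rw [this, map_mul, map_mul, map_pow, map_pow, map_pow]
      push_cast
      rw [Real.log_mul (mul_ne_zero (hnz he) (pow_ne_zero _ (pow_ne_zero _ hb1)))
        (pow_ne_zero _ (hnz hi)), Real.log_mul (hnz he) (pow_ne_zero _ (pow_ne_zero _ hb1)),
        Real.log_pow, Real.log_pow, Real.log_pow]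
    simp only [h2, h3, Finset.sum_sub_distrib, ← Finset.mul_sum, hΛ]
    have h4 : (r : ℝ) * Real.log (Ideal.absNorm (Ideal.span {θ i₀})) ≤
        h * Real.log (Ideal.absNorm (Ideal.span {θ i₀})) :=
      mul_le_mul_of_nonneg_right (by exact_mod_cast hr.le) (hlogI _)
    have h5 : (j : ℝ) * (h * B) ≤ (n - n₁ : ℕ) * B := by
      rw [← mul_assoc]
      refine mul_le_mul_of_nonneg_right ?_ hB
      have : j * h ≤ n - n₁ := by rw [mul_comm]; omega
      exact_mod_cast this
    simp only [Finset.sum_const, Finset.card_univ, hIc, nsmul_eq_mul, C₀, Ω, V] at *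
    linarith
  refine ach_of_eventually hN (C := a * n₁ + C₀ / d) (n₀ := n₁) fun n hn => ?_
  have hc := (hframe n hn).card_eq
  refine (hframe n hn).toFin.mono ?_
  rw [← hc, hIc, Nat.cast_sub hn]
  have h1 : ((n : ℝ) - n₁) * (a * d) ≤ (n - n₁) * (Λ - B) :=
    mul_le_mul_of_nonneg_left ha (by rw [sub_nonneg]; exact_mod_cast hn)
  have hd1 : (d : ℝ) ≠ 0 := by exact_mod_cast hd0.ne'
  have h2 : (a * n - (a * n₁ + C₀ / d)) * d = (n - n₁) * (a * d) - C₀ := by field_simp; ring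
  rw [h2]
  linarith

end PointCase

section Induction
open Module
variable {k : Type} [Field k] [NumberField k] {τ : Type} [Fintype τ]
  {N : (k →+* ℂ) → (τ → ℂ) → ℝ} {J : Ideal (MvPolynomial τ k)}

theorem hilbFun_eq_zero (h : ∀ i, (X i : MvPolynomial τ k) ∈ J) {n : ℕ} (hn : n ≠ 0) :
    hilbFun J n = 0 := by
  refine (card_eq_hilbFun (I := Empty) (b := fun x => x.elim) (fun x => x.elim)
    (fun t _ => Subsingleton.elim _ _) fun f hf => ⟨fun x => x.elim, ?_⟩).symm
  simp only [Finset.univ_eq_empty, Finset.sum_empty, sub_zero]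
  rw [f.as_sum]
  refine J.sum_mem fun m hm => ?_
  have h1 := hf (mem_support_iff.mp hm)
  obtain ⟨i, hi⟩ : ∃ i, m i ≠ 0 := by
    by_contra! h0
    have : m = 0 := Finsupp.ext h0
    rw [this, map_zero] at h1
    exact hn h1.symm
  exact J.mem_of_dvd (X_dvd_monomial.mpr (.inr hi)) (h i)

attribute [local instance] MvPolynomial.gradedAlgebra in
theorem exists_homogeneous_of_not_isPrime (hJ : IsHom J) (h1 : J ≠ ⊤) (hp : ¬ J.IsPrime) :
    ∃ (a b : MvPolynomial τ k) (e : ℕ), a.IsHomogeneous e ∧ a ∉ J ∧ b ∉ J ∧ a * b ∈ J := by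
  by_contra! h
  refine hp (Ideal.IsHomogeneous.isPrime_of_homogeneous_mem_or_mem (isHom_iff.mp hJ) h1 ?_)
  rintro x y ⟨e, hx⟩ ⟨-, -⟩ hxy
  by_contra! h2
  exact h x y e hx h2.1 h2.2 hxy

theorem Growth.of_mul (hN : GoodNorm N) (hJ : IsHom J) {a : MvPolynomial τ (𝓞 k)} {e : ℕ}
    (ha : a.IsHomogeneous e) (h1 : Growth (hilbFun (colonI J (toK a))))
    (h2 : Growth (hilbFun (J ⊔ Ideal.span {toK a}))) : Growth (hilbFun J) := by
  have h3 : Growth fun n => hilbFun (colonI J (toK a)) (n - e) :=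
    h1.shift (e := e) fun n => by rw [Nat.add_sub_cancel]
  refine (h3.add h2).congr' (m := e) fun n hn => ?_
  have := hilbFun_add hN hJ ha (n - e)
  rw [Nat.sub_add_cancel hn] at this
  exact this.symm

theorem Ach.of_mul (hN : GoodNorm N) (hJ : IsHom J) {a : MvPolynomial τ (𝓞 k)} {e : ℕ}
    (ha : a.IsHomogeneous e) {x : ℝ} (h1 : Ach N (colonI J (toK a)) x)
    (h2 : Ach N (J ⊔ Ideal.span {toK a}) x) : Ach N J x := by
  obtain ⟨C₁, h1⟩ := h1
  obtain ⟨C₂, h2⟩ := h2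
  obtain ⟨A, hA, hAa⟩ := exists_polyBall_uniform hN (I := Unit) (fun σ _ => map σ (toK a))
    fun σ _ => (ha.map _).map _
  obtain ⟨D, hD⟩ : ∃ D, D = finrank ℚ k * Real.log A := ⟨_, rfl⟩
  refine ach_of_eventually hN (C := |C₁| + |x * e| + |D| + |C₂|) (n₀ := e) fun n hn => ?_
  have h3 := Frame.union' hJ ha hA (fun σ => ⟨_, hAa σ (), by rw [sub_self]; exact zero_mem _⟩)
    (h1 (n - e)) (h2 (n - e + e))
  have h4 := hilbFun_add hN hJ ha (n - e)
  rw [Nat.sub_add_cancel hn] at h3 h4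
  refine h3.mono ?_
  rw [h4, ← hD, Nat.cast_sub hn]
  push_cast
  have e1 := le_abs_self C₁
  have e2 := le_abs_self (x * e)
  have e3 := le_abs_self D
  have e4 := le_abs_self C₂
  have p1 := abs_nonneg C₁
  have p2 := abs_nonneg (x * e)
  have p3 := abs_nonneg D
  have p4 := abs_nonneg C₂
  have k1 : (0 : ℝ) ≤ (|C₁| + |x * e| + |D| + |C₂| - C₁ - x * e - D) *
    hilbFun (colonI J (toK a)) (n - e) := mul_nonneg (by linarith) (Nat.cast_nonneg _)
  have k2 : (0 : ℝ) ≤ (|C₁| + |x * e| + |D| + |C₂| - C₂) *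
    hilbFun (J ⊔ Ideal.span {toK a}) n := mul_nonneg (by linarith) (Nat.cast_nonneg _)
  linarith

theorem toK_C_mul {a : MvPolynomial τ k} {d : 𝓞 k} (hd : d ≠ 0) {g : MvPolynomial τ (𝓞 k)}
    (hg : toK g = C (algebraMap (𝓞 k) k d) * a) :
    Ideal.span {toK g} = Ideal.span {a} := by
  rw [hg, mul_comm]
  refine Ideal.span_singleton_mul_right_unit ((isUnit_iff_ne_zero.mpr ?_).map C) _
  simpa using hd

theorem ach_of_bounded (hN : GoodNorm N) {l : ℝ} (hH : HeightBound N l) (hJ : IsHom J)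
    (hJp : J.IsPrime) {i : τ} (hi : (X i : MvPolynomial τ k) ∉ J) {D : ℕ}
    (hD : ∀ n, hilbFun J n ≤ D) : Ach N J l := by
  obtain ⟨K', _, _, _, θ, h1, h2, h3⟩ := exists_point hJp hi hD
  exact ach_of_point hN hJ h1 h2 h3 (hH K' θ fun h => h1 (congrFun h i))

theorem growth_and_ach [NumberField.IsTotallyComplex k] (hN : GoodNorm N) {l : ℝ}
    (hH : HeightBound N l) (hJ : IsHom J) : Growth (hilbFun J) ∧ ∀ a < l, Ach N J a := by
  revert hJ
  refine IsNoetherian.induction (P := fun J : Ideal (MvPolynomial τ k) => IsHom J →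
    Growth (hilbFun J) ∧ ∀ a < l, Ach N J a) (fun J ih hJ => ?_) J
  change Ideal (MvPolynomial τ k) at J
  by_cases hX : ∀ i, (X i : MvPolynomial τ k) ∈ J
  · refine ⟨.inl ⟨1, fun n hn => hilbFun_eq_zero hX (by omega)⟩, fun a _ =>
      ach_of_eventually hN (C := 0) (n₀ := 1) fun n hn => ?_⟩
    obtain ⟨v, hv⟩ := Frame.trivial hN J n
    have h0 := hilbFun_eq_zero hX (show n ≠ 0 by omega)
    have : IsEmpty (Fin (hilbFun J n)) := by rw [h0]; infer_instance
    rw [show ((a * n - 0) * hilbFun J n : ℝ) = 0 by rw [h0]; simp]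
    exact hv.zero_of_isEmpty
  obtain ⟨i, hi⟩ := not_forall.mp hX
  have hJ1 : J ≠ ⊤ := fun h => hi (h ▸ Submodule.mem_top)
  by_cases hp : J.IsPrime
  · have hXi : (X i : MvPolynomial τ (𝓞 k)).IsHomogeneous 1 := isHomogeneous_X _ i
    have hXK : toK (X i : MvPolynomial τ (𝓞 k)) = X i := map_X _ i
    have hJX : IsHom (J ⊔ Ideal.span {X i}) := hJ.sup (isHom_span (by
      rintro f rfl
      exact ⟨1, isHomogeneous_X _ i⟩))
    have hlt : J < J ⊔ Ideal.span {X i} := left_lt_sup.mpr fun h =>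
      hi (h (Ideal.mem_span_singleton_self _))
    have hρ : ∀ n, hilbFun J (n + 1) = hilbFun J n + hilbFun (J ⊔ Ideal.span {X i}) (n + 1) :=
      fun n => by
        have := hilbFun_add hN hJ hXi n
        rwa [hXK, colonI_eq_self hp hi] at this
    rcases (ih _ hlt hJX).1 with ⟨n₀, h0⟩ | ⟨d, c₁, c₂, n₀, hc, hh⟩
    · have hconst : ∀ n, hilbFun J (n₀ + n) = hilbFun J n₀ := fun n => by
        induction n with
        | zero => rfl
        | succ n ihn => rw [← add_assoc, hρ, ihn, h0 _ (by omega), add_zero]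
      have hmono : Monotone (hilbFun J) := monotone_nat_of_le_succ fun n => by
        rw [hρ]; exact Nat.le_add_right _ _
      refine ⟨.inr ⟨0, hilbFun J n₀, hilbFun J n₀, n₀, by exact_mod_cast hilbFun_pos hp hi n₀,
        fun n hn => ?_⟩, fun a ha => (ach_of_bounded hN hH hJ hp hi (D := hilbFun J n₀)
          fun n => ?_).mono ha.le⟩
      · rw [← Nat.add_sub_cancel' hn, hconst]
        simp
      · exact (hmono (Nat.le_add_left n n₀)).trans (hconst n).le
    · exact ach_of_isPrime hN hJ hp hi (fun J' h1 h2 => (ih J' h2 h1).2) hc hh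
  · obtain ⟨a, b, e, ha, haJ, hbJ, hab⟩ := exists_homogeneous_of_not_isPrime hJ hJ1 hp
    obtain ⟨d, hd, g, hg, hga⟩ := exists_integral_multiple ha
    have hsp := toK_C_mul hd hga
    have hagJ : toK g ∉ J := fun h => haJ (by
      have : Ideal.span {a} ≤ J := hsp ▸ (Ideal.span_singleton_le_iff_mem _).mpr h
      exact (Ideal.span_singleton_le_iff_mem _).mp this)
    have hgh : (toK g).IsHomogeneous e := hg.map _
    have l1 : J < J ⊔ Ideal.span {toK g} := left_lt_sup.mpr fun h =>
      hagJ (h (Ideal.mem_span_singleton_self _))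
    have l2 : J < colonI J (toK g) := lt_of_le_of_ne (fun _ hf => Ideal.mul_mem_left _ _ hf)
      fun h => hbJ (by
        rw [h, mem_colonI, hga, mul_assoc]
        exact Ideal.mul_mem_left _ _ hab)
    have p1 := ih _ l1 (hJ.sup (isHom_span (by
      rintro f rfl
      exact ⟨e, hgh⟩)))
    have p2 := ih _ l2 (hJ.colonI hgh)
    exact ⟨p2.1.of_mul hN hJ hg p1.1, fun x hx => (p2.2 x hx).of_mul hN hJ hg (p1.2 x hx)⟩

end Induction

section SymPower
variable {τ : Type} [Fintype τ]

/-- Exponents of degree `n`. -/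
@[ext] structure Mon (τ : Type) (n : ℕ) : Type where
  val : τ →₀ ℕ
  deg : val.degree = n

theorem Mon.val_le {n : ℕ} (m : Mon τ n) (i : τ) : m.1 i ≤ n := by
  have h := m.2
  rw [Finsupp.degree_eq_sum] at h
  exact (Finset.single_le_sum (f := fun i => m.1 i) (fun _ _ => Nat.zero_le _)
    (Finset.mem_univ i)).trans h.le

theorem Mon.injective_fin (n : ℕ) : Function.Injective fun (m : Mon τ n) (i : τ) =>
    (⟨m.1 i, Nat.lt_succ_of_le (m.val_le i)⟩ : Fin (n + 1)) := fun _ _ h =>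
  Mon.ext (Finsupp.ext fun i => Fin.ext_iff.mp (congrFun h i))

instance (n : ℕ) : Fintype (Mon τ n) := Fintype.ofInjective _ (Mon.injective_fin n)

theorem Mon.card_le (τ : Type) [Fintype τ] (n : ℕ) :
    Fintype.card (Mon τ n) ≤ (n + 1) ^ Fintype.card τ := by
  have := Fintype.card_le_of_injective _ (Mon.injective_fin (τ := τ) n)
  simpa using this

theorem sum_monomial_of_isHomogeneous {R : Type} [CommRing R] {n : ℕ} {p : MvPolynomial τ R}
    (hp : p.IsHomogeneous n) : p = ∑ m : Mon τ n, monomial m.1 (coeff m.1 p) := by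
  ext m
  rw [coeff_sum]
  simp only [coeff_monomial]
  by_cases hm : m.degree = n
  · rw [Finset.sum_eq_single (⟨m, hm⟩ : Mon τ n) (fun b _ hb => if_neg fun h => hb (Mon.ext h))
      (fun h => absurd (Finset.mem_univ _) h), if_pos rfl]
  · rw [hp.coeff_eq_zero hm, Finset.sum_eq_zero fun b _ => if_neg fun h => hm (by rw [← h, b.2])]

/-- Substitution of linear forms. -/
def subst (T : Matrix τ τ ℂ) : MvPolynomial τ ℂ →ₐ[ℂ] MvPolynomial τ ℂ :=
  aeval fun i => ∑ j, C (T i j) * X j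

theorem eval_subst (T : Matrix τ τ ℂ) (p : MvPolynomial τ ℂ) (v : τ → ℂ) :
    eval v (subst T p) = eval (T.mulVec v) p := by
  rw [subst, aeval_def, ← coe_eval₂Hom, ← RingHom.comp_apply]
  congr 1
  refine ringHom_ext (fun r => by simp) fun i => ?_
  simp [Matrix.mulVec, dotProduct]

theorem isHomogeneous_subst (T : Matrix τ τ ℂ) {p : MvPolynomial τ ℂ} {n : ℕ}
    (hp : p.IsHomogeneous n) : (subst T p).IsHomogeneous n := by
  have := hp.aeval (fun i => ∑ j, C (T i j) * X j) (n := 1) fun i =>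
    IsHomogeneous.sum _ _ _ fun j _ => by
      simpa using (isHomogeneous_C τ (T i j)).mul (isHomogeneous_X ℂ j)
  rwa [one_mul] at this

/-- The matrix of the `n`-th symmetric power. -/
def symMat (n : ℕ) (T : Matrix τ τ ℂ) : Matrix (Mon τ n) (Mon τ n) ℂ :=
  Matrix.of fun m m' => coeff m'.1 (subst T (monomial m.1 1))

theorem coeff_subst {n : ℕ} (T : Matrix τ τ ℂ) {p : MvPolynomial τ ℂ} (hp : p.IsHomogeneous n)
    (m' : Mon τ n) : coeff m'.1 (subst T p) = ∑ m : Mon τ n, coeff m.1 p * symMat n T m m' := by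
  conv_lhs => rw [sum_monomial_of_isHomogeneous hp, map_sum, coeff_sum]
  refine Finset.sum_congr rfl fun m _ => ?_
  rw [← mul_one (coeff m.1 p), ← C_mul_monomial, ← algebraMap_eq, ← Algebra.smul_def, map_smul,
    coeff_smul, smul_eq_mul, mul_one]
  rfl

theorem subst_mul (T U : Matrix τ τ ℂ) (p : MvPolynomial τ ℂ) :
    subst (T * U) p = subst U (subst T p) :=
  funext fun v => by
    rw [eval_subst, eval_subst, eval_subst, Matrix.mulVec_mulVec]

theorem symMat_mul (n : ℕ) (T U : Matrix τ τ ℂ) : symMat n (T * U) = symMat n T * symMat n U := by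
  ext m m'
  rw [Matrix.mul_apply, symMat, Matrix.of_apply, subst_mul, coeff_subst]
  · rfl
  · exact isHomogeneous_subst _ (isHomogeneous_monomial _ (by rw [m.2]))

theorem symMat_diagonal (n : ℕ) (d : τ → ℂ) :
    symMat n (Matrix.diagonal d) = Matrix.diagonal fun m => ∏ i, d i ^ m.1 i := by
  ext m m'
  have : subst (Matrix.diagonal d) (monomial m.1 1) = monomial m.1 (∏ i, d i ^ m.1 i) := by
    refine funext fun v => ?_
    rw [eval_subst, eval_monomial, eval_monomial, one_mul, Finsupp.prod_fintype _ _ (by simp),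
      Finsupp.prod_fintype _ _ (by simp), ← Finset.prod_mul_distrib]
    simp only [Matrix.mulVec_diagonal, mul_pow]
  rw [symMat, Matrix.of_apply, this, coeff_monomial, Matrix.diagonal_apply]
  simp only [Mon.ext_iff]

theorem card_mul_sum_mon (n : ℕ) (i : τ) :
    Fintype.card τ * ∑ m : Mon τ n, m.1 i = n * Fintype.card (Mon τ n) := by
  have hsymm : ∀ j, ∑ m : Mon τ n, m.1 j = ∑ m : Mon τ n, m.1 i := fun j => by
    have hd : ∀ m : τ →₀ ℕ, (m.equivMapDomain (Equiv.swap i j)).degree = m.degree := fun m => by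
      rw [Finsupp.degree_eq_sum, Finsupp.degree_eq_sum, ← Equiv.sum_comp (Equiv.swap i j)]
      simp
    let f : Mon τ n → Mon τ n := fun m => ⟨m.1.equivMapDomain (Equiv.swap i j), by rw [hd, m.2]⟩
    have hf : Function.Involutive f := fun m => Mon.ext (Finsupp.ext fun t => by simp [f])
    rw [← Equiv.sum_comp hf.toPerm]
    refine Finset.sum_congr rfl fun m _ => ?_
    simp [f]
  have h1 : ∑ j, ∑ m : Mon τ n, m.1 j = n * Fintype.card (Mon τ n) := by
    rw [Finset.sum_comm]
    have : ∀ m : Mon τ n, ∑ j, m.1 j = n := fun m => by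
      have h := m.2
      rwa [Finsupp.degree_eq_sum] at h
    simp [this, mul_comm]
  rw [← h1, Finset.sum_congr rfl fun j _ => hsymm j]
  simp

theorem det_symMat (n : ℕ) {T : Matrix τ τ ℂ} (hT : T.det ≠ 0) :
    (symMat n T).det ^ Fintype.card τ = T.det ^ (n * Fintype.card (Mon τ n)) := by
  have hone : symMat n (1 : Matrix τ τ ℂ) = 1 := by
    rw [← Matrix.diagonal_one, symMat_diagonal]
    simp
  have htr : ∀ (i j : τ) (c : ℂ), i ≠ j → (symMat n (Matrix.transvection i j c)).det = 1 := by
    intro i j c hij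
    let D : Matrix τ τ ℂ := Matrix.diagonal fun t => if t = i then 2 else 1
    have h1 : D * Matrix.transvection i j c =
        Matrix.transvection i j c * Matrix.transvection i j c * D := by
      rw [Matrix.transvection_mul_transvection_same i j hij]
      ext a b
      simp only [D, Matrix.diagonal_mul, Matrix.mul_diagonal, Matrix.transvection, Matrix.add_apply,
        Matrix.one_apply, Matrix.single_apply]
      by_cases ha : a = i
      · subst ha
        by_cases hb : b = a
        · subst hb
          simp [hij.symm]
        · simp [hb, Ne.symm hb]
          split_ifs <;> ring
      · by_cases hb : b = i
        · subst hb
          simp [ha, Ne.symm ha]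
        · simp [ha, hb, Ne.symm ha]
    have hinv : symMat n (Matrix.transvection i j c) * symMat n (Matrix.transvection i j (-c)) =
        1 := by
      rw [← symMat_mul, Matrix.transvection_mul_transvection_same i j hij, add_neg_cancel,
        Matrix.transvection_zero, hone]
    have hne : (symMat n (Matrix.transvection i j c)).det ≠ 0 := fun h0 => by
      have := congrArg Matrix.det hinv
      rw [Matrix.det_mul, h0, zero_mul, Matrix.det_one] at this
      exact zero_ne_one this
    have hD : (symMat n D).det ≠ 0 := by
      rw [symMat_diagonal, Matrix.det_diagonal]
      refine Finset.prod_ne_zero_iff.mpr fun m _ => Finset.prod_ne_zero_iff.mpr fun t _ =>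
        pow_ne_zero _ ?_
      split_ifs <;> norm_num
    have h2 := congrArg (fun A => (symMat n A).det) h1
    simp only [symMat_mul, Matrix.det_mul] at h2
    rw [mul_comm] at h2
    have h3 := mul_right_cancel₀ hD h2
    exact (mul_left_cancel₀ hne (by rw [mul_one]; exact h3)).symm
  refine Matrix.diagonal_transvection_induction_of_det_ne_zero (fun T => (symMat n T).det ^
    Fintype.card τ = T.det ^ (n * Fintype.card (Mon τ n))) T hT (fun d _ => ?_) (fun t => ?_)
    fun A B _ _ hA hB => ?_
  · rw [symMat_diagonal, Matrix.det_diagonal, Matrix.det_diagonal, Finset.prod_comm,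
      ← Finset.prod_pow, ← Finset.prod_pow]
    refine Finset.prod_congr rfl fun i _ => ?_
    rw [Finset.prod_pow_eq_pow_sum, ← pow_mul, mul_comm, card_mul_sum_mon]
  · rw [Matrix.TransvectionStruct.det, one_pow, Matrix.TransvectionStruct.toMatrix,
        htr _ _ _ t.hij, one_pow]
  · rw [symMat_mul, Matrix.det_mul, Matrix.det_mul, mul_pow, mul_pow, hA, hB]

theorem norm_coeff_le {p : MvPolynomial τ ℂ} {n : ℕ} (hp : p.IsHomogeneous n) {B : ℝ}
    (hB : ∀ w : τ → ℂ, (∀ i, ‖w i‖ = 1) → ‖eval w p‖ ≤ B) (m : Mon τ n) : ‖coeff m.1 p‖ ≤ B := by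
  obtain ⟨Q, hQ⟩ : ∃ Q, Q = n + 1 := ⟨_, rfl⟩
  have hQ0 : Q ≠ 0 := by omega
  have hζ := Complex.isPrimitiveRoot_exp Q hQ0
  set ζ := Complex.exp (2 * Real.pi * Complex.I / Q)
  have hζ0 : ζ ≠ 0 := Complex.exp_ne_zero _
  have hζ1 : ‖ζ‖ = 1 := hζ.norm'_eq_one hQ0
  have key : ∑ a : τ → Fin Q, eval (fun i => ζ ^ (a i : ℕ)) p * ∏ i, ((ζ ^ (a i : ℕ)) ^ m.1 i)⁻¹ =
      (Q : ℂ) ^ Fintype.card τ * coeff m.1 p := by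
    have h1 : ∀ a : τ → Fin Q, eval (fun i => ζ ^ (a i : ℕ)) p * ∏ i, ((ζ ^ (a i : ℕ)) ^ m.1 i)⁻¹ =
        ∑ m' : Mon τ n, coeff m'.1 p * ∏ i, (ζ ^ m'.1 i / ζ ^ m.1 i) ^ (a i : ℕ) := fun a => by
      conv_lhs => rw [sum_monomial_of_isHomogeneous hp, map_sum, Finset.sum_mul]
      refine Finset.sum_congr rfl fun m' _ => ?_
      rw [eval_monomial, Finsupp.prod_fintype _ _ (by simp), mul_assoc, ← Finset.prod_mul_distrib]
      congr 1
      refine Finset.prod_congr rfl fun i _ => ?_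
      rw [div_pow, ← pow_mul, ← pow_mul, ← pow_mul, ← pow_mul, mul_comm (a i : ℕ),
        mul_comm (a i : ℕ), div_eq_mul_inv]
    have hg : ∀ (m' : Mon τ n) i, ∑ t : Fin Q, (ζ ^ m'.1 i / ζ ^ m.1 i) ^ (t : ℕ) =
        if m'.1 i = m.1 i then (Q : ℂ) else 0 := fun m' i => by
      split_ifs with h
      · rw [h, div_self (pow_ne_zero _ hζ0)]
        simp
      · rw [Fin.sum_univ_eq_sum_range fun t => (ζ ^ m'.1 i / ζ ^ m.1 i) ^ t]
        have hx : ζ ^ m'.1 i / ζ ^ m.1 i ≠ 1 := fun h1 => h (by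
          rw [div_eq_one_iff_eq (pow_ne_zero _ hζ0)] at h1
          exact hζ.pow_inj (by have := m'.val_le i; omega) (by have := m.val_le i; omega) h1)
        have hxQ : (ζ ^ m'.1 i / ζ ^ m.1 i) ^ Q = 1 := by
          rw [div_pow, ← pow_mul, ← pow_mul, mul_comm, mul_comm (m.1 i), pow_mul, pow_mul,
            hζ.pow_eq_one, one_pow, one_pow, div_one]
        have := mul_geom_sum (ζ ^ m'.1 i / ζ ^ m.1 i) Q
        rw [hxQ, sub_self, mul_eq_zero] at this
        exact this.resolve_left (sub_ne_zero.mpr hx)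
    simp only [h1]
    rw [Finset.sum_comm]
    simp only [← Finset.mul_sum]
    have h2 : ∀ m' : Mon τ n, ∑ a : τ → Fin Q, ∏ i, (ζ ^ m'.1 i / ζ ^ m.1 i) ^ (a i : ℕ) =
        if m' = m then (Q : ℂ) ^ Fintype.card τ else 0 := fun m' => by
      rw [← Fintype.piFinset_univ, ← Finset.prod_univ_sum (fun _ => Finset.univ)
        fun i (t : Fin Q) => (ζ ^ m'.1 i / ζ ^ m.1 i) ^ (t : ℕ)]
      simp only [hg]
      split_ifs with h
      · rw [h]; simp
      · obtain ⟨i, hi⟩ : ∃ i, m'.1 i ≠ m.1 i := by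
          by_contra! h0
          exact h (Mon.ext (Finsupp.ext h0))
        exact Finset.prod_eq_zero (Finset.mem_univ i) (if_neg hi)
    simp only [h2, mul_ite, mul_zero, Finset.sum_ite_eq', Finset.mem_univ, if_true]
    ring
  have hb : ‖(Q : ℂ) ^ Fintype.card τ * coeff m.1 p‖ ≤ (Q : ℝ) ^ Fintype.card τ * B := by
    rw [← key]
    refine (norm_sum_le_of_le _ (f := fun a : τ → Fin Q => _) (n := fun _ => B) fun a _ =>
        ?_).trans ?_
    · rw [norm_mul, norm_prod]
      simp only [norm_inv, norm_pow, hζ1, one_pow, inv_one, Finset.prod_const_one, mul_one]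
      exact hB _ fun i => by rw [norm_pow, hζ1, one_pow]
    · simp
  rw [norm_mul, norm_pow, Complex.norm_natCast] at hb
  exact le_of_mul_le_mul_left hb (by positivity)

end SymPower

section FreeSiegel
open Module Matrix
variable {τ : Type} [Fintype τ]

open scoped MatrixOrder in
theorem exists_conjTranspose_mul_self {H : Matrix τ τ ℂ} (hH : H.PosDef) :
    ∃ T : Matrix τ τ ℂ, T.det ≠ 0 ∧ H = Tᴴ * T := by
  obtain ⟨T, hT⟩ := CStarAlgebra.nonneg_iff_eq_star_mul_self.mp hH.posSemidef.nonneg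
  refine ⟨T, fun h0 => hH.det_pos.ne' ?_, hT⟩
  rw [hT, det_mul, h0, mul_zero]

/-- The norm with Gram matrix `H`. -/
def gramNorm (H : Matrix τ τ ℂ) (v : τ → ℂ) : ℝ := √(star v ⬝ᵥ H *ᵥ v).re

theorem gramNorm_eq (T : Matrix τ τ ℂ) (v : τ → ℂ) :
    gramNorm (Tᴴ * T) v = ‖WithLp.toLp 2 (T *ᵥ v)‖ := by
  rw [gramNorm, EuclideanSpace.norm_eq, ← mulVec_mulVec, dotProduct_mulVec, ← star_mulVec]
  congr 1
  rw [dotProduct, Complex.re_sum]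
  refine Finset.sum_congr rfl fun i _ => ?_
  rw [Pi.star_apply, RCLike.star_def, ← Complex.normSq_eq_conj_mul_self, Complex.ofReal_re,
    Complex.normSq_eq_norm_sq]

theorem goodNorm_gramNorm {k : Type} [Field k] {H : (k →+* ℂ) → Matrix τ τ ℂ}
    (hpos : ∀ σ, (H σ).PosDef)
    (hconj : ∀ σ, H ((starRingEnd ℂ).comp σ) = (H σ).map (starRingEnd ℂ)) :
    GoodNorm fun σ => gramNorm (H σ) where
  nonneg _ _ := Real.sqrt_nonneg _
  lower σ := by
    obtain ⟨T, hT, hH⟩ := exists_conjTranspose_mul_self (hpos σ)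
    refine ⟨∑ i, ∑ j, ‖T⁻¹ i j‖ + 1, add_pos_of_nonneg_of_pos (Finset.sum_nonneg fun i _ =>
      Finset.sum_nonneg fun j _ => norm_nonneg _) one_pos, fun v i => ?_⟩
    rw [hH, gramNorm_eq]
    have h1 : v = T⁻¹ *ᵥ (T *ᵥ v) := by
      rw [mulVec_mulVec, nonsing_inv_mul _ (isUnit_iff_ne_zero.mpr hT), one_mulVec]
    conv_lhs => rw [h1]
    refine (norm_sum_le _ _).trans ?_
    have h2 : ∀ j, ‖T⁻¹ i j * (T *ᵥ v) j‖ ≤ ‖T⁻¹ i j‖ * ‖WithLp.toLp 2 (T *ᵥ v)‖ := fun j => by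
      rw [norm_mul]
      exact mul_le_mul_of_nonneg_left (PiLp.norm_apply_le (WithLp.toLp 2 (T *ᵥ v)) j)
        (norm_nonneg _)
    refine (Finset.sum_le_sum fun j _ => h2 j).trans ?_
    rw [← Finset.sum_mul]
    refine mul_le_mul_of_nonneg_right ?_ (norm_nonneg _)
    have := Finset.single_le_sum (f := fun i => ∑ j, ‖T⁻¹ i j‖)
      (fun i _ => Finset.sum_nonneg fun j _ => norm_nonneg _) (Finset.mem_univ i)
    linarith
  peak σ v := by
    obtain ⟨T, hT, hH⟩ := exists_conjTranspose_mul_self (hpos σ)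
    simp only [hH, gramNorm_eq]
    let a := WithLp.toLp 2 (T *ᵥ v)
    have key : ∀ w, ∑ j, (∑ i, star ((T *ᵥ v) i) * T i j / (‖a‖ : ℂ)) * w j =
        inner ℂ a (WithLp.toLp 2 (T *ᵥ w)) / (‖a‖ : ℂ) := fun w => by
      simp only [PiLp.inner_apply, RCLike.inner_apply, a, mulVec, dotProduct, Finset.sum_mul,
        Finset.sum_div]
      rw [Finset.sum_comm]
      refine Finset.sum_congr rfl fun i _ => Finset.sum_congr rfl fun j _ => ?_
      rw [RCLike.star_def]
      ring
    refine ⟨fun j => ∑ i, star ((T *ᵥ v) i) * T i j / (‖a‖ : ℂ), fun w => ?_, ?_⟩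
    · rw [key, norm_div, Complex.norm_real, norm_norm]
      exact div_le_of_le_mul₀ (norm_nonneg _) (norm_nonneg _) ((norm_inner_le_norm _ _).trans_eq
        (mul_comm _ _))
    · rw [key, inner_self_eq_norm_sq_to_K, norm_div, norm_pow, Complex.norm_real, norm_norm]
      change ‖((‖a‖ : ℝ) : ℂ)‖ ^ 2 / ‖a‖ = ‖a‖
      rw [Complex.norm_real, norm_norm]
      by_cases h : ‖a‖ = 0
      · rw [h]; simp
      · field_simp
  conj σ v := by
    rw [gramNorm, gramNorm, hconj, ← Complex.conj_re]
    congr 2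
    simp [dotProduct, mulVec, map_sum, map_mul]

theorem frame_bot_bound {k : Type} [Field k] [NumberField k] [Nonempty τ]
    {H : (k →+* ℂ) → Matrix τ τ ℂ}
    (hpos : ∀ σ, (H σ).PosDef) {n : ℕ} {v : ℝ}
    (h : Frame (fun σ => gramNorm (H σ)) (⊥ : Ideal (MvPolynomial τ k)) n (Mon τ n) v) :
    v ≤ ∑ σ, (Fintype.card (Mon τ n) * Real.log (Fintype.card (Mon τ n)) +
      Fintype.card (Mon τ n) * (n * (Real.log (Fintype.card τ) / 2)) +
      n * Fintype.card (Mon τ n) / Fintype.card τ * (Real.log (H σ).det.re / 2)) := by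
  obtain ⟨b, hb, -, hspan, M, hM, hv⟩ := h
  let ρ := Fintype.card (Mon τ n)
  let s := Fintype.card τ
  have hs : (0 : ℝ) < s := by exact_mod_cast Fintype.card_pos
  have hρ : (0 : ℝ) < ρ := by
    have i := Classical.arbitrary τ
    have : Nonempty (Mon τ n) := ⟨⟨Finsupp.single i n, by simp⟩⟩
    exact_mod_cast Fintype.card_pos
  let B : Matrix (Mon τ n) (Mon τ n) (𝓞 k) := Matrix.of fun j m => coeff m.1 (b j)
  have hBcoe : ∀ σ : k →+* ℂ, σ (B.det : k) =
      (Matrix.of fun j (m : Mon τ n) => coeff m.1 (map σ (toK (b j)))).det := fun σ => by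
    have h1 := RingHom.map_det (σ.comp (algebraMap (𝓞 k) k)) B
    refine h1.trans ?_
    congr 1
  have hB0 : B.det ≠ 0 := by
    choose t ht using fun m : Mon τ n => hspan (monomial m.1 1)
      (isHomogeneous_monomial _ (by rw [m.2]))
    have h1 : Matrix.of t * B.map (algebraMap (𝓞 k) k) = 1 := by
      ext m m'
      have h2 := congrArg (coeff m'.1) (sub_eq_zero.mp ((Submodule.mem_bot _).mp (ht m)))
      rw [coeff_monomial, coeff_sum] at h2
      rw [Matrix.mul_apply, Matrix.one_apply]
      simp only [Mon.ext_iff, h2]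
      refine Finset.sum_congr rfl fun j _ => ?_
      rw [coeff_C_mul, coeff_map]
      rfl
    intro h0
    have h2 := congrArg Matrix.det h1
    rw [det_mul, det_one, ← RingHom.mapMatrix_apply, ← RingHom.map_det, h0, map_zero,
        mul_zero] at h2
    exact zero_ne_one h2
  have hBlog : 0 ≤ ∑ σ : k →+* ℂ, Real.log ‖σ B.det‖ := by
    rw [sum_log_norm_int hB0]
    exact Real.log_natCast_nonneg _
  have key : ∀ σ, Real.log ‖(M σ).det‖ + Real.log ‖σ B.det‖ ≤ ρ * Real.log ρ +
      ρ * (n * (Real.log s / 2)) + n * ρ / s * (Real.log (H σ).det.re / 2) := fun σ => by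
    obtain ⟨T, hT, hH⟩ := exists_conjTranspose_mul_self (hpos σ)
    choose c hc hcM using (hM σ).2
    have hT' : T⁻¹.det ≠ 0 := by
      rw [det_nonsing_inv, Ring.inverse_eq_inv']; exact inv_ne_zero hT
    let Cm : Matrix (Mon τ n) (Mon τ n) ℂ := Matrix.of fun i m => coeff m.1 (subst T⁻¹ (c i))
    have hCm : Cm = M σ * (Matrix.of fun j (m : Mon τ n) => coeff m.1 (map σ (toK (b j)))) *
        symMat n T⁻¹ := by
      ext i m'
      rw [Matrix.mul_apply]
      refine (coeff_subst T⁻¹ (hc i).1 m').trans (Finset.sum_congr rfl fun m _ => ?_)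
      congr 1
      have h1 := hcM i
      rw [Ideal.map_bot, Ideal.mem_bot, sub_eq_zero] at h1
      rw [h1, coeff_sum, Matrix.mul_apply]
      simp only [coeff_C_mul, Matrix.of_apply]
    have hcoef : ∀ i m, ‖Cm i m‖ ≤ √s ^ n := fun i m => by
      refine norm_coeff_le (isHomogeneous_subst _ (hc i).1) (fun w hw => ?_) m
      rw [eval_subst]
      refine ((hc i).2 _).trans_eq ?_
      change gramNorm (H σ) _ ^ n = _
      rw [hH, gramNorm_eq, mulVec_mulVec, mul_nonsing_inv _ (isUnit_iff_ne_zero.mpr hT), one_mulVec,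
        EuclideanSpace.norm_eq]
      simp [hw, s]
    have hdet : ‖Cm.det‖ ≤ ρ.factorial * (√s ^ n) ^ ρ := by
      have := det_le (A := Cm) (abv := IsAbsoluteValue.toAbsoluteValue (norm : ℂ → ℝ)) hcoef
      rwa [nsmul_eq_mul] at this
    have hSdet : (symMat n T⁻¹).det ≠ 0 := fun h0 => by
      have := det_symMat n hT'
      rw [h0, zero_pow Fintype.card_ne_zero] at this
      exact pow_ne_zero _ hT' this.symm
    have hS : Real.log ‖(symMat n T⁻¹).det‖ = -(n * ρ / s * (Real.log (H σ).det.re / 2)) := by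
      have h1 := congrArg (fun z : ℂ => Real.log ‖z‖) (det_symMat n hT')
      simp only [norm_pow, Real.log_pow] at h1
      have h2 : Real.log ‖T⁻¹.det‖ = -(Real.log (H σ).det.re / 2) := by
        rw [det_nonsing_inv, Ring.inverse_eq_inv', norm_inv, Real.log_inv]
        have : (H σ).det.re = ‖T.det‖ ^ 2 := by
          rw [hH, det_mul, det_conjTranspose, RCLike.star_def, ← Complex.normSq_eq_conj_mul_self,
            Complex.ofReal_re, Complex.normSq_eq_norm_sq]
        rw [this, Real.log_pow]
        push_cast
        ring
      rw [h2] at h1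
      push_cast at h1
      field_simp
      change (s : ℝ) * _ = _ at h1
      rw [mul_comm] at h1
      linarith
    have hσB : ‖σ B.det‖ ≠ 0 := by simpa using hB0
    rw [hCm, det_mul, det_mul, ← hBcoe, norm_mul, norm_mul] at hdet
    have hMd : ‖(M σ).det‖ ≠ 0 := by simpa using (hM σ).1
    have hSd : ‖(symMat n T⁻¹).det‖ ≠ 0 := by simpa using hSdet
    have h3 := Real.log_le_log (by positivity) hdet
    have hsq : √(s : ℝ) ≠ 0 := (Real.sqrt_pos.mpr hs).ne'
    rw [Real.log_mul (mul_ne_zero hMd hσB) hSd, Real.log_mul hMd hσB, hS, Real.log_mul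
      (by positivity) (pow_ne_zero _ (pow_ne_zero _ hsq)), Real.log_pow, Real.log_pow,
      Real.log_sqrt hs.le] at h3
    have h4 : Real.log ρ.factorial ≤ ρ * Real.log ρ := by
      rw [← Real.log_pow]
      refine Real.log_le_log (by positivity) ?_
      exact_mod_cast Nat.factorial_le_pow ρ
    linarith
  have := Finset.sum_le_sum fun σ (_ : σ ∈ Finset.univ) => key σ
  rw [Finset.sum_add_distrib] at this
  linarith

/-- The absolute Siegel lemma for a free module. -/
theorem siegel_free {k : Type} [Field k] [NumberField k] [NumberField.IsTotallyComplex k]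
    [Nonempty τ] {H : (k →+* ℂ) → Matrix τ τ ℂ} (hpos : ∀ σ, (H σ).PosDef)
    (hconj : ∀ σ, H ((starRingEnd ℂ).comp σ) = (H σ).map (starRingEnd ℂ)) {l : ℝ}
    (hl : HeightBound (fun σ => gramNorm (H σ)) l) :
    Fintype.card τ * l ≤ (∑ σ, Real.log (H σ).det.re) / 2 +
      Fintype.card τ / 2 * (finrank ℚ k * Real.log (Fintype.card τ)) := by
  have hN := goodNorm_gramNorm hpos hconj
  have hs : (0 : ℝ) < Fintype.card τ := by exact_mod_cast Fintype.card_pos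
  have hbot : IsHom (⊥ : Ideal (MvPolynomial τ k)) := fun f hf n => by
    rw [(Submodule.mem_bot _).mp hf, map_zero]
    exact zero_mem _
  have hach := (growth_and_ach hN hl hbot).2
  have hcardN : Fintype.card (k →+* ℂ) = finrank ℚ k := NumberField.Embeddings.card k ℂ
  rw [← le_div_iff₀' hs]
  refine le_of_forall_lt fun a ha => ?_
  obtain ⟨a', haa', ha'⟩ := exists_between ha
  obtain ⟨c, hc⟩ := hach a' ha'
  refine haa'.trans_le ?_
  have hn : ∀ n : ℕ, 0 < n → a' - c / n ≤ finrank ℚ k * (Fintype.card τ * (Real.log (n + 1) / n)) +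
      ((∑ σ, Real.log (H σ).det.re) / 2 +
      Fintype.card τ / 2 * (finrank ℚ k * Real.log (Fintype.card τ))) / Fintype.card τ := by
    intro n hn
    have hcard : Fintype.card (Mon τ n) = hilbFun (⊥ : Ideal (MvPolynomial τ k)) n := by
      have hsum : ∀ t : Mon τ n → k, ∀ m, coeff m.1 (∑ i, C (t i) * monomial i.1 (1 : k)) = t m :=
        fun t m => by
          rw [coeff_sum, Finset.sum_eq_single m]
          · rw [coeff_C_mul, coeff_monomial, if_pos rfl, mul_one]
          · intro b _ hb
            rw [coeff_C_mul, coeff_monomial, if_neg fun h => hb (Mon.ext h), mul_zero]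
          · exact fun h => absurd (Finset.mem_univ _) h
      refine card_eq_hilbFun (b := fun m => monomial m.1 1)
        (fun m => isHomogeneous_monomial _ (by rw [m.2])) (fun t ht => funext fun m => ?_)
        fun f hf => ⟨fun m => coeff m.1 f, ?_⟩
      · rw [← hsum t m, (Submodule.mem_bot _).mp ht]
        rfl
      · rw [Submodule.mem_bot, sub_eq_zero]
        conv_lhs => rw [sum_monomial_of_isHomogeneous hf]
        simp [C_mul_monomial]
    have h1 := frame_bot_bound hpos ((hc n).reindex (Fintype.equivFinOfCardEq hcard).symm)
    rw [← hcard] at h1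
    have hρ : (0 : ℝ) < Fintype.card (Mon τ n) := by
      have i := Classical.arbitrary τ
      have : Nonempty (Mon τ n) := ⟨⟨Finsupp.single i n, by simp⟩⟩
      exact_mod_cast Fintype.card_pos
    have hlogρ : Real.log (Fintype.card (Mon τ n)) ≤ Fintype.card τ * Real.log (n + 1) := by
      rw [← Real.log_pow]
      exact Real.log_le_log hρ (by exact_mod_cast Mon.card_le τ n)
    rw [Finset.sum_add_distrib, ← Finset.mul_sum, Finset.sum_const, Finset.card_univ, hcardN,
      nsmul_eq_mul, ← Finset.sum_div] at h1
    have hn' : (0 : ℝ) < n := by exact_mod_cast hn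
    have h2 : (a' * n - c) * Fintype.card (Mon τ n) =
        (a' - c / n) * (n * Fintype.card (Mon τ n)) := by
      field_simp
    rw [h2, ← le_div_iff₀ (by positivity)] at h1
    refine h1.trans ?_
    have h3 : (finrank ℚ k : ℝ) * Real.log (Fintype.card (Mon τ n)) / n ≤
        finrank ℚ k * (Fintype.card τ * (Real.log (n + 1) / n)) := by
      rw [mul_div_assoc]
      refine mul_le_mul_of_nonneg_left ?_ (Nat.cast_nonneg _)
      rw [← mul_div_assoc]
      exact div_le_div_of_nonneg_right hlogρ hn'.le
    refine le_trans (le_of_eq ?_) (add_le_add_left h3 _)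
    field_simp
    ring
  have ht1 : Filter.Tendsto (fun n : ℕ => c / (n : ℝ)) Filter.atTop (nhds 0) :=
    tendsto_const_div_atTop_nhds_zero_nat c
  have ht2 : Filter.Tendsto (fun n : ℕ => Real.log ((n : ℝ) + 1) / n) Filter.atTop (nhds 0) := by
    have h1 := (Real.tendsto_pow_log_div_mul_add_atTop 1 (-1) 1 one_ne_zero).comp
      (Filter.tendsto_atTop_add_const_right _ (1 : ℝ) tendsto_natCast_atTop_atTop)
    simpa [Function.comp_def] using h1
  have ht3 := (ht2.const_mul (Fintype.card τ : ℝ)).const_mul (finrank ℚ k : ℝ)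
  rw [mul_zero, mul_zero] at ht3
  refine le_of_tendsto_of_tendsto (by simpa using (tendsto_const_nhds (x := a')).sub ht1)
    (by simpa using ht3.add_const _) (Filter.eventually_atTop.mpr ⟨1, fun n h => hn n h⟩)

end FreeSiegel

end PolynomialSide

section MatrixInequalities
open Matrix
variable {n p a c : Type} [Fintype n] [Fintype p] [Fintype a] [Fintype c]

theorem det_le_trace_div_card_pow [Nonempty n] {M : Matrix n n ℂ} (hM : M.PosSemidef) :
    M.det.re ≤ (M.trace.re / Fintype.card n) ^ Fintype.card n := by
  have hn : (0 : ℝ) < Fintype.card n := by exact_mod_cast Fintype.card_pos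
  rw [hM.1.det_eq_prod_eigenvalues, hM.1.trace_eq_sum_eigenvalues]
  simp only [Complex.coe_algebraMap, ← Complex.ofReal_prod, ← Complex.ofReal_sum,
    Complex.ofReal_re]
  have h0 := fun i => hM.eigenvalues_nonneg i
  have h := Real.geom_mean_le_arith_mean Finset.univ (fun _ => (1 : ℝ)) hM.1.eigenvalues
    (fun _ _ => zero_le_one) (by simpa using hn) fun i _ => h0 i
  simp only [Real.rpow_one, one_mul, Finset.sum_const, Finset.card_univ, nsmul_eq_mul, mul_one] at h
  have hp := Finset.prod_nonneg fun i (_ : i ∈ Finset.univ) => h0 i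
  calc _ = ((∏ i, hM.1.eigenvalues i) ^ ((Fintype.card n : ℝ)⁻¹)) ^ Fintype.card n := by
        rw [Real.rpow_inv_natCast_pow hp Fintype.card_ne_zero]
    _ ≤ _ := by
      gcongr

theorem det_le_det_of_posSemidef_sub {A B : Matrix n n ℂ} (hA : A.PosSemidef) (hB : B.PosDef)
    (h : (B - A).PosSemidef) : A.det.re ≤ B.det.re := by
  cases isEmpty_or_nonempty n
  · simp
  obtain ⟨T, hT, rfl⟩ := exists_conjTranspose_mul_self hB
  have hTu : IsUnit T.det := isUnit_iff_ne_zero.mpr hT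
  have hn : (0 : ℝ) < Fintype.card n := by exact_mod_cast Fintype.card_pos
  have h1 := hA.conjTranspose_mul_mul_same T⁻¹
  have h2 := (h.conjTranspose_mul_mul_same T⁻¹).trace_nonneg
  have h3 : (T⁻¹)ᴴ * (Tᴴ * T - A) * T⁻¹ = 1 - (T⁻¹)ᴴ * A * T⁻¹ := by
    rw [mul_sub, sub_mul, ← mul_assoc, ← conjTranspose_mul, mul_nonsing_inv _ hTu,
      conjTranspose_one, one_mul, mul_nonsing_inv _ hTu]
  rw [h3, trace_sub, trace_one, sub_nonneg] at h2
  have h4 : ((T⁻¹)ᴴ * A * T⁻¹).det.re ≤ 1 := by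
    refine (det_le_trace_div_card_pow h1).trans (pow_le_one₀ ?_ ?_)
    · exact div_nonneg (Complex.le_def.mp h1.trace_nonneg).1 hn.le
    · rw [div_le_one hn]
      simpa using (Complex.le_def.mp h2).1
  have h5 : A = Tᴴ * ((T⁻¹)ᴴ * A * T⁻¹) * T := by
    rw [mul_assoc, mul_assoc, mul_assoc, nonsing_inv_mul _ hTu, mul_one, ← mul_assoc,
      ← conjTranspose_mul, nonsing_inv_mul _ hTu, conjTranspose_one, one_mul]
  have h6 : ∀ z : ℂ, ((star T.det) * z * T.det).re = Complex.normSq T.det * z.re := fun z => by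
    rw [mul_right_comm, RCLike.star_def, ← Complex.normSq_eq_conj_mul_self, Complex.re_ofReal_mul]
  have h7 := h6 1
  rw [mul_one, Complex.one_re] at h7
  rw [h5, det_mul, det_mul, det_conjTranspose, h6, det_mul Tᴴ T, det_conjTranspose, h7]
  exact mul_le_mul_of_nonneg_left h4 (Complex.normSq_nonneg _)

theorem posSemidef_inv_sub {P : Matrix p p ℂ} (hP : P.PosDef) {J : Matrix p a ℂ}
    (hJ : (Jᴴ * P * J).PosDef) : (P⁻¹ - J * (Jᴴ * P * J)⁻¹ * Jᴴ).PosSemidef := by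
  set G := Jᴴ * P * J with hG
  have hPu : IsUnit P.det := (isUnit_iff_isUnit_det _).mp hP.isUnit
  have hGu : IsUnit G.det := (isUnit_iff_isUnit_det _).mp hJ.isUnit
  set Q := P⁻¹ - J * G⁻¹ * Jᴴ with hQ
  have h1 : Jᴴ * P * Q = 0 := by
    rw [hQ, Matrix.mul_sub, Matrix.mul_assoc, mul_nonsing_inv _ hPu, Matrix.mul_one,
        ← Matrix.mul_assoc,
      ← Matrix.mul_assoc, ← hG, mul_nonsing_inv _ hGu, Matrix.one_mul, sub_self]
  have h2 : Qᴴ = Q := by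
    rw [hQ, conjTranspose_sub, conjTranspose_mul, conjTranspose_mul, conjTranspose_conjTranspose,
      hP.inv.isHermitian, hJ.inv.isHermitian, Matrix.mul_assoc]
  have h3 : Q = Qᴴ * P * Q := by
    rw [h2]
    conv_rhs => rw [hQ, sub_mul, sub_mul, nonsing_inv_mul _ hPu, one_mul,
      Matrix.mul_assoc (J * G⁻¹), Matrix.mul_assoc (J * G⁻¹), h1, Matrix.mul_zero, sub_zero]
  rw [h3]
  exact hP.posSemidef.conjTranspose_mul_mul_same Q

theorem det_fromBlocks_submodular {P : Matrix p p ℂ} {g : Matrix p c ℂ} {D : Matrix c c ℂ}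
    {J : Matrix p a ℂ} (hG : (fromBlocks P g gᴴ D).PosDef)
    (hJ : (fromBlocks (Jᴴ * P * J) (Jᴴ * g) (Jᴴ * g)ᴴ D).PosDef) :
    (fromBlocks P g gᴴ D).det.re * (Jᴴ * P * J).det.re ≤
      P.det.re * (fromBlocks (Jᴴ * P * J) (Jᴴ * g) (Jᴴ * g)ᴴ D).det.re := by
  have hP : P.PosDef := hG.submatrix (e := Sum.inl) Sum.inl_injective
  have hA : (Jᴴ * P * J).PosDef := hJ.submatrix (e := Sum.inl) Sum.inl_injective
  have := hP.isUnit.invertible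
  have := hA.isUnit.invertible
  have key : ∀ {q : Type} [Fintype q] {R : Matrix q q ℂ} (hR : R.PosDef) (k : Matrix q c ℂ)
      (_ : (fromBlocks R k kᴴ D).PosDef), (D - kᴴ * R⁻¹ * k).PosDef ∧
      (fromBlocks R k kᴴ D).det.re = R.det.re * (D - kᴴ * R⁻¹ * k).det.re := by
    intro q _ R hR k hk
    have := hR.isUnit.invertible
    have hRu : IsUnit R.det := (isUnit_iff_isUnit_det _).mp hR.isUnit
    refine ⟨?_, ?_⟩
    · let V : Matrix (q ⊕ c) c ℂ := fromRows (-(R⁻¹ * k)) 1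
      have hV : Vᴴ = fromCols (-(kᴴ * R⁻¹)) 1 := by
        rw [conjTranspose_fromRows_eq_fromCols_conjTranspose, conjTranspose_neg, conjTranspose_one,
          conjTranspose_mul, hR.inv.isHermitian]
      have hS : D - kᴴ * R⁻¹ * k = Vᴴ * fromBlocks R k kᴴ D * V := by
        rw [hV, fromCols_mul_fromBlocks, fromCols_mul_fromRows, Matrix.one_mul, Matrix.one_mul,
          Matrix.neg_mul, Matrix.mul_assoc _ _ R, nonsing_inv_mul _ hRu, Matrix.mul_one,
          neg_add_cancel, Matrix.zero_mul, zero_add, Matrix.neg_mul, Matrix.mul_one, sub_eq_neg_add]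
      rw [hS]
      refine hk.conjTranspose_mul_mul_same fun v w hvw => ?_
      have := congrArg (fun u => u ∘ Sum.inr) hvw
      simpa [V, fromRows_mulVec] using this
    · rw [det_fromBlocks₁₁, invOf_eq_nonsing_inv]
      have h1 := hR.det_pos
      rw [Complex.mul_re, (Complex.lt_def.mp h1).2.symm]
      simp
  obtain ⟨h1, h2⟩ := key hP g hG
  obtain ⟨h3, h4⟩ := key hA (Jᴴ * g) hJ
  rw [h2, h4]
  have h5 := det_le_det_of_posSemidef_sub h1.posSemidef h3 (by
    have := (posSemidef_inv_sub hP hA).conjTranspose_mul_mul_same g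
    convert this using 1
    simp only [conjTranspose_mul, conjTranspose_conjTranspose, Matrix.mul_sub, Matrix.sub_mul,
      Matrix.mul_assoc]
    abel)
  have h6 := (Complex.lt_def.mp hP.det_pos).1
  have h7 := (Complex.lt_def.mp hA.det_pos).1
  rw [Complex.zero_re] at h6 h7
  calc _ = P.det.re * (Jᴴ * P * J).det.re * (D - gᴴ * P⁻¹ * g).det.re := by ring
    _ ≤ P.det.re * (Jᴴ * P * J).det.re * _ := mul_le_mul_of_nonneg_left h5 (by positivity)
    _ = _ := by ring

end MatrixInequalities

section Content
open Matrix nonZeroDivisors FractionalIdeal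
variable {A B β γ p a c : Type} [Fintype A] [Fintype B] [Fintype β] [Fintype γ] [Fintype p]
  [Fintype a] [Fintype c]

theorem det_mul_eq_sum {R : Type} [CommRing R] (Q : Matrix β A R) (P : Matrix A β R) :
    (Q * P).det = ∑ f : β → A, (∏ b, Q b (f b)) * (P.submatrix f id).det := by
  have h1 : (Q * P).det = (detRowAlternating : (β → R) [⋀^β]→ₗ[R] R).toMultilinearMap
      (fun b => ∑ i, Q b i • P i) := by
    change detRowAlternating (Q * P) = detRowAlternating _
    congr 1
    ext i j
    simp [Matrix.mul_apply]
  rw [h1, MultilinearMap.map_sum]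
  exact Finset.sum_congr rfl fun f _ => MultilinearMap.map_smul_univ _ _ _

variable {N : Type} [Field N] [NumberField N]

/-- The fractional ideal generated by the maximal minors of `P`. -/
def cont (P : Matrix A β N) : FractionalIdeal (𝓞 N)⁰ N :=
  ∑ f : β → A, spanSingleton (𝓞 N)⁰ (P.submatrix f id).det

theorem sum_spanSingleton_le_iff (x : p → N) {I : FractionalIdeal (𝓞 N)⁰ N} :
    ∑ i, spanSingleton (𝓞 N)⁰ (x i) ≤ I ↔ ∀ i, x i ∈ I := by
  have : ∑ i, spanSingleton (𝓞 N)⁰ (x i) = Finset.univ.sup fun i => spanSingleton (𝓞 N)⁰ (x i) := by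
    induction (Finset.univ : Finset p) using Finset.induction_on with
    | empty => simp
    | insert f s hf ih => rw [Finset.sum_insert hf, Finset.sup_insert, ih]; rfl
  rw [this, Finset.sup_le_iff]
  simp [spanSingleton_le_iff_mem]

theorem cont_le_iff {P : Matrix A β N} {I : FractionalIdeal (𝓞 N)⁰ N} :
    cont P ≤ I ↔ ∀ f : β → A, (P.submatrix f id).det ∈ I :=
  sum_spanSingleton_le_iff _

theorem cont_mul_cont_le_iff {P : Matrix A β N} {Q : Matrix B γ N}
    {I : FractionalIdeal (𝓞 N)⁰ N} : cont P * cont Q ≤ I ↔ ∀ (f : β → A) (g : γ → B),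
      (P.submatrix f id).det * (Q.submatrix g id).det ∈ I := by
  rw [cont, cont, Finset.sum_mul_sum]
  simp only [spanSingleton_mul_spanSingleton]
  rw [← Fintype.sum_prod_type', sum_spanSingleton_le_iff
    fun q : (β → A) × (γ → B) => (P.submatrix q.1 id).det * (Q.submatrix q.2 id).det]
  exact Prod.forall

theorem det_mem_cont (P : Matrix A β N) (f : β → A) : (P.submatrix f id).det ∈ cont P :=
  cont_le_iff.mp le_rfl f

theorem det_mul_mem_cont (Q : Matrix β A (𝓞 N)) (P : Matrix A β N) :
    (Q.map (algebraMap (𝓞 N) N) * P).det ∈ cont P := by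
  rw [det_mul_eq_sum, ← mem_coe]
  refine Submodule.sum_mem _ fun f _ => ?_
  have h := Submodule.smul_mem (cont P : Submodule (𝓞 N) N) (∏ b, Q b (f b))
    (mem_coe.mpr (det_mem_cont P f))
  rwa [Algebra.smul_def, map_prod] at h

theorem cont_ne_zero {P : Matrix A β N} {Q : Matrix β A N} (h : Q * P = 1) : cont P ≠ 0 := by
  intro h0
  have h1 := congrArg Matrix.det h
  rw [det_mul_eq_sum, det_one, Finset.sum_eq_zero] at h1
  · exact zero_ne_one h1
  · intro f _
    have := det_mem_cont P f
    rw [h0, mem_zero_iff] at this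
    rw [this, mul_zero]

theorem cont_mul (P : Matrix A β N) (g : Matrix β β N) :
    cont (P * g) = spanSingleton (𝓞 N)⁰ g.det * cont P := by
  rw [cont, cont, Finset.mul_sum]
  refine Finset.sum_congr rfl fun f _ => ?_
  rw [spanSingleton_mul_spanSingleton, mul_comm, ← det_mul]
  rfl

theorem cont_submatrix_equiv (P : Matrix A β N) (e : γ ≃ β) :
    cont (P.submatrix id e) = cont P := by
  rw [cont, cont, ← (Equiv.arrowCongr e (Equiv.refl A)).sum_comp]
  refine Finset.sum_congr rfl fun f _ => ?_
  rw [← det_submatrix_equiv_self e (P.submatrix _ id)]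
  congr 2
  ext i j
  simp

theorem cont_submatrix_left (P : Matrix A β N) (e : B ≃ A) :
    cont (P.submatrix e id) = cont P := by
  rw [cont, cont, ← (Equiv.arrowCongr (Equiv.refl β) e).sum_comp]
  rfl

theorem cont_map {L : Type} [Field L] [NumberField L] [Algebra N L] (P : Matrix A β N) :
    cont (P.map (algebraMap N L)) = extendedHom L (𝓞 L) (cont P) := by
  rw [cont, cont, map_sum]
  refine Finset.sum_congr rfl fun f _ => ?_
  have h : (IsFractionRing.map (K := N) (L := L)
      (FaithfulSMul.algebraMap_injective (𝓞 N) (𝓞 L)) : N →+* L) = algebraMap N L := by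
    refine IsLocalization.ringHom_ext (𝓞 N)⁰ (RingHom.ext fun x => ?_)
    rw [RingHom.comp_apply, IsFractionRing.map, IsLocalization.map_eq]
    rfl
  rw [extendedHom_spanSingleton]
  erw [h]
  rw [RingHom.map_det]
  rfl

theorem prod_mem_prod (s : Finset β) (C : β → FractionalIdeal (𝓞 N)⁰ N) (x : β → N)
    (h : ∀ b ∈ s, x b ∈ C b) : ∏ b ∈ s, x b ∈ ∏ b ∈ s, C b := by
  induction s using Finset.induction_on with
  | empty => simp
  | insert b s hb ih =>
    rw [Finset.prod_insert hb, Finset.prod_insert hb]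
    exact FractionalIdeal.mul_mem_mul (h b (Finset.mem_insert_self b s))
      (ih fun i hi => h i (Finset.mem_insert_of_mem hi))

theorem det_mem_prod (C : β → FractionalIdeal (𝓞 N)⁰ N) (M : Matrix β β N)
    (h : ∀ i j, M i j ∈ C j) : M.det ∈ ∏ b, C b := by
  rw [det_apply, ← mem_coe]
  refine Submodule.sum_mem _ fun σ _ => ?_
  rw [Units.smul_def]
  exact zsmul_mem (mem_coe.mpr (prod_mem_prod _ C _ fun b _ => h _ _)) _

theorem cont_mul_cont_le (P : Matrix A β N) (Q : Matrix B β N) {I : FractionalIdeal (𝓞 N)⁰ N}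
    (h : ∀ i j, (P * Qᵀ) i j ∈ I) : cont P * cont Q ≤ I ^ Fintype.card β := by
  refine cont_mul_cont_le_iff.mpr fun f g => ?_
  have h1 : (P.submatrix f id).det * (Q.submatrix g id).det =
      ((P * Qᵀ).submatrix f g).det := by
    rw [← det_transpose (Q.submatrix g id), ← det_mul]
    rfl
  rw [h1]
  have := det_mem_prod (fun _ => I) _ fun i j => h (f i) (g j)
  rwa [Finset.prod_const, Finset.card_univ] at this

end Content

section Laplace
open Matrix nonZeroDivisors FractionalIdeal
variable {A p q a c : Type} [Fintype A] [Fintype p] [Fintype q] [Fintype a] [Fintype c]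

/-- The Laplace expansion along a partition of the columns, as a membership statement. -/
theorem det_mem_of_minors {R : Type} [CommRing R] (M : Matrix (p ⊕ q) (p ⊕ q) R) (I : AddSubgroup R)
    (h : ∀ (f : p → p ⊕ q) (g : q → p ⊕ q),
      (M.submatrix f Sum.inl).det * (M.submatrix g Sum.inr).det ∈ I) : M.det ∈ I := by
  let s := (Equiv.Perm.sumCongrHom p q).range
  let e : Equiv.Perm p × Equiv.Perm q ≃ s :=
    (MonoidHom.ofInjective Equiv.Perm.sumCongrHom_injective).toEquiv
  have hE : Function.Bijective fun d : (Equiv.Perm (p ⊕ q) ⧸ s) × s =>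
      d.1.out * (d.2 : Equiv.Perm (p ⊕ q)) := by
    have hmk : ∀ (c : Equiv.Perm (p ⊕ q) ⧸ s) (d : s),
        (QuotientGroup.mk (c.out * (d : Equiv.Perm (p ⊕ q))) : Equiv.Perm (p ⊕ q) ⧸ s) = c :=
      fun c d => by rw [QuotientGroup.mk_mul_of_mem _ d.2, QuotientGroup.out_eq']
    refine ⟨fun d d' h => ?_, fun x => ?_⟩
    · have h1 := congrArg (QuotientGroup.mk : _ → Equiv.Perm (p ⊕ q) ⧸ s) h
      simp only [hmk] at h1
      refine Prod.ext h1 (Subtype.ext ?_)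
      simpa [h1] using h
    · exact ⟨(x, ⟨(x : Equiv.Perm (p ⊕ q) ⧸ s).out⁻¹ * x,
        QuotientGroup.eq.mp (QuotientGroup.out_eq' _)⟩), mul_inv_cancel_left _ _⟩
  rw [det_apply, ← (Equiv.ofBijective _ hE).sum_comp, Fintype.sum_prod_type]
  refine AddSubgroup.sum_mem _ fun c _ => ?_
  rw [← e.sum_comp, Fintype.sum_prod_type]
  simp only [Equiv.ofBijective_apply]
  have h1 : ∑ x : Equiv.Perm p, ∑ y : Equiv.Perm q,
      Equiv.Perm.sign (c.out * (e (x, y) : Equiv.Perm (p ⊕ q))) •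
      ∏ i, M ((c.out * (e (x, y) : Equiv.Perm (p ⊕ q))) i) i = Equiv.Perm.sign c.out •
      ((M.submatrix (c.out ∘ Sum.inl) Sum.inl).det *
        (M.submatrix (c.out ∘ Sum.inr) Sum.inr).det) := by
    rw [det_apply, det_apply, Finset.sum_mul_sum, Finset.smul_sum]
    refine Finset.sum_congr rfl fun x _ => ?_
    rw [Finset.smul_sum]
    refine Finset.sum_congr rfl fun y _ => ?_
    have h2 : (e (x, y) : Equiv.Perm (p ⊕ q)) = Equiv.Perm.sumCongr x y := rfl
    rw [h2, map_mul, Equiv.Perm.sign_sumCongr, Fintype.prod_sum_type, mul_smul, mul_smul,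
      smul_mul_smul_comm, mul_smul]
    rfl
  rw [h1, Units.smul_def]
  exact zsmul_mem (h _ _) _

theorem det_mem_of_minors' {R n : Type} [Fintype n] [CommRing R] (M : Matrix n n R) (e : p ⊕ q ≃ n)
    (I : AddSubgroup R) (h : ∀ (f : p → n) (g : q → n),
      (M.submatrix f (e ∘ Sum.inl)).det * (M.submatrix g (e ∘ Sum.inr)).det ∈ I) : M.det ∈ I := by
  have := det_mem_of_minors (M.submatrix e e) I fun f g => h (e ∘ f) (e ∘ g)
  convert this using 1
  convert (det_submatrix_equiv_self e M).symm

variable {N : Type} [Field N] [NumberField N]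

theorem cont_submodular (P : Matrix A p N) (J : Matrix p a N) (Z : Matrix A c N) :
    cont (fromCols P Z) * cont (P * J) ≤ cont P * cont (fromCols (P * J) Z) := by
  refine cont_mul_cont_le_iff.mpr fun f g => ?_
  set u : (p ⊕ c) ⊕ a → A := Sum.elim f g
  let M₀ : Matrix ((p ⊕ c) ⊕ a) ((p ⊕ c) ⊕ a) N :=
    fromBlocks ((fromCols P Z).submatrix f id) 0 (fromCols 0 (Z.submatrix g id))
      ((P * J).submatrix g id)
  let T : Matrix ((p ⊕ c) ⊕ a) ((p ⊕ c) ⊕ a) N := fromBlocks 1 (fromRows J 0) 0 1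
  have hdet : (M₀ * T).det =
      ((fromCols P Z).submatrix f id).det * ((P * J).submatrix g id).det := by
    rw [det_mul, det_fromBlocks_zero₁₂, det_fromBlocks_zero₂₁, det_one, det_one, mul_one, mul_one]
  have hM : M₀ * T = fromBlocks ((fromCols P Z).submatrix f id) ((P * J).submatrix f id)
      (fromCols 0 (Z.submatrix g id)) ((P * J).submatrix g id) := by
    rw [fromBlocks_multiply]
    have h1 : (fromCols P Z).submatrix f id = fromCols (P.submatrix f id) (Z.submatrix f id) := by
      ext i (j | j) <;> rfl
    congr 1
    · simp
    · rw [h1, fromCols_mul_fromRows, Matrix.mul_zero, Matrix.zero_mul, add_zero, add_zero]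
      rfl
    · simp
    · rw [fromCols_mul_fromRows, Matrix.mul_zero, Matrix.zero_mul, add_zero, zero_add,
        Matrix.mul_one]
  let e : p ⊕ (a ⊕ c) ≃ (p ⊕ c) ⊕ a :=
    ((Equiv.refl p).sumCongr (Equiv.sumComm a c)).trans (Equiv.sumAssoc p c a).symm
  have key := det_mem_of_minors' (M₀ * T) e
    (cont P * cont (fromCols (P * J) Z) : FractionalIdeal (𝓞 N)⁰ N).coeToSubmodule.toAddSubgroup
    fun f' g' => ?_
  · convert mem_coe.mp key using 1
    convert hdet.symm
  refine mem_coe.mpr (FractionalIdeal.mul_mem_mul ?_ ?_)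
  · by_cases hf : ∃ i j, f' i = Sum.inr j
    · obtain ⟨i, j, hij⟩ := hf
      rw [det_eq_zero_of_row_eq_zero i fun k => ?_]
      · exact zero_mem _
      · rw [submatrix_apply, hij, hM]
        rfl
    · push Not at hf
      have : ∀ i, ∃ j, f' i = Sum.inl j := fun i => by
        rcases h : f' i with j | j
        · exact ⟨j, rfl⟩
        · exact absurd h (hf i j)
      choose w hw using this
      convert det_mem_cont P (f ∘ w) using 2
      ext i j
      rw [submatrix_apply, hw, hM]
      rfl
  · convert det_mem_cont (fromCols (P * J) Z) (u ∘ g') using 2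
    ext i j
    rw [submatrix_apply, hM]
    rcases h : g' i with k | k <;> rcases j with j | j <;> simp [e, u, h]

end Laplace

section LogNorm
open Matrix nonZeroDivisors FractionalIdeal Module
variable {N L : Type} [Field N] [NumberField N] [Field L] [NumberField L] [Algebra N L]

/-- The logarithm of the norm of a fractional ideal. -/
def logN (I : FractionalIdeal (𝓞 N)⁰ N) : ℝ := Real.log ((absNorm I : ℚ) : ℝ)

theorem absNorm_pos {I : FractionalIdeal (𝓞 N)⁰ N} (h : I ≠ 0) : (0 : ℝ) < (absNorm I : ℚ) := by
  exact_mod_cast lt_of_le_of_ne (absNorm_nonneg I) fun h' => h (absNorm_eq_zero_iff.mp h'.symm)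

theorem logN_one : logN (1 : FractionalIdeal (𝓞 N)⁰ N) = 0 := by
  simp [logN]

theorem logN_mul {I J : FractionalIdeal (𝓞 N)⁰ N} (hI : I ≠ 0) (hJ : J ≠ 0) :
    logN (I * J) = logN I + logN J := by
  rw [logN, map_mul, Rat.cast_mul, Real.log_mul (absNorm_pos hI).ne' (absNorm_pos hJ).ne']
  rfl

theorem logN_pow (I : FractionalIdeal (𝓞 N)⁰ N) (n : ℕ) : logN (I ^ n) = n * logN I := by
  rw [logN, map_pow, Rat.cast_pow, Real.log_pow]
  rfl

theorem logN_coeIdeal (I : Ideal (𝓞 N)) :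
    logN (I : FractionalIdeal (𝓞 N)⁰ N) = Real.log (Ideal.absNorm I) := by
  rw [logN, coeIdeal_absNorm]
  simp

theorem logN_spanSingleton {x : N} (hx : x ≠ 0) :
    logN (spanSingleton (𝓞 N)⁰ x) = ∑ σ : N →+* ℂ, Real.log ‖σ x‖ := by
  rw [sum_log_norm hx, logN, absNorm_span_singleton]
  simp

theorem logN_nonneg {I : FractionalIdeal (𝓞 N)⁰ N} (hI : I ≠ 0) (h : I ≤ 1) : 0 ≤ logN I := by
  obtain ⟨J, rfl⟩ := le_one_iff_exists_coeIdeal.mp h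
  rw [logN_coeIdeal]
  exact Real.log_natCast_nonneg _

theorem logN_mono {I J : FractionalIdeal (𝓞 N)⁰ N} (hI : I ≠ 0) (h : I ≤ J) :
    logN J ≤ logN I := by
  have hJ : J ≠ 0 := fun hJ => hI (le_bot_iff.mp (h.trans hJ.le))
  have h1 : I * J⁻¹ ≤ 1 := by
    calc I * J⁻¹ ≤ J * J⁻¹ := by gcongr
      _ = 1 := mul_inv_cancel₀ hJ
  have h2 := logN_nonneg (mul_ne_zero hI (inv_ne_zero hJ)) h1
  have h3 : logN I = logN (I * J⁻¹) + logN J := by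
    rw [← logN_mul (mul_ne_zero hI (inv_ne_zero hJ)) hJ, mul_assoc, inv_mul_cancel₀ hJ, mul_one]
  linarith

theorem extendedHom_spanSingleton' (x : N) : extendedHom L (𝓞 L) (spanSingleton (𝓞 N)⁰ x) =
    spanSingleton (𝓞 L)⁰ (algebraMap N L x) := by
  have h : (IsFractionRing.map (K := N) (L := L)
      (FaithfulSMul.algebraMap_injective (𝓞 N) (𝓞 L)) : N →+* L) = algebraMap N L := by
    refine IsLocalization.ringHom_ext (𝓞 N)⁰ (RingHom.ext fun x => ?_)
    rw [RingHom.comp_apply, IsFractionRing.map, IsLocalization.map_eq]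
    rfl
  rw [extendedHom_spanSingleton]
  erw [h]

theorem logN_extendedHom {I : FractionalIdeal (𝓞 N)⁰ N} (hI : I ≠ 0) :
    logN (extendedHom L (𝓞 L) I) = finrank N L * logN I := by
  obtain ⟨a, J, ha, rfl⟩ := exists_eq_spanSingleton_mul I
  have ha' : (algebraMap (𝓞 N) N a)⁻¹ ≠ 0 := by simpa using ha
  have hJ : (J : FractionalIdeal (𝓞 N)⁰ N) ≠ 0 := right_ne_zero_of_mul hI
  have hs : spanSingleton (𝓞 N)⁰ (algebraMap (𝓞 N) N a)⁻¹ ≠ 0 := left_ne_zero_of_mul hI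
  have hJ' : (extendedHom L (𝓞 L) (J : FractionalIdeal (𝓞 N)⁰ N)) ≠ 0 :=
    (extendedHom_eq_zero_iff _ _).not.mpr hJ
  have hs' : extendedHom L (𝓞 L) (spanSingleton (𝓞 N)⁰ (algebraMap (𝓞 N) N a)⁻¹) ≠ 0 :=
    (extendedHom_eq_zero_iff _ _).not.mpr hs
  rw [map_mul, logN_mul hs' hJ', logN_mul hs hJ, mul_add, extendedHom_spanSingleton',
    logN_spanSingleton ha', logN_spanSingleton (by simpa using ha)]
  have h1 := sum_embeddings_comp (K' := L) fun σ : N →+* ℂ =>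
    Real.log ‖σ (algebraMap (𝓞 N) N a)⁻¹‖
  simp only [RingHom.comp_apply] at h1
  rw [h1]
  congr 1
  rw [extendedHom_coeIdeal_eq_map, logN_coeIdeal, logN_coeIdeal, Ideal.absNorm_algebraMap,
    Nat.cast_pow, Real.log_pow, IsFractionRing.finrank_eq (𝓞 N) N (𝓞 L) L]

end LogNorm

section Degree
open Matrix nonZeroDivisors FractionalIdeal Module
variable {A ι β γ p a c : Type} [Fintype A] [Fintype ι] [Fintype β] [Fintype γ] [Fintype p]
  [Fintype a] [Fintype c]
variable {K N L : Type} [Field K] [NumberField K] [Field N] [NumberField N] [Algebra K N]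
  [Field L] [NumberField L] [Algebra K L] [Algebra N L] [IsScalarTower K N L]
variable {φ : Matrix A ι K} {H : (K →+* ℂ) → Matrix ι ι ℂ}

/-- `x` has a left inverse. -/
def LeftInv {R : Type} [CommRing R] (x : Matrix ι β R) : Prop := ∃ y : Matrix β ι R, y * x = 1

theorem LeftInv.map {R S : Type} [CommRing R] [CommRing S] {x : Matrix ι β R} (hx : LeftInv x)
    (f : R →+* S) : LeftInv (x.map f) := by
  obtain ⟨y, hy⟩ := hx
  exact ⟨y.map f, by rw [← Matrix.map_mul, hy, Matrix.map_one _ (map_zero f) (map_one f)]⟩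

theorem LeftInv.mul {R : Type} [CommRing R] {x : Matrix ι β R} (hx : LeftInv x)
    {z : Matrix β γ R} (hz : LeftInv z) : LeftInv (x * z) := by
  obtain ⟨y, hy⟩ := hx
  obtain ⟨w, hw⟩ := hz
  exact ⟨w * y, by rw [Matrix.mul_assoc, ← Matrix.mul_assoc y, hy, Matrix.one_mul, hw]⟩

theorem LeftInv.mulVec_injective {R : Type} [CommRing R] {x : Matrix ι β R} (hx : LeftInv x) :
    Function.Injective x.mulVec := by
  obtain ⟨y, hy⟩ := hx
  intro v w h
  have := congrArg (y *ᵥ ·) h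
  simpa [mulVec_mulVec, hy] using this

theorem leftInv_of_det_ne_zero {g : Matrix β β N} (hg : g.det ≠ 0) : LeftInv g :=
  ⟨g⁻¹, nonsing_inv_mul _ (isUnit_iff_ne_zero.mpr hg)⟩

/-- The Gram matrix of the columns of `x`. -/
def gram (H : Matrix ι ι ℂ) (x : Matrix ι β ℂ) : Matrix β β ℂ := xᴴ * H * x

theorem gram_posDef {H : Matrix ι ι ℂ} (hH : H.PosDef) {x : Matrix ι β ℂ} (hx : LeftInv x) :
    (gram H x).PosDef :=
  hH.conjTranspose_mul_mul_same hx.mulVec_injective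

theorem gram_mul (H : Matrix ι ι ℂ) (x : Matrix ι β ℂ) (g : Matrix β γ ℂ) :
    gram H (x * g) = gᴴ * gram H x * g := by
  simp only [gram, conjTranspose_mul, Matrix.mul_assoc]

/-- The Gram determinant of the columns of `x`. -/
def gramDet (H : Matrix ι ι ℂ) (x : Matrix ι β ℂ) : ℝ := (gram H x).det.re

theorem gramDet_pos {H : Matrix ι ι ℂ} (hH : H.PosDef) {x : Matrix ι β ℂ} (hx : LeftInv x) :
    0 < gramDet H x :=
  (Complex.lt_def.mp (gram_posDef hH hx).det_pos).1

theorem gramDet_mul (H : Matrix ι ι ℂ) (x : Matrix ι β ℂ) (g : Matrix β β ℂ) :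
    gramDet H (x * g) = ‖g.det‖ ^ 2 * gramDet H x := by
  rw [gramDet, gramDet, gram_mul, det_mul, det_mul, det_conjTranspose, mul_right_comm,
      mul_comm (star _),
    Complex.star_def, Complex.mul_conj', ← Complex.ofReal_pow, Complex.re_ofReal_mul]

theorem gramDet_submodular {H : Matrix ι ι ℂ} (hH : H.PosDef) {W : Matrix ι p ℂ}
    {J : Matrix p a ℂ} {Z : Matrix ι c ℂ} (h : LeftInv (fromCols W Z))
    (h' : LeftInv (fromCols (W * J) Z)) :
    gramDet H (fromCols W Z) * gramDet H (W * J) ≤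
      gramDet H W * gramDet H (fromCols (W * J) Z) := by
  have e : ∀ {q : Type} [Fintype q] (V : Matrix ι q ℂ), gram H (fromCols V Z) =
      fromBlocks (gram H V) (Vᴴ * H * Z) (Vᴴ * H * Z)ᴴ (gram H Z) := fun V => by
    rw [gram, conjTranspose_fromCols_eq_fromRows_conjTranspose, fromRows_mul,
      fromRows_mul_fromCols, conjTranspose_mul, conjTranspose_mul, hH.1.eq,
      conjTranspose_conjTranspose, Matrix.mul_assoc Zᴴ]
    rfl
  have e' : gram H (fromCols (W * J) Z) = fromBlocks (Jᴴ * gram H W * J) (Jᴴ * (Wᴴ * H * Z))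
      (Jᴴ * (Wᴴ * H * Z))ᴴ (gram H Z) := by
    rw [e, gram_mul]
    simp only [conjTranspose_mul, Matrix.mul_assoc]
  have hG := gram_posDef hH h
  have hG' := gram_posDef hH h'
  have key := det_fromBlocks_submodular (e W ▸ hG) (e' ▸ hG')
  rw [← e, ← e', ← gram_mul] at key
  simp only [gramDet]
  convert key

/-- The degree of the saturated lattice spanned by the columns of `x`, the lattice being defined
by the functionals `φ` and the metrics `H`. -/
def deg (φ : Matrix A ι K) (H : (K →+* ℂ) → Matrix ι ι ℂ) (x : Matrix ι β N) : ℝ :=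
  logN (cont (φ.map (algebraMap K N) * x)) -
    (∑ σ : N →+* ℂ, Real.log (gramDet (H (σ.comp (algebraMap K N))) (x.map σ))) / 2

theorem cont_ne_zero_of_leftInv (hφ : LeftInv φ) {x : Matrix ι β N} (hx : LeftInv x) :
    cont (φ.map (algebraMap K N) * x) ≠ 0 := by
  obtain ⟨y, hy⟩ := (hφ.map (algebraMap K N)).mul hx
  exact cont_ne_zero hy

theorem deg_mul (hφ : LeftInv φ) (hH : ∀ σ, (H σ).PosDef) {x : Matrix ι β N} (hx : LeftInv x)
    {g : Matrix β β N} (hg : g.det ≠ 0) : deg φ H (x * g) = deg φ H x := by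
  have h1 : ∀ σ : N →+* ℂ, Real.log (gramDet (H (σ.comp (algebraMap K N))) ((x * g).map σ)) =
      2 * Real.log ‖σ g.det‖ +
        Real.log (gramDet (H (σ.comp (algebraMap K N))) (x.map σ)) := fun σ => by
    have hg' : σ g.det ≠ 0 := by simpa using hg
    rw [Matrix.map_mul, gramDet_mul, ← RingHom.mapMatrix_apply, ← RingHom.map_det, Real.log_mul
      (by positivity) (gramDet_pos (hH _) (hx.map σ)).ne', Real.log_pow]
    rfl
  rw [deg, ← Matrix.mul_assoc, cont_mul, logN_mul (spanSingleton_ne_zero_iff.mpr hg)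
    (cont_ne_zero_of_leftInv hφ hx), logN_spanSingleton hg]
  simp only [h1, Finset.sum_add_distrib, ← Finset.mul_sum]
  rw [deg]
  ring

theorem deg_submatrix_equiv (x : Matrix ι β N) (e : γ ≃ β) :
    deg φ H (x.submatrix id e) = deg φ H x := by
  have h : ∀ y : Matrix A ι N, y * x.submatrix id e = (y * x).submatrix id e := fun _ => rfl
  rw [deg, h, cont_submatrix_equiv, deg]
  refine congrArg (fun t : ℝ => _ - t / 2) (Finset.sum_congr rfl fun σ _ => ?_)
  have : gramDet (H (σ.comp (algebraMap K N))) ((x.submatrix id e).map σ) =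
    gramDet (H (σ.comp (algebraMap K N))) (x.map σ) := congrArg Complex.re
      (det_submatrix_equiv_self e (gram (H (σ.comp (algebraMap K N))) (x.map σ)))
  rw [this]

/-- The degree only depends on the space spanned by the columns. -/
theorem deg_eq_of_eq_mul (hφ : LeftInv φ) (hH : ∀ σ, (H σ).PosDef) {x : Matrix ι β N}
    (hx : LeftInv x) {x' : Matrix ι γ N} (hx' : LeftInv x') {J : Matrix β γ N}
    {J' : Matrix γ β N} (h : x' = x * J) (h' : x = x' * J') : deg φ H x' = deg φ H x := by
  obtain ⟨y, hy⟩ := hx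
  obtain ⟨y', hy'⟩ := hx'
  have h1 : J * J' = 1 := by
    have : x = x * J * J' := h ▸ h'
    rw [Matrix.mul_assoc] at this
    rw [← Matrix.one_mul (J * J'), ← hy, Matrix.mul_assoc, ← this]
  have h2 : J' * J = 1 := by
    have : x' = x' * J' * J := h' ▸ h
    rw [Matrix.mul_assoc] at this
    rw [← Matrix.one_mul (J' * J), ← hy', Matrix.mul_assoc, ← this]
  have hc : Fintype.card β = Fintype.card γ := square_of_invertible J J' h1 h2
  let e : β ≃ γ := Fintype.equivOfCardEq hc
  have h3 : (J.submatrix id e).det ≠ 0 := by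
    intro h0
    have h4 : J.submatrix id e * J'.submatrix e id = 1 := by
      rw [submatrix_mul_equiv, h1, submatrix_id_id]
    have := congrArg det h4
    rw [det_mul, h0, zero_mul, det_one] at this
    exact zero_ne_one this
  rw [← deg_submatrix_equiv x' e, ← deg_mul hφ hH ⟨y, hy⟩ h3, h]
  rfl

theorem deg_map (hφ : LeftInv φ) {x : Matrix ι β N} (hx : LeftInv x) :
    deg φ H (x.map (algebraMap N L)) = finrank N L * deg φ H x := by
  have h1 : φ.map (algebraMap K L) * x.map (algebraMap N L) =
      (φ.map (algebraMap K N) * x).map (algebraMap N L) := by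
    rw [Matrix.map_mul, Matrix.map_map, IsScalarTower.algebraMap_eq K N L]
    rfl
  rw [deg, h1, cont_map, logN_extendedHom (cont_ne_zero_of_leftInv hφ hx), deg, mul_sub]
  congr 1
  have := sum_embeddings_comp (K' := L) fun σ : N →+* ℂ =>
    Real.log (gramDet (H (σ.comp (algebraMap K N))) (x.map σ))
  rw [← mul_div_assoc, ← this]
  congr 3
  refine funext fun σ => ?_
  rw [RingHom.comp_assoc, ← IsScalarTower.algebraMap_eq]
  rfl

theorem deg_submodular (hφ : LeftInv φ) (hH : ∀ σ, (H σ).PosDef) {W : Matrix ι p N}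
    {J : Matrix p a N} {Z : Matrix ι c N} (h : LeftInv (fromCols W Z)) (hJ : LeftInv J) :
    deg φ H W + deg φ H (fromCols (W * J) Z) ≤ deg φ H (fromCols W Z) + deg φ H (W * J) := by
  have hW : LeftInv W := by
    obtain ⟨y, hy⟩ := h
    refine ⟨y.submatrix Sum.inl id, Matrix.ext fun i j => ?_⟩
    have h1 := congrFun₂ hy (Sum.inl i) (Sum.inl j)
    exact h1.trans (by simp only [Matrix.one_apply, Sum.inl.injEq])
  have h' : LeftInv (fromCols (W * J) Z) := by
    obtain ⟨j, hj⟩ := hJ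
    let B : Matrix (p ⊕ c) (a ⊕ c) N := fromBlocks J 0 0 1
    let B' : Matrix (a ⊕ c) (p ⊕ c) N := fromBlocks j 0 0 1
    have : fromCols (W * J) Z = fromCols W Z * B := by
      rw [fromCols_mul_fromBlocks]
      simp
    rw [this]
    refine h.mul ⟨B', ?_⟩
    rw [fromBlocks_multiply]
    convert (fromBlocks_one (α := N) (m := c) (l := a))
    all_goals simp [hj]
  have h1 : logN (cont (φ.map (algebraMap K N) * W)) +
      logN (cont (φ.map (algebraMap K N) * fromCols (W * J) Z)) ≤
      logN (cont (φ.map (algebraMap K N) * fromCols W Z)) +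
      logN (cont (φ.map (algebraMap K N) * (W * J))) := by
    rw [← logN_mul (cont_ne_zero_of_leftInv hφ hW) (cont_ne_zero_of_leftInv hφ h'),
      ← logN_mul (cont_ne_zero_of_leftInv hφ h) (cont_ne_zero_of_leftInv hφ (hW.mul hJ))]
    refine logN_mono (mul_ne_zero (cont_ne_zero_of_leftInv hφ h)
      (cont_ne_zero_of_leftInv hφ (hW.mul hJ))) ?_
    rw [mul_fromCols, mul_fromCols, ← Matrix.mul_assoc]
    exact cont_submodular _ _ _
  have h2 : ∀ σ : N →+* ℂ,
      Real.log (gramDet (H (σ.comp (algebraMap K N))) ((fromCols W Z).map σ)) +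
      Real.log (gramDet (H (σ.comp (algebraMap K N))) ((W * J).map σ)) ≤
      Real.log (gramDet (H (σ.comp (algebraMap K N))) (W.map σ)) +
      Real.log (gramDet (H (σ.comp (algebraMap K N))) ((fromCols (W * J) Z).map σ)) :=
    fun σ => by
    have hp := hH (σ.comp (algebraMap K N))
    rw [← Real.log_mul (gramDet_pos hp (h.map σ)).ne' (gramDet_pos hp ((hW.mul hJ).map σ)).ne',
      ← Real.log_mul (gramDet_pos hp (hW.map σ)).ne' (gramDet_pos hp (h'.map σ)).ne']
    refine Real.log_le_log (mul_pos (gramDet_pos hp (h.map σ))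
      (gramDet_pos hp ((hW.mul hJ).map σ))) ?_
    have h1 := h.map σ
    have h2 := h'.map σ
    rw [fromCols_map] at h1
    rw [fromCols_map, Matrix.map_mul] at h2
    rw [fromCols_map, fromCols_map, Matrix.map_mul]
    exact gramDet_submodular hp h1 h2
  have h3 := Finset.sum_le_sum fun σ (_ : σ ∈ Finset.univ) => h2 σ
  rw [Finset.sum_add_distrib, Finset.sum_add_distrib] at h3
  simp only [deg]
  linarith

end Degree

section Bounded
open Matrix nonZeroDivisors FractionalIdeal Module
variable {A ι β γ p a c : Type} [Fintype A] [Fintype ι] [Fintype β] [Fintype γ] [Fintype p]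
  [Fintype a] [Fintype c]

open scoped Matrix.Norms.L2Operator in
theorem exists_bound_of_posDef {H : Matrix ι ι ℂ} (hH : H.PosDef) (Φ : Matrix A ι ℂ) :
    ∃ c : ℝ, 1 ≤ c ∧ ∀ v : ι → ℂ, ∑ i, ‖(Φ *ᵥ v) i‖ ^ 2 ≤ c * (star v ⬝ᵥ H *ᵥ v).re := by
  obtain ⟨T, hT, rfl⟩ := exists_conjTranspose_mul_self hH
  refine ⟨‖Φ * T⁻¹‖ ^ 2 + 1, by nlinarith [sq_nonneg ‖Φ * T⁻¹‖], fun v => ?_⟩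
  have h1 : (star v ⬝ᵥ (Tᴴ * T) *ᵥ v).re = ‖WithLp.toLp 2 (T *ᵥ v)‖ ^ 2 := by
    rw [← gramNorm_eq, gramNorm, Real.sq_sqrt]
    exact (Complex.le_def.mp (hH.posSemidef.dotProduct_mulVec_nonneg v)).1
  have h2 : ∑ i, ‖(Φ *ᵥ v) i‖ ^ 2 = ‖WithLp.toLp 2 (Φ *ᵥ v)‖ ^ 2 := by
    rw [EuclideanSpace.norm_sq_eq]
  have h3 : Φ *ᵥ v = (Φ * T⁻¹) *ᵥ (T *ᵥ v) := by
    rw [mulVec_mulVec, Matrix.mul_assoc, nonsing_inv_mul _ (isUnit_iff_ne_zero.mpr hT),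
      Matrix.mul_one]
  have h4 := l2_opNorm_mulVec (Φ * T⁻¹) (WithLp.toLp 2 (T *ᵥ v))
  rw [h1, h2, h3]
  calc _ ≤ (‖Φ * T⁻¹‖ * ‖WithLp.toLp 2 (T *ᵥ v)‖) ^ 2 :=
        pow_le_pow_left₀ (norm_nonneg _) h4 2
    _ ≤ _ := by nlinarith [sq_nonneg ‖WithLp.toLp 2 (T *ᵥ v)‖]

theorem norm_minor_sq_le {H : Matrix ι ι ℂ} (hH : H.PosDef) {Φ : Matrix A ι ℂ} {c : ℝ}
    (hc : 1 ≤ c) (hΦ : ∀ v : ι → ℂ, ∑ i, ‖(Φ *ᵥ v) i‖ ^ 2 ≤ c * (star v ⬝ᵥ H *ᵥ v).re)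
    {x : Matrix ι β ℂ} (hx : LeftInv x) (f : β → A) :
    ‖((Φ * x).submatrix f id).det‖ ^ 2 ≤
      ((Fintype.card β + 1) * c) ^ Fintype.card β * gramDet H x := by
  set Q : Matrix β β ℂ := (Φ * x).submatrix f id
  have hc' : (0 : ℝ) < (Fintype.card β + 1) * c := by positivity
  have hB : (((((Fintype.card β + 1) * c : ℝ) : ℂ)) • gram H x).PosDef :=
    (gram_posDef hH hx).smul (by exact_mod_cast hc')
  have hA := posSemidef_conjTranspose_mul_self Q
  have key := det_le_det_of_posSemidef_sub hA hB ?_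
  · rw [det_mul, det_conjTranspose, Complex.star_def, Complex.conj_mul', det_smul,
      ← Complex.ofReal_pow, ← Complex.ofReal_pow, Complex.re_ofReal_mul, Complex.ofReal_re] at key
    exact key
  refine PosSemidef.of_dotProduct_mulVec_nonneg (hB.1.sub hA.1) fun v => ?_
  have h0 := (hB.posSemidef.dotProduct_mulVec_nonneg v)
  have h1 := hΦ (x *ᵥ v)
  have h2 : star (x *ᵥ v) ⬝ᵥ H *ᵥ (x *ᵥ v) = star v ⬝ᵥ gram H x *ᵥ v := by
    rw [gram, ← mulVec_mulVec, ← mulVec_mulVec, dotProduct_mulVec, star_mulVec,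
      ← dotProduct_mulVec, ← dotProduct_mulVec]
  have h3 : star v ⬝ᵥ (Qᴴ * Q) *ᵥ v = ((∑ b, ‖(Q *ᵥ v) b‖ ^ 2 : ℝ) : ℂ) := by
    rw [← mulVec_mulVec, dotProduct_mulVec, ← star_mulVec, dotProduct]
    push_cast
    refine Finset.sum_congr rfl fun b _ => ?_
    rw [Pi.star_apply, Complex.star_def, Complex.conj_mul']
  have h4 : ∑ b, ‖(Q *ᵥ v) b‖ ^ 2 ≤ Fintype.card β * ∑ i, ‖(Φ *ᵥ (x *ᵥ v)) i‖ ^ 2 := by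
    rw [← nsmul_eq_mul, ← Finset.card_univ, ← Finset.sum_const]
    refine Finset.sum_le_sum fun b _ => ?_
    have h5 : (Q *ᵥ v) b = (Φ *ᵥ (x *ᵥ v)) (f b) := by
      rw [mulVec_mulVec]
      rfl
    rw [h5]
    exact Finset.single_le_sum (f := fun i => ‖(Φ *ᵥ (x *ᵥ v)) i‖ ^ 2)
      (fun i _ => by positivity) (Finset.mem_univ (f b))
  have h6 := (gram_posDef hH hx).posSemidef.dotProduct_mulVec_nonneg v
  obtain ⟨h7, h8⟩ := Complex.le_def.mp h6
  rw [sub_mulVec, dotProduct_sub, h3, smul_mulVec, dotProduct_smul, smul_eq_mul]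
  rw [h2] at h1
  rw [Complex.le_def]
  simp only [Complex.zero_re, Complex.zero_im, Complex.sub_re, Complex.sub_im,
    Complex.re_ofReal_mul, Complex.im_ofReal_mul, Complex.ofReal_re, Complex.ofReal_im] at *
  refine ⟨?_, by rw [← h8]; ring⟩
  have h9 : (0 : ℝ) ≤ Fintype.card β := by positivity
  nlinarith [mul_le_mul_of_nonneg_left h1 h9, mul_nonneg (by linarith : (0 : ℝ) ≤ c) h7]

variable {K N : Type} [Field K] [NumberField K] [Field N] [NumberField N] [Algebra K N]
variable {φ : Matrix A ι K} {H : (K →+* ℂ) → Matrix ι ι ℂ}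

theorem LeftInv.card_le {R : Type} [Field R] {x : Matrix ι β R} (hx : LeftInv x) :
    Fintype.card β ≤ Fintype.card ι := by
  have := LinearMap.finrank_le_finrank_of_injective (f := x.mulVecLin) hx.mulVec_injective
  simpa using this

theorem exists_deg_le (N : Type) [Field N] [NumberField N] [Algebra K N] (hφ : LeftInv φ)
    (hH : ∀ σ, (H σ).PosDef) : ∃ C : ℝ, ∀ (β : Type) [Fintype β] (x : Matrix ι β N), LeftInv x →
      deg φ H x ≤ C := by
  choose c hc hΦ using fun σ : N →+* ℂ => exists_bound_of_posDef (hH (σ.comp (algebraMap K N)))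
    (φ.map (σ.comp (algebraMap K N)))
  refine ⟨(∑ σ, Fintype.card ι * Real.log ((Fintype.card ι + 1) * c σ)) / 2,
    fun β _ x hx => ?_⟩
  obtain ⟨f, hf⟩ : ∃ f : β → A, ((φ.map (algebraMap K N) * x).submatrix f id).det ≠ 0 := by
    by_contra! h
    refine cont_ne_zero_of_leftInv hφ hx (Finset.sum_eq_zero fun f _ => ?_)
    rw [h f, spanSingleton_zero]
  set m := ((φ.map (algebraMap K N) * x).submatrix f id).det with hm
  have h1 : logN (cont (φ.map (algebraMap K N) * x)) ≤ ∑ σ : N →+* ℂ, Real.log ‖σ m‖ := by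
    rw [← logN_spanSingleton hf]
    exact logN_mono (spanSingleton_ne_zero_iff.mpr hf)
      (spanSingleton_le_iff_mem.mpr (det_mem_cont _ f))
  have h2 : ∀ σ : N →+* ℂ, Real.log ‖σ m‖ ≤
      (Fintype.card ι * Real.log ((Fintype.card ι + 1) * c σ)) / 2 +
      Real.log (gramDet (H (σ.comp (algebraMap K N))) (x.map σ)) / 2 := fun σ => by
    have hσ : σ m ≠ 0 := by simpa using hf
    have hg := gramDet_pos (hH (σ.comp (algebraMap K N))) (hx.map σ)
    have hcard : (Fintype.card β : ℝ) ≤ Fintype.card ι := by exact_mod_cast hx.card_le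
    have hc0 : 0 < c σ := by linarith [hc σ]
    have h3 := norm_minor_sq_le (hH _) (hc σ) (hΦ σ) (hx.map σ) f
    have h4 : σ m = (((φ.map (σ.comp (algebraMap K N))) * x.map σ).submatrix f id).det := by
      rw [hm, RingHom.map_det, RingHom.mapMatrix_apply, RingHom.coe_comp, ← Matrix.map_map,
        ← Matrix.map_mul]
      rfl
    rw [← h4] at h3
    have h5 := Real.log_le_log (by positivity) h3
    rw [Real.log_pow, Real.log_mul (by positivity) hg.ne', Real.log_pow] at h5
    have h6 : (Fintype.card β : ℝ) * Real.log ((Fintype.card β + 1) * c σ) ≤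
        Fintype.card ι * Real.log ((Fintype.card ι + 1) * c σ) := by
      refine mul_le_mul hcard (Real.log_le_log (by positivity) (by gcongr))
        (Real.log_nonneg ?_) (by positivity)
      nlinarith [hc σ, (Nat.cast_nonneg (Fintype.card β) : (0 : ℝ) ≤ _)]
    push_cast at h5
    linarith
  have h3 := Finset.sum_le_sum fun σ (_ : σ ∈ Finset.univ) => h2 σ
  rw [Finset.sum_add_distrib, ← Finset.sum_div, ← Finset.sum_div] at h3
  rw [deg]
  linarith

end Bounded

section Subspaces
open Matrix Module
variable {A ι β γ p a c : Type} [Fintype A] [Fintype ι] [Fintype β] [Fintype γ] [Fintype p]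
  [Fintype a] [Fintype c]
variable {F : Type} [Field F]

/-- The span of the columns of `x`. -/
def colSpan (x : Matrix ι β F) : Submodule F (ι → F) := LinearMap.range x.mulVecLin

theorem mem_colSpan {x : Matrix ι β F} {v : ι → F} : v ∈ colSpan x ↔ ∃ w, x *ᵥ w = v :=
  LinearMap.mem_range

theorem leftInv_of_injective {x : Matrix ι β F} (h : Function.Injective x.mulVec) :
    LeftInv x := by
  obtain ⟨g, hg⟩ := LinearMap.exists_leftInverse_of_injective x.mulVecLin
    (LinearMap.ker_eq_bot.mpr h)
  refine ⟨LinearMap.toMatrix' g, ?_⟩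
  have := congrArg LinearMap.toMatrix' hg
  rwa [LinearMap.toMatrix'_comp, ← toLin'_apply', LinearMap.toMatrix'_toLin',
    LinearMap.toMatrix'_id] at this

theorem finrank_colSpan {x : Matrix ι β F} (hx : LeftInv x) :
    finrank F (colSpan x) = Fintype.card β := by
  rw [colSpan, LinearMap.finrank_range_of_inj hx.mulVec_injective, finrank_fintype_fun_eq_card]

theorem exists_mul_of_colSpan_le {x : Matrix ι β F} {y : Matrix ι γ F}
    (h : colSpan y ≤ colSpan x) : ∃ J : Matrix β γ F, y = x * J := by
  have : ∀ j, ∃ w, x *ᵥ w = fun i => y i j := fun j => mem_colSpan.mp (h (mem_colSpan.mpr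
    ⟨Pi.single j 1, by ext i; simp⟩))
  choose w hw using this
  refine ⟨Matrix.of fun i j => w j i, ?_⟩
  ext i j
  exact (congrFun (hw j) i).symm

/-- A matrix whose columns form a basis of `U`. -/
def colBasis (U : Submodule F (ι → F)) : Matrix ι (Fin (finrank F U)) F :=
  Matrix.of fun i j => (finBasis F U j : ι → F) i

theorem colBasis_mulVec (U : Submodule F (ι → F)) (w : Fin (finrank F U) → F) :
    colBasis U *ᵥ w = ((finBasis F U).equivFun.symm w : ι → F) := by
  rw [Basis.equivFun_symm_apply]
  ext i
  simp [colBasis, mulVec, dotProduct, Finset.sum_apply, mul_comm]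

theorem colBasis_leftInv (U : Submodule F (ι → F)) : LeftInv (colBasis U) := by
  refine leftInv_of_injective fun v w h => ?_
  change colBasis U *ᵥ v = colBasis U *ᵥ w at h
  rw [colBasis_mulVec, colBasis_mulVec] at h
  exact (finBasis F U).equivFun.symm.injective (Subtype.ext h)

theorem colSpan_colBasis (U : Submodule F (ι → F)) : colSpan (colBasis U) = U := by
  ext v
  rw [mem_colSpan]
  constructor
  · rintro ⟨w, rfl⟩
    rw [colBasis_mulVec]
    exact Submodule.coe_mem _
  · intro hv
    exact ⟨(finBasis F U).equivFun ⟨v, hv⟩, by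
      rw [colBasis_mulVec, LinearEquiv.symm_apply_apply]⟩

theorem colSpan_fromCols (x : Matrix ι p F) (y : Matrix ι c F) :
    colSpan (fromCols x y) = colSpan x ⊔ colSpan y := by
  ext v
  simp only [Submodule.mem_sup, mem_colSpan]
  constructor
  · rintro ⟨w, rfl⟩
    exact ⟨_, ⟨w ∘ Sum.inl, rfl⟩, _, ⟨w ∘ Sum.inr, rfl⟩, (fromCols_mulVec x y w).symm⟩
  · rintro ⟨_, ⟨w, rfl⟩, _, ⟨z, rfl⟩, rfl⟩
    exact ⟨Sum.elim w z, by simp [fromCols_mulVec]⟩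

theorem leftInv_fromCols {x : Matrix ι p F} {y : Matrix ι c F} (hx : LeftInv x) (hy : LeftInv y)
    (h : Disjoint (colSpan x) (colSpan y)) : LeftInv (fromCols x y) := by
  refine leftInv_of_injective fun v w hvw => ?_
  change fromCols x y *ᵥ v = fromCols x y *ᵥ w at hvw
  rw [fromCols_mulVec, fromCols_mulVec] at hvw
  have h1 : x *ᵥ (v ∘ Sum.inl - w ∘ Sum.inl) = y *ᵥ (w ∘ Sum.inr - v ∘ Sum.inr) := by
    rw [mulVec_sub, mulVec_sub, sub_eq_sub_iff_add_eq_add, hvw, add_comm]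
  have h2 := Submodule.disjoint_def.mp h _ (mem_colSpan.mpr ⟨_, rfl⟩)
    (mem_colSpan.mpr ⟨_, h1.symm⟩)
  have h3 : v ∘ Sum.inl - w ∘ Sum.inl = 0 := hx.mulVec_injective (h2.trans (mulVec_zero _).symm)
  have h4 : w ∘ Sum.inr - v ∘ Sum.inr = 0 :=
    hy.mulVec_injective ((h1.symm.trans h2).trans (mulVec_zero _).symm)
  ext (i | i)
  · exact sub_eq_zero.mp (congrFun h3 i)
  · exact (sub_eq_zero.mp (congrFun h4 i)).symm

variable {K N : Type} [Field K] [NumberField K] [Field N] [NumberField N] [Algebra K N]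
variable {φ : Matrix A ι K} {H : (K →+* ℂ) → Matrix ι ι ℂ}

/-- The degree of the saturated lattice in the subspace `U`. -/
def degS (φ : Matrix A ι K) (H : (K →+* ℂ) → Matrix ι ι ℂ) (U : Submodule N (ι → N)) : ℝ :=
  deg φ H (colBasis U)

theorem deg_eq_degS (hφ : LeftInv φ) (hH : ∀ σ, (H σ).PosDef) {x : Matrix ι β N}
    (hx : LeftInv x) : deg φ H x = degS φ H (colSpan x) := by
  have h := colSpan_colBasis (colSpan x)
  obtain ⟨J, hJ⟩ := exists_mul_of_colSpan_le h.le
  obtain ⟨J', hJ'⟩ := exists_mul_of_colSpan_le h.ge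
  exact deg_eq_of_eq_mul hφ hH (colBasis_leftInv _) hx hJ' hJ

theorem deg_congr (hφ : LeftInv φ) (hH : ∀ σ, (H σ).PosDef) {x : Matrix ι β N}
    (hx : LeftInv x) {U : Submodule N (ι → N)} (h : colSpan x = U) : deg φ H x = degS φ H U := by
  rw [← h, deg_eq_degS hφ hH hx]

theorem degS_supermodular (hφ : LeftInv φ) (hH : ∀ σ, (H σ).PosDef) (U V : Submodule N (ι → N)) :
    degS φ H U + degS φ H V ≤ degS φ H (U ⊔ V) + degS φ H (U ⊓ V) := by
  obtain ⟨C, hC⟩ := exists_isCompl (U ⊓ V)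
  have hV : (U ⊓ V) ⊔ (C ⊓ V) = V := by
    rw [← sup_inf_assoc_of_le _ inf_le_right, hC.sup_eq_top, top_inf_eq]
  have hU : U ⊔ (C ⊓ V) = U ⊔ V := by
    conv_rhs => rw [← hV]
    rw [← sup_assoc, sup_of_le_left (inf_le_left : U ⊓ V ≤ U)]
  have hd : Disjoint U (C ⊓ V) := by
    rw [disjoint_iff, ← inf_assoc, inf_right_comm, hC.inf_eq_bot]
  have hd' : Disjoint (U ⊓ V) (C ⊓ V) := hd.mono_left inf_le_left
  obtain ⟨J, hJ⟩ := exists_mul_of_colSpan_le (x := colBasis U) (y := colBasis (U ⊓ V))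
    (by rw [colSpan_colBasis, colSpan_colBasis]; exact inf_le_left)
  have h1 : LeftInv (fromCols (colBasis U) (colBasis (C ⊓ V))) :=
    leftInv_fromCols (colBasis_leftInv _) (colBasis_leftInv _) (by simpa only [colSpan_colBasis])
  have h2 : LeftInv (fromCols (colBasis (U ⊓ V)) (colBasis (C ⊓ V))) :=
    leftInv_fromCols (colBasis_leftInv _) (colBasis_leftInv _) (by simpa only [colSpan_colBasis])
  have hJ' : LeftInv J := by
    obtain ⟨y, hy⟩ := colBasis_leftInv (U ⊓ V)
    exact ⟨y * colBasis U, by rw [Matrix.mul_assoc, ← hJ, hy]⟩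
  have key := deg_submodular hφ hH h1 hJ'
  rw [← hJ, deg_congr hφ hH h1 (U := U ⊔ V) (by
    rw [colSpan_fromCols, colSpan_colBasis, colSpan_colBasis, hU]),
    deg_congr hφ hH h2 (U := V) (by
    rw [colSpan_fromCols, colSpan_colBasis, colSpan_colBasis, hV])] at key
  exact key

theorem degS_bot : degS φ H (⊥ : Submodule N (ι → N)) = 0 := by
  have : IsEmpty (Fin (finrank N (⊥ : Submodule N (ι → N)))) := by
    rw [finrank_bot]
    infer_instance
  rw [degS, deg, cont]
  simp [gramDet, logN]

end Subspaces

section Descent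
open Matrix Module
variable {A ι β : Type} [Fintype A] [Fintype ι] [Fintype β]
variable {K L : Type} [Field K] [NumberField K] [Field L] [NumberField L] [Algebra K L]
variable {φ : Matrix A ι K} {H : (K →+* ℂ) → Matrix ι ι ℂ}

/-- The image of a subspace under a Galois automorphism. -/
def galConj (g : L ≃ₐ[K] L) (U : Submodule L (ι → L)) : Submodule L (ι → L) where
  carrier := {v | (fun i => g.symm (v i)) ∈ U}
  add_mem' {v w} hv hw := by
    have := U.add_mem hv hw
    simpa [Pi.add_def] using this
  zero_mem' := by
    have := U.zero_mem
    simpa [Pi.zero_def] using this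
  smul_mem' r v hv := by
    have := U.smul_mem (g.symm r) hv
    simpa [Pi.smul_def] using this

theorem mem_galConj {g : L ≃ₐ[K] L} {U : Submodule L (ι → L)} {v : ι → L} :
    v ∈ galConj g U ↔ (fun i => g.symm (v i)) ∈ U := Iff.rfl

theorem colSpan_map_algEquiv (g : L ≃ₐ[K] L) (x : Matrix ι β L) :
    colSpan (x.map g) = galConj g (colSpan x) := by
  ext v
  rw [mem_galConj, mem_colSpan, mem_colSpan]
  constructor
  · rintro ⟨w, rfl⟩
    refine ⟨fun j => g.symm (w j), ?_⟩
    ext i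
    simp [mulVec, dotProduct]
  · rintro ⟨w, hw⟩
    refine ⟨fun j => g (w j), ?_⟩
    ext i
    have := congrArg g (congrFun hw i)
    simpa [mulVec, dotProduct] using this

theorem deg_map_equiv {L₂ : Type} [Field L₂] [NumberField L₂] [Algebra K L₂] (hφ : LeftInv φ)
    (g : L ≃ₐ[K] L₂) {x : Matrix ι β L} (hx : LeftInv x) :
    deg φ H (x.map g) = deg φ H x := by
  let : Algebra L L₂ := (g : L →+* L₂).toAlgebra
  have : IsScalarTower K L L₂ := IsScalarTower.of_algebraMap_eq fun a => (g.commutes a).symm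
  have h : finrank L L₂ = 1 := by
    have h1 := finrank_mul_finrank K L L₂
    rw [g.toLinearEquiv.finrank_eq] at h1
    exact Nat.eq_of_mul_eq_mul_left finrank_pos (h1.trans (mul_one _).symm)
  have := deg_map (L := L₂) (H := H) hφ hx
  rw [h, Nat.cast_one, one_mul] at this
  exact this

theorem degS_galConj (hφ : LeftInv φ) (hH : ∀ σ, (H σ).PosDef) (g : L ≃ₐ[K] L)
    (U : Submodule L (ι → L)) : degS φ H (galConj g U) = degS φ H U := by
  have h := colBasis_leftInv U
  rw [← deg_congr hφ hH (h.map (g : L →+* L)) (U := galConj g U), degS]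
  · exact deg_map_equiv hφ g h
  · exact (colSpan_map_algEquiv g _).trans (by rw [colSpan_colBasis])

theorem finrank_galConj (g : L ≃ₐ[K] L) (U : Submodule L (ι → L)) :
    finrank L (galConj g U) = finrank L U := by
  have h : colSpan ((colBasis U).map g) = galConj g U :=
    (colSpan_map_algEquiv g _).trans (by rw [colSpan_colBasis])
  have h2 := finrank_colSpan ((colBasis_leftInv U).map (g : L →+* L))
  rw [← h]
  exact h2.trans (Fintype.card_fin _)

/-- Galois descent for subspaces. -/
theorem exists_of_galois_stable [IsGalois K L] {W : Submodule L (ι → L)}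
    (hW : ∀ (g : L ≃ₐ[K] L), ∀ w ∈ W, (fun i => g (w i)) ∈ W) :
    ∃ (s : ℕ) (x : Matrix ι (Fin s) K), LeftInv x ∧ colSpan (x.map (algebraMap K L)) = W := by
  let W₀ : Submodule K (ι → K) :=
    { carrier := {u | (fun i => algebraMap K L (u i)) ∈ W}
      add_mem' := fun {v w} hv hw => by
        have := W.add_mem hv hw
        simpa [Pi.add_def] using this
      zero_mem' := by
        have := W.zero_mem
        simpa [Pi.zero_def] using this
      smul_mem' := fun r v hv => by
        rw [Set.mem_ofPred_eq, show (fun i => algebraMap K L ((r • v) i)) =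
          algebraMap K L r • fun i => algebraMap K L (v i) by ext i; simp]
        exact W.smul_mem (algebraMap K L r) hv }
  refine ⟨_, colBasis W₀, colBasis_leftInv _, le_antisymm ?_ ?_⟩
  · rw [colSpan, range_mulVecLin, Submodule.span_le]
    rintro _ ⟨j, rfl⟩
    exact (finBasis K W₀ j).2
  · intro w hw
    let b := finBasis K L
    have h1 : ∀ j, ∃ c, colBasis W₀ *ᵥ c = fun i => Algebra.trace K L (b j * w i) := fun j => by
      rw [← mem_colSpan, colSpan_colBasis]
      change (fun i => algebraMap K L (Algebra.trace K L (b j * w i))) ∈ W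
      have : (fun i => algebraMap K L (Algebra.trace K L (b j * w i))) =
          ∑ g : L ≃ₐ[K] L, g (b j) • fun i => g (w i) := by
        ext i
        rw [trace_eq_sum_automorphisms, Finset.sum_apply]
        simp
      rw [this]
      exact W.sum_mem fun g _ => W.smul_mem _ (hW g w hw)
    choose c hc using h1
    refine mem_colSpan.mpr ⟨∑ j, b.traceDual j • fun i => algebraMap K L (c j i), ?_⟩
    have h2 : ∀ j, (colBasis W₀).map (algebraMap K L) *ᵥ (fun i => algebraMap K L (c j i)) =
        fun i => algebraMap K L (Algebra.trace K L (b j * w i)) := fun j => by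
      ext i
      rw [← congrFun (hc j) i]
      simp [mulVec, dotProduct]
    rw [mulVec_sum]
    simp only [mulVec_smul, h2]
    ext i
    rw [Finset.sum_apply]
    conv_rhs => rw [← b.traceDual.sum_repr (w i)]
    refine Finset.sum_congr rfl fun j _ => ?_
    rw [Basis.traceDual_repr_apply, Algebra.traceForm_apply, Pi.smul_apply, smul_eq_mul, mul_comm,
      Algebra.smul_def, mul_comm (w i)]

theorem degS_le_of_isGalois [IsGalois K L] (hφ : LeftInv φ) (hH : ∀ σ, (H σ).PosDef) {M : ℝ}
    (hM : ∀ (s : ℕ) (x : Matrix ι (Fin s) K), LeftInv x → deg φ H x ≤ s * M)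
    (U : Submodule L (ι → L)) : degS φ H U ≤ finrank L U * (finrank K L * M) := by
  let D : Submodule L (ι → L) → ℝ := fun U => degS φ H U - finrank L U * (finrank K L * M)
  have hD : ∀ U V, D U + D V ≤ D (U ⊔ V) + D (U ⊓ V) := fun U V => by
    have h1 := degS_supermodular hφ hH U V
    have h2 : (finrank L ↥(U ⊔ V) : ℝ) + finrank L ↥(U ⊓ V) = finrank L U + finrank L V := by
      exact_mod_cast Submodule.finrank_sup_add_finrank_inf_eq U V
    have h3 := congrArg (· * (finrank K L * M)) h2
    simp only [add_mul] at h3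
    simp only [D]
    linarith
  have hbot : D ⊥ = 0 := by simp [D, degS_bot]
  have hconj : ∀ (g : L ≃ₐ[K] L) U, D (galConj g U) = D U := fun g U => by
    simp only [D, degS_galConj hφ hH, finrank_galConj]
  have hbdd : BddAbove (Set.range D) := by
    obtain ⟨C, hC⟩ := exists_deg_le (φ := φ) (H := H) L hφ hH
    refine ⟨C + Fintype.card ι * |finrank K L * M|, ?_⟩
    rintro _ ⟨U, rfl⟩
    have h1 := hC _ (colBasis U) (colBasis_leftInv U)
    have h2 : (finrank L U : ℝ) ≤ Fintype.card ι := by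
      have := Submodule.finrank_le U
      rw [finrank_fintype_fun_eq_card] at this
      exact_mod_cast this
    have h3 := mul_le_mul_of_nonneg_right h2 (abs_nonneg (finrank K L * M))
    have h4 := mul_le_mul_of_nonneg_left (neg_abs_le (finrank K L * M))
      (Nat.cast_nonneg (α := ℝ) (finrank L U))
    simp only [D]
    change deg φ H (colBasis U) - _ ≤ _
    linarith
  set S := ⨆ U, D U with hS
  have hle : ∀ U, D U ≤ S := fun U => le_ciSup hbdd U
  have hstable : ∀ W : Submodule L (ι → L),
      (∀ (g : L ≃ₐ[K] L), ∀ w ∈ W, (fun i => g (w i)) ∈ W) → D W ≤ 0 := fun W hW => by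
    obtain ⟨s, x, hx, hxW⟩ := exists_of_galois_stable hW
    have h1 := deg_congr hφ hH (hx.map (algebraMap K L)) hxW
    have h2 := finrank_colSpan (hx.map (algebraMap K L))
    rw [hxW, Fintype.card_fin] at h2
    have h3 := deg_map (N := K) (L := L) (H := H) hφ hx
    have h4 := mul_le_mul_of_nonneg_left (hM s x hx) (Nat.cast_nonneg (α := ℝ) (finrank K L))
    simp only [D]
    rw [← h1, h2]
    have h5 : deg φ H (x.map (algebraMap K L)) = finrank K L * deg φ H x := h3
    linarith
  have horbit : ∀ (U : Submodule L (ι → L)) (T : Finset (L ≃ₐ[K] L)),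
      D U + T.card * (D U - S) ≤ D (U ⊔ T.sup fun g => galConj g U) := fun U T => by
    induction T using Finset.induction_on with
    | empty => simp
    | insert g T hg ih =>
      have h1 := hD (galConj g U) (U ⊔ T.sup fun g => galConj g U)
      have h2 := hle (galConj g U ⊓ (U ⊔ T.sup fun g => galConj g U))
      rw [hconj] at h1
      rw [Finset.sup_insert, Finset.card_insert_of_notMem hg, sup_left_comm]
      push_cast
      linarith
  have hfin : ∀ U, D U ≤ Fintype.card (L ≃ₐ[K] L) / (Fintype.card (L ≃ₐ[K] L) + 1) * S :=
    fun U => by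
    have h1 := horbit U Finset.univ
    have h2 : D (U ⊔ Finset.univ.sup fun g : L ≃ₐ[K] L => galConj g U) ≤ 0 := by
      refine hstable _ fun g w hw => ?_
      have h3 : U ≤ Finset.univ.sup fun g : L ≃ₐ[K] L => galConj g U :=
        le_trans (fun v hv => hv) (Finset.le_sup (f := fun g : L ≃ₐ[K] L => galConj g U)
          (Finset.mem_univ (1 : L ≃ₐ[K] L)))
      rw [sup_of_le_right h3] at hw ⊢
      have h4 : (Finset.univ.sup fun g : L ≃ₐ[K] L => galConj g U) ≤
          galConj g.symm (Finset.univ.sup fun g : L ≃ₐ[K] L => galConj g U) := by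
        refine Finset.sup_le fun h _ v hv => ?_
        refine Finset.le_sup (f := fun g : L ≃ₐ[K] L => galConj g U)
          (Finset.mem_univ (g * h)) (?_ : _ ∈ galConj (g * h) U)
        rw [mem_galConj]
        have : (fun i => h.symm (v i)) ∈ U := hv
        convert this using 2 with i
        rw [AlgEquiv.symm_apply_eq]
        simp
      exact h4 hw
    rw [Finset.card_univ] at h1
    rw [div_mul_eq_mul_div, le_div_iff₀ (by positivity)]
    linarith
  have hS0 : S ≤ 0 := by
    have h1 : S ≤ Fintype.card (L ≃ₐ[K] L) / (Fintype.card (L ≃ₐ[K] L) + 1) * S := ciSup_le hfin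
    rw [div_mul_eq_mul_div, le_div_iff₀ (by positivity)] at h1
    linarith
  have := (hle U).trans hS0
  simp only [D] at this
  linarith

/-- A slope bound for the subspaces over `K` propagates to all finite extensions. -/
theorem deg_le_of_base (hφ : LeftInv φ) (hH : ∀ σ, (H σ).PosDef) {M : ℝ}
    (hM : ∀ (s : ℕ) (x : Matrix ι (Fin s) K), LeftInv x → deg φ H x ≤ s * M)
    {x : Matrix ι β L} (hx : LeftInv x) :
    deg φ H x ≤ Fintype.card β * (finrank K L * M) := by
  let E := AlgebraicClosure L
  let F : IntermediateField K E := IntermediateField.normalClosure K L E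
  have : NumberField F := NumberField.of_module_finite K F
  have h1 := degS_le_of_isGalois (L := F) hφ hH hM (colSpan (x.map (algebraMap L F)))
  have h2 := deg_congr hφ hH (hx.map (algebraMap L F)) rfl
  have h3 := finrank_colSpan (hx.map (algebraMap L F))
  have h4 := deg_map (L := F) (H := H) hφ hx
  have h5 : (finrank K L : ℝ) * finrank L F = finrank K F := by
    exact_mod_cast finrank_mul_finrank K L F
  have h6 : (0 : ℝ) < finrank L F := by exact_mod_cast finrank_pos
  rw [← h2, h3, ← h5] at h1
  refine le_of_mul_le_mul_left ?_ h6
  have h7 : deg φ H (x.map (algebraMap L F)) = finrank L F * deg φ H x := h4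
  linarith

end Descent

section PseudoBasis
open Matrix Module FractionalIdeal
open scoped nonZeroDivisors
variable {N : Type} [Field N] [NumberField N]

theorem exists_fractionalIdeal_of_fg {I : Submodule (𝓞 N) N} (hI : I.FG) :
    ∃ c : FractionalIdeal (𝓞 N)⁰ N, ∀ x, x ∈ c ↔ x ∈ I :=
  ⟨⟨I, isFractional_of_fg hI⟩, fun _ => Iff.rfl⟩

theorem exists_smul_mem_of_le {V : Type} [AddCommGroup V] [Module N V] [Module (𝓞 N) V]
    [IsScalarTower (𝓞 N) N V] {Λ : Submodule (𝓞 N) V} {v : V}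
    (hv : v ∈ Submodule.span N (Λ : Set V)) : ∃ d : 𝓞 N, d ≠ 0 ∧ d • v ∈ Λ := by
  induction hv using Submodule.span_induction with
  | mem x hx => exact ⟨1, one_ne_zero, by simpa using hx⟩
  | zero => exact ⟨1, one_ne_zero, by simp⟩
  | add x y _ _ hx hy =>
    obtain ⟨a, ha, hx⟩ := hx
    obtain ⟨b, hb, hy⟩ := hy
    refine ⟨a * b, mul_ne_zero ha hb, ?_⟩
    rw [smul_add, mul_comm a, mul_smul, mul_comm b, mul_smul]
    exact Λ.add_mem (Λ.smul_mem _ hx) (Λ.smul_mem _ hy)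
  | smul r x _ hx =>
    obtain ⟨a, ha, hx⟩ := hx
    obtain ⟨⟨p, q⟩, h⟩ := IsLocalization.surj (𝓞 N)⁰ r
    refine ⟨a * q, mul_ne_zero ha (nonZeroDivisors.ne_zero q.2), ?_⟩
    have : (a * (q : 𝓞 N)) • r • x = p • a • x := by
      rw [← algebraMap_smul N (a * (q : 𝓞 N)), ← algebraMap_smul N p, ← algebraMap_smul N a x,
        smul_smul, smul_smul, ← h, map_mul]
      congr 1
      ring
    rw [this]
    exact Λ.smul_mem _ hx

/-- The element splitting off the first coordinate of a lattice. -/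
theorem exists_splitting {V : Type} [AddCommGroup V] [Module N V] [Module (𝓞 N) V]
    [IsScalarTower (𝓞 N) N V] {Λ : Submodule (𝓞 N) V} (p : V →ₗ[N] N)
    {c : FractionalIdeal (𝓞 N)⁰ N} (hc0 : c ≠ 0) (hc : ∀ x, x ∈ c ↔ ∃ v ∈ Λ, p v = x) :
    ∃ e : V, p e = 1 ∧ ∀ t ∈ c, t • e ∈ Λ := by
  have h1 : (1 : N) ∈ c * c⁻¹ := by
    rw [mul_inv_cancel₀ hc0]
    exact one_mem_one _
  refine FractionalIdeal.mul_induction_on (C := fun x => ∃ e : V, p e = x ∧ ∀ t ∈ c, t • e ∈ Λ)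
    h1 ?_ ?_
  · intro m hm q hq
    obtain ⟨v, hv, rfl⟩ := (hc m).mp hm
    refine ⟨q • v, by simp [mul_comm], fun t ht => ?_⟩
    obtain ⟨a, ha⟩ := (mem_one_iff _).mp ((mem_inv_iff hc0).mp hq t ht)
    rw [smul_smul, mul_comm, ← ha, algebraMap_smul]
    exact Λ.smul_mem _ hv
  · rintro x y ⟨e, he, he'⟩ ⟨f, hf, hf'⟩
    refine ⟨e + f, by rw [map_add, he, hf], fun t ht => ?_⟩
    rw [smul_add]
    exact Λ.add_mem (he' t ht) (hf' t ht)

/-- Every full lattice over a ring of integers has a pseudo-basis. -/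
theorem exists_pseudoBasis {s : ℕ} {Λ : Submodule (𝓞 N) (Fin s → N)} (hfg : Λ.FG)
    (hfull : ∀ v, ∃ d : 𝓞 N, d ≠ 0 ∧ d • v ∈ Λ) :
    ∃ (g : Matrix (Fin s) (Fin s) N) (c : Fin s → FractionalIdeal (𝓞 N)⁰ N), g.det = 1 ∧
      (∀ i, c i ≠ 0) ∧ ∀ v, v ∈ Λ ↔ ∀ i, (g *ᵥ v) i ∈ c i := by
  induction s with
  | zero =>
    refine ⟨1, fun _ => 1, by simp, fun _ => one_ne_zero, fun v => ?_⟩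
    rw [Subsingleton.elim v 0]
    exact iff_of_true (Submodule.zero_mem _) fun i => i.elim0
  | succ s ih =>
    let p : (Fin (s + 1) → N) →ₗ[N] N := LinearMap.proj 0
    obtain ⟨c₀, hc₀⟩ := exists_fractionalIdeal_of_fg (hfg.map (p.restrictScalars (𝓞 N)))
    replace hc₀ : ∀ x, x ∈ c₀ ↔ ∃ v ∈ Λ, p v = x := fun x => (hc₀ x).trans Submodule.mem_map
    have hne : c₀ ≠ 0 := by
      rintro rfl
      obtain ⟨d, hd, h⟩ := hfull (Pi.single 0 1)
      have := (hc₀ (p (d • Pi.single 0 1))).mpr ⟨_, h, rfl⟩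
      rw [mem_zero_iff] at this
      simp [p, Algebra.smul_def, hd] at this
    obtain ⟨e, he, hec⟩ := exists_splitting p hne hc₀
    let ic : (Fin s → N) →ₗ[𝓞 N] (Fin (s + 1) → N) :=
      { toFun := fun v => Fin.cons 0 v
        map_add' := fun v w => by
          ext i
          refine Fin.cases ?_ (fun j => ?_) i <;> simp
        map_smul' := fun a v => by
          ext i
          refine Fin.cases ?_ (fun j => ?_) i <;> simp }
    have hic : Function.Injective ic := fun v w h => by
      ext j
      exact congrFun h j.succ
    have hfg' : (Λ.comap ic).FG := by
      refine Submodule.fg_of_fg_map_injective ic hic ?_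
      have : IsNoetherian (𝓞 N) Λ := isNoetherian_of_fg_of_noetherian Λ hfg
      exact Submodule.FG.of_le hfg (Submodule.map_comap_le _ _)
    obtain ⟨g, c, hg, hc, h⟩ := ih hfg' fun v => by
      obtain ⟨d, hd, h⟩ := hfull (ic v)
      exact ⟨d, hd, by rwa [Submodule.mem_comap, map_smul]⟩
    let te : Fin s → N := fun j => e j.succ
    let G : Matrix (Fin (s + 1)) (Fin (s + 1)) N :=
      Matrix.of (Fin.cons (Pi.single 0 1) fun i => Fin.cons (-(g *ᵥ te) i) (g i))
    have hG0 : ∀ v, (G *ᵥ v) 0 = v 0 := fun v => by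
      simp [G, mulVec, dotProduct, Fin.sum_univ_succ]
    have hG1 : ∀ v i, (G *ᵥ v) (Fin.succ i) = (g *ᵥ fun j => v j.succ - v 0 * te j) i :=
      fun v i => by
      simp [G, mulVec, dotProduct, Fin.sum_univ_succ, mul_sub, Finset.sum_sub_distrib,
        Finset.sum_mul]
      rw [add_comm, sub_eq_add_neg]
      congr 2
      exact Finset.sum_congr rfl fun j _ => by ring
    refine ⟨G, Fin.cons c₀ c, ?_, ?_, fun v => ?_⟩
    · rw [det_succ_row_zero, Fin.sum_univ_succ, Finset.sum_eq_zero]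
      · rw [← hg]
        simp [G]
        congr 1
      · intro j _
        simp [G]
    · intro i
      refine Fin.cases hne hc i
    · rw [Fin.forall_fin_succ, hG0]
      simp only [hG1, Fin.cons_zero, Fin.cons_succ]
      rw [← h, Submodule.mem_comap]
      have h1 : ic (fun j => v j.succ - v 0 * te j) = v - v 0 • e := by
        ext i
        refine Fin.cases ?_ (fun j => ?_) i
        · have : e 0 = 1 := he
          simp [ic, this]
        · simp [ic, te]
      rw [h1]
      constructor
      · intro hv
        have h2 := (hc₀ (v 0)).mpr ⟨v, hv, rfl⟩
        exact ⟨h2, Λ.sub_mem hv (hec _ h2)⟩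
      · rintro ⟨h2, h3⟩
        have := Λ.add_mem h3 (hec _ h2)
        rwa [sub_add_cancel] at this

theorem prod_le_of_forall {β : Type} (S : Finset β) (c : β → FractionalIdeal (𝓞 N)⁰ N)
    (J : FractionalIdeal (𝓞 N)⁰ N)
    (h : ∀ t : β → N, (∀ i, t i ∈ c i) → ∏ i ∈ S, t i ∈ J) : ∏ i ∈ S, c i ≤ J := by
  induction S using Finset.induction_on generalizing J with
  | empty =>
    simp only [Finset.prod_empty] at h ⊢
    rw [← spanSingleton_one, spanSingleton_le_iff_mem]
    exact h 0 fun i => FractionalIdeal.zero_mem _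
  | insert b S hb ih =>
    rw [Finset.prod_insert hb, FractionalIdeal.mul_le]
    intro x hx y hy
    by_cases hx0 : x = 0
    · simpa [hx0] using FractionalIdeal.zero_mem J
    have h1 : ∏ i ∈ S, c i ≤ spanSingleton (𝓞 N)⁰ x⁻¹ * J := by
      refine ih _ fun t ht => mem_singleton_mul.mpr ⟨x * ∏ i ∈ S, t i, ?_, by field_simp⟩
      have h2 := h (Function.update t b x) fun i => by
        by_cases hi : i = b
        · subst hi
          simpa using hx
        · simpa [hi] using ht i
      rw [Finset.prod_insert hb, Function.update_self] at h2
      convert h2 using 2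
      refine Finset.prod_congr rfl fun i hi => ?_
      rw [Function.update_of_ne]
      rintro rfl
      exact hb hi
    obtain ⟨z, hz, rfl⟩ := mem_singleton_mul.mp (h1 hy)
    rwa [mul_inv_cancel_left₀ hx0]

/-- The content of a matrix in terms of a pseudo-basis of its row lattice. -/
theorem cont_eq_prod {A β : Type} [Fintype A] [Fintype β] (P : Matrix A β N)
    {g : Matrix β β N} (hg : g.det = 1) {c : β → FractionalIdeal (𝓞 N)⁰ N}
    (h : ∀ v, v ∈ Submodule.span (𝓞 N) (Set.range P) ↔ ∀ i, (g *ᵥ v) i ∈ c i) :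
    cont P = ∏ i, c i := by
  refine le_antisymm (cont_le_iff.mpr fun f => ?_) (prod_le_of_forall _ _ _ fun t ht => ?_)
  · have h1 : (P.submatrix f id).det = (P.submatrix f id * gᵀ).det := by
      rw [det_mul, det_transpose, hg, mul_one]
    rw [h1]
    refine det_mem_prod c _ fun i j => ?_
    have := (h (P (f i))).mp (Submodule.subset_span ⟨f i, rfl⟩) j
    convert this using 1
    simp [Matrix.mul_apply, mulVec, dotProduct, mul_comm]
  · have hg' : g * g⁻¹ = 1 := mul_nonsing_inv g (by simp [hg])
    have h1 : ∀ i, t i • g⁻¹.col i ∈ Submodule.span (𝓞 N) (Set.range P) := fun i => by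
      rw [h]
      intro j
      rw [mulVec_smul]
      have : (g *ᵥ g⁻¹.col i) j = (1 : Matrix β β N) j i := by
        rw [← hg', Matrix.mul_apply]
        rfl
      rw [Pi.smul_apply, this, one_apply]
      split_ifs with hij
      · subst hij
        simpa using ht j
      · simpa using FractionalIdeal.zero_mem (c j)
    choose q hq using fun i => (Submodule.mem_span_range_iff_exists_fun (𝓞 N)).mp (h1 i)
    have h2 := det_mul_mem_cont (Matrix.of q) P
    have h3 : (Matrix.of q).map (algebraMap (𝓞 N) N) * P = diagonal t * (g⁻¹)ᵀ := by
      ext i j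
      have := congrFun (hq i) j
      rw [Finset.sum_apply] at this
      rw [diagonal_mul, Matrix.mul_apply]
      simpa [Algebra.smul_def] using this
    rw [h3, det_mul, det_diagonal, det_transpose, det_nonsing_inv, hg] at h2
    simpa using h2

end PseudoBasis

section AbsoluteSiegel
open Matrix Module FractionalIdeal
open scoped nonZeroDivisors
variable {A ι β : Type} [Fintype A] [Fintype ι] [Fintype β]
variable {K N : Type} [Field K] [NumberField K] [Field N] [NumberField N] [Algebra K N]
variable {φ : Matrix A ι K} {H : (K →+* ℂ) → Matrix ι ι ℂ}

theorem exists_pow_eq_spanSingleton {c : FractionalIdeal (𝓞 N)⁰ N} (hc : c ≠ 0) :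
    ∃ h : ℕ, 0 < h ∧ ∃ γ : N, γ ≠ 0 ∧ c ^ h = spanSingleton (𝓞 N)⁰ γ := by
  obtain ⟨a, J, ha, rfl⟩ := exists_eq_spanSingleton_mul c
  have hJ : J ≠ ⊥ := by
    rintro rfl
    simp at hc
  obtain ⟨h, hh, α, hα⟩ := exists_pow_eq_span hJ
  have h1 : (spanSingleton (𝓞 N)⁰ (algebraMap (𝓞 N) N a)⁻¹ * (J : FractionalIdeal (𝓞 N)⁰ N)) ^ h =
      spanSingleton (𝓞 N)⁰ ((algebraMap (𝓞 N) N a)⁻¹ ^ h * algebraMap (𝓞 N) N α) := by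
    rw [mul_pow, spanSingleton_pow, ← coeIdeal_pow, hα, coeIdeal_span_singleton,
      spanSingleton_mul_spanSingleton]
  refine ⟨h, hh, _, ?_, h1⟩
  intro h0
  rw [h0, spanSingleton_zero] at h1
  exact pow_ne_zero h hc h1

theorem logN_prod {S : Finset β} {c : β → FractionalIdeal (𝓞 N)⁰ N} (h : ∀ i ∈ S, c i ≠ 0) :
    logN (∏ i ∈ S, c i) = ∑ i ∈ S, logN (c i) := by
  induction S using Finset.induction_on with
  | empty => simp [logN_one]
  | insert b S hb ih =>
    have h1 : ∀ i ∈ S, c i ≠ 0 := fun i hi => h i (Finset.mem_insert_of_mem hi)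
    rw [Finset.prod_insert hb, Finset.sum_insert hb, logN_mul (h b (Finset.mem_insert_self _ _))
      (Finset.prod_ne_zero_iff.mpr h1), ih h1]

theorem spanSingleton_prod (S : Finset β) (x : β → N) :
    ∏ i ∈ S, spanSingleton (𝓞 N)⁰ (x i) = spanSingleton (𝓞 N)⁰ (∏ i ∈ S, x i) := by
  induction S using Finset.induction_on with
  | empty => simp
  | insert b S hb ih =>
    rw [Finset.prod_insert hb, Finset.prod_insert hb, ih, spanSingleton_mul_spanSingleton]

/-- Adjoining roots to a number field. -/
theorem exists_field_of_roots (h : β → ℕ) (hh : ∀ i, 0 < h i) (γ : β → N) :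
    ∃ (k : Type) (_ : Field k) (_ : NumberField k) (_ : Algebra N k),
      NumberField.IsTotallyComplex k ∧ ∃ r : β → k, ∀ i, r i ^ h i = algebraMap N k (γ i) := by
  let E := AlgebraicClosure N
  obtain ⟨z, hz⟩ := IsAlgClosed.exists_pow_nat_eq (-1 : E) two_pos
  choose r hr using fun i => IsAlgClosed.exists_pow_nat_eq (algebraMap N E (γ i)) (hh i)
  let F : IntermediateField N E := IntermediateField.adjoin N (insert z (Set.range r))
  have : FiniteDimensional N F :=
    IntermediateField.finiteDimensional_adjoin fun x _ => Algebra.IsIntegral.isIntegral x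
  have hF : NumberField F := NumberField.of_module_finite N F
  let z' : F := ⟨z, IntermediateField.subset_adjoin _ _ (Set.mem_insert _ _)⟩
  have hz' : z' ^ 2 = -1 := Subtype.ext hz
  refine ⟨F, inferInstance, hF, inferInstance, ⟨fun v => ?_⟩, fun i => ⟨r i,
    IntermediateField.subset_adjoin _ _ (Set.mem_insert_of_mem _ ⟨i, rfl⟩)⟩, fun i =>
    Subtype.ext (hr i)⟩
  rw [← NumberField.InfinitePlace.not_isReal_iff_isComplex]
  intro hv
  have h1 := congrArg (NumberField.InfinitePlace.embedding_of_isReal hv) hz'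
  rw [map_pow, map_neg, map_one] at h1
  nlinarith [sq_nonneg (NumberField.InfinitePlace.embedding_of_isReal hv z')]

/-- All lines over finite extensions have normalized degree at most `M`. -/
def AbsBound (φ : Matrix A ι K) (H : (K →+* ℂ) → Matrix ι ι ℂ) (M : ℝ) : Prop :=
  ∀ (N : Type) [Field N] [NumberField N] [Algebra K N] (x : Matrix ι Unit N), LeftInv x →
    deg φ H x ≤ finrank K N * M

theorem det_unit {R : Type} [CommRing R] {d : DecidableEq Unit} {f : Fintype Unit}
    (M : Matrix Unit Unit R) :
    M.det = M () () := by
  exact det_unique M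

theorem gramDet_unit {H : Matrix ι ι ℂ} (hH : H.PosDef) {x : Matrix ι β ℂ} (hx : LeftInv x)
    (y : Matrix β Unit ℂ) (hy : LeftInv y) :
    Real.log (gramDet H (x * y)) = 2 * Real.log (gramNorm (gram H x) fun b => y b ()) := by
  have h1 : gramDet H (x * y) =
      (star (fun b => y b ()) ⬝ᵥ gram H x *ᵥ fun b => y b ()).re := by
    rw [gramDet, gram_mul, det_unit, Matrix.mul_assoc]
    rfl
  rw [gramNorm, ← h1, Real.log_sqrt (gramDet_pos hH (hx.mul hy)).le]
  ring

theorem leftInv_col {x : Matrix β Unit N} {b : β} (hb : x b () ≠ 0) : LeftInv x :=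
  ⟨Matrix.of fun _ => Pi.single b (x b ())⁻¹, by
    ext i j
    simp [Matrix.mul_apply, Pi.single_apply, hb]⟩

theorem heightBound_of_absBound (hH : ∀ σ, (H σ).PosDef) {M : ℝ} (hφ : LeftInv φ)
    (hM : AbsBound φ H M) {u : Matrix ι β N} (hu : LeftInv u)
    (hint : ∀ a b, ∃ t : 𝓞 N, (φ.map (algebraMap K N) * u) a b = algebraMap (𝓞 N) N t) :
    HeightBound (fun σ => gramNorm (gram (H (σ.comp (algebraMap K N))) (u.map σ)))
      (-(finrank K N * M)) := by
  intro K' _ _ _ x hx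
  let : Algebra K K' := ((algebraMap N K').comp (algebraMap K N)).toAlgebra
  have : IsScalarTower K N K' := IsScalarTower.of_algebraMap_eq fun a => rfl
  obtain ⟨b, hb⟩ := Function.ne_iff.mp hx
  let y : Matrix β Unit K' := Matrix.of fun b _ => (x b : K')
  have hy : LeftInv y := leftInv_col (b := b) (by simpa [y] using hb)
  have h1 := hM K' (u.map (algebraMap N K') * y) ((hu.map _).mul hy)
  rw [← finrank_mul_finrank K N K', deg] at h1
  have h2 : ∀ σ : K' →+* ℂ, Real.log (gramDet (H (σ.comp (algebraMap K K')))
      ((u.map (algebraMap N K') * y).map σ)) = 2 * Real.log (gramNorm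
        (gram (H ((σ.comp (algebraMap N K')).comp (algebraMap K N)))
          (u.map (σ.comp (algebraMap N K')))) fun j => σ (x j)) := fun σ => by
    rw [Matrix.map_mul, Matrix.map_map]
    exact gramDet_unit (hH _) (hu.map (σ.comp (algebraMap N K'))) _ (hy.map σ)
  simp only [h2] at h1
  rw [← Finset.mul_sum, mul_div_cancel_left₀ _ two_ne_zero] at h1
  have h3 : Real.log (Ideal.absNorm (Ideal.span (Set.range x))) ≤
      logN (cont (φ.map (algebraMap K K') * (u.map (algebraMap N K') * y))) := by
    rw [← logN_coeIdeal (N := K')]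
    refine logN_mono (cont_ne_zero_of_leftInv hφ ((hu.map _).mul hy)) (cont_le_iff.mpr fun f => ?_)
    rw [det_unit, submatrix_apply, ← Matrix.mul_assoc, Matrix.mul_apply]
    choose t ht using hint (f default)
    refine (mem_coeIdeal _).mpr ⟨∑ b, algebraMap (𝓞 N) (𝓞 K') (t b) * x b,
      Ideal.sum_mem _ fun b _ => Ideal.mul_mem_left _ _ (Ideal.subset_span ⟨b, rfl⟩), ?_⟩
    rw [map_sum]
    refine Finset.sum_congr rfl fun b _ => ?_
    rw [map_mul, ← IsScalarTower.algebraMap_apply, IsScalarTower.algebraMap_apply (𝓞 N) N K',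
      ← ht b]
    congr 1
    simp [Matrix.mul_apply, map_sum, ← IsScalarTower.algebraMap_apply]
  push_cast at h1
  linarith

theorem deg_le_of_integral [NumberField.IsTotallyComplex N] [Nonempty β]
    (hH : ∀ σ, (H σ).PosDef)
    (hconj : ∀ σ, H ((starRingEnd ℂ).comp σ) = (H σ).map (starRingEnd ℂ)) {M : ℝ}
    (hφ : LeftInv φ) (hM : AbsBound φ H M) {u : Matrix ι β N} (hu : LeftInv u)
    (hint : ∀ a b, ∃ t : 𝓞 N, (φ.map (algebraMap K N) * u) a b = algebraMap (𝓞 N) N t)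
    (hcont : logN (cont (φ.map (algebraMap K N) * u)) = 0) :
    deg φ H u ≤ Fintype.card β * (finrank K N * M) +
      Fintype.card β / 2 * (finrank ℚ N * Real.log (Fintype.card β)) := by
  have h1 := siegel_free (fun σ : N →+* ℂ => gram_posDef (hH (σ.comp (algebraMap K N))) (hu.map σ))
    (fun σ => ?_) (heightBound_of_absBound hH hφ hM hu hint)
  · rw [deg, hcont]
    change _ ≤ (∑ σ : N →+* ℂ, Real.log (gramDet _ _)) / 2 + _ at h1
    linarith
  · rw [gram, gram, Matrix.map_mul, Matrix.map_mul, RingHom.comp_assoc, hconj]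
    have h2 : (u.map ((starRingEnd ℂ).comp σ))ᴴ = (u.map σ)ᴴ.map (starRingEnd ℂ) := by
      ext i j
      simp
    rw [h2, Matrix.map_map]
    rfl

theorem exists_pseudoBasis_span_range {P : Matrix A β N} (hP : LeftInv P) :
    ∃ (g : Matrix β β N) (c : β → FractionalIdeal (𝓞 N)⁰ N), g.det = 1 ∧ (∀ i, c i ≠ 0) ∧
      ∀ v, v ∈ Submodule.span (𝓞 N) (Set.range P) ↔ ∀ i, (g *ᵥ v) i ∈ c i := by
  let e := Fintype.equivFin β
  let L : (β → N) ≃ₗ[𝓞 N] (Fin (Fintype.card β) → N) := LinearEquiv.funCongrLeft (𝓞 N) N e.symm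
  let W : Submodule (𝓞 N) (β → N) := Submodule.span (𝓞 N) (Set.range P)
  have hL : ∀ v, v ∈ W.map L.toLinearMap ↔ L.symm v ∈ W := fun v =>
    Submodule.mem_map_equiv W
  obtain ⟨g, c, hg, hc, h⟩ := exists_pseudoBasis
    (Λ := W.map L.toLinearMap)
    ((Submodule.fg_span (Set.finite_range P)).map _) fun v => by
      refine (exists_smul_mem_of_le (Λ := W) (v := L.symm v) ?_).imp fun d hd =>
        ⟨hd.1, (hL _).mpr (by rw [map_smul]; exact hd.2)⟩
      obtain ⟨y, hy⟩ := hP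
      have : L.symm v = ∑ a, (L.symm v ᵥ* y) a • P a := by
        rw [← vecMul_eq_sum, vecMul_vecMul, hy, vecMul_one]
      rw [this]
      exact Submodule.sum_mem _ fun a _ =>
        Submodule.smul_mem _ _ (Submodule.subset_span (Submodule.subset_span ⟨a, rfl⟩))
  refine ⟨g.submatrix e e, fun i => c (e i), ?_, fun i => hc _, fun v => ?_⟩
  · rw [← hg]
    convert det_submatrix_equiv_self e g
  · have h1 := h (L v)
    rw [hL, LinearEquiv.symm_apply_apply] at h1
    refine h1.trans ?_
    rw [e.forall_congr_left]
    refine forall_congr' fun i => ?_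
    simp only [e.apply_symm_apply]
    have : (g.submatrix e e *ᵥ v) (e.symm i) = (g *ᵥ L v) i := by
      simp only [mulVec, dotProduct, submatrix_apply, e.apply_symm_apply]
      rw [← Equiv.sum_comp e.symm]
      simp [L, LinearMap.funLeft]
    rw [this]

/-- The absolute Siegel lemma. -/
theorem deg_le_of_absBound (hH : ∀ σ, (H σ).PosDef)
    (hconj : ∀ σ, H ((starRingEnd ℂ).comp σ) = (H σ).map (starRingEnd ℂ)) {M : ℝ}
    (hφ : LeftInv φ) (hM : AbsBound φ H M) [Nonempty β]
    {u : Matrix ι β N} (hu : LeftInv u) :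
    deg φ H u ≤
      Fintype.card β * (finrank K N * (M + finrank ℚ K / 2 * Real.log (Fintype.card β))) := by
  set P := φ.map (algebraMap K N) * u with hP
  have hPinv : LeftInv P := (hφ.map _).mul hu
  obtain ⟨g, c, hg, hc, hΛ⟩ := exists_pseudoBasis_span_range hPinv
  have hcont := cont_eq_prod P hg hΛ
  choose h hh γ hγ hcγ using fun i => exists_pow_eq_spanSingleton (hc i)
  obtain ⟨k, _, _, _, _, r, hr⟩ := exists_field_of_roots h hh γ
  let : Algebra K k := ((algebraMap N k).comp (algebraMap K N)).toAlgebra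
  have : IsScalarTower K N k := IsScalarTower.of_algebraMap_eq fun a => rfl
  have hr0 : ∀ i, r i ≠ 0 := fun i h0 => by
    have := hr i
    rw [h0, zero_pow (hh i).ne', eq_comm, map_eq_zero] at this
    exact hγ i this
  have hlog : ∀ i, logN (spanSingleton (𝓞 k)⁰ (r i)) = finrank N k * logN (c i) := fun i => by
    have h1 : spanSingleton (𝓞 k)⁰ (r i) ^ h i = extendedHom k (𝓞 k) (c i ^ h i) := by
      rw [hcγ, extendedHom_spanSingleton', spanSingleton_pow, hr]
    have h2 := congrArg logN h1
    rw [logN_extendedHom (pow_ne_zero _ (hc i)), logN_pow, logN_pow] at h2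
    have h3 : (h i : ℝ) ≠ 0 := by exact_mod_cast (hh i).ne'
    refine mul_left_cancel₀ h3 ?_
    linarith
  let G : Matrix (β) (β) k := gᵀ.map (algebraMap N k) * diagonal fun i => (r i)⁻¹
  have hG : G.det = ∏ i, (r i)⁻¹ := by
    rw [det_mul, det_diagonal, ← RingHom.mapMatrix_apply, ← RingHom.map_det, det_transpose, hg,
      map_one, one_mul]
  have hG0 : G.det ≠ 0 := by
    rw [hG]
    exact Finset.prod_ne_zero_iff.mpr fun i _ => inv_ne_zero (hr0 i)
  have huk : LeftInv (u.map (algebraMap N k)) := hu.map _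
  have hPk : φ.map (algebraMap K k) * u.map (algebraMap N k) = P.map (algebraMap N k) := by
    rw [hP, Matrix.map_mul, Matrix.map_map]
    rfl
  have huG : LeftInv (u.map (algebraMap N k) * G) := huk.mul (leftInv_of_det_ne_zero hG0)
  have hentry : ∀ a i, (φ.map (algebraMap K k) * (u.map (algebraMap N k) * G)) a i =
      algebraMap N k ((g *ᵥ P a) i) * (r i)⁻¹ := fun a i => by
    rw [← Matrix.mul_assoc, hPk, ← Matrix.mul_assoc, mul_diagonal, ← Matrix.map_mul, map_apply]
    congr 2
    simp [Matrix.mul_apply, mulVec, dotProduct, mul_comm]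
  have hint : ∀ a i, ∃ t : 𝓞 k, (φ.map (algebraMap K k) * (u.map (algebraMap N k) * G)) a i =
      algebraMap (𝓞 k) k t := fun a i => by
    rw [hentry]
    have h1 : (g *ᵥ P a) i ∈ c i := (hΛ _).mp (Submodule.subset_span ⟨a, rfl⟩) i
    have h2 : (g *ᵥ P a) i ^ h i ∈ spanSingleton (𝓞 N)⁰ (γ i) := by
      rw [← hcγ]
      have := prod_mem_prod (Finset.univ : Finset (Fin (h i))) (fun _ => c i) (fun _ =>
          (g *ᵥ P a) i)
        fun _ _ => h1
      simpa using this
    obtain ⟨z, hz⟩ := (mem_spanSingleton _).mp h2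
    have h3 : (algebraMap N k ((g *ᵥ P a) i) * (r i)⁻¹) ^ h i = algebraMap (𝓞 N) k z := by
      rw [mul_pow, ← map_pow, ← hz, inv_pow, hr, Algebra.smul_def, map_mul,
        ← IsScalarTower.algebraMap_apply, mul_assoc, mul_inv_cancel₀ (by simpa using hγ i), mul_one]
    have h4 : IsIntegral ℤ (algebraMap N k ((g *ᵥ P a) i) * (r i)⁻¹) := by
      refine IsIntegral.of_pow (hh i) ?_
      rw [h3, IsScalarTower.algebraMap_apply (𝓞 N) (𝓞 k) k]
      exact NumberField.RingOfIntegers.isIntegral_coe _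
    exact ⟨⟨_, h4⟩, rfl⟩
  have hzero : logN (cont (φ.map (algebraMap K k) * (u.map (algebraMap N k) * G))) = 0 := by
    have h1 : ∀ i, spanSingleton (𝓞 k)⁰ (r i) ≠ 0 := fun i => spanSingleton_ne_zero_iff.mpr (hr0 i)
    have h2 : spanSingleton (𝓞 k)⁰ (∏ i, r i) ≠ 0 :=
      spanSingleton_ne_zero_iff.mpr (Finset.prod_ne_zero_iff.mpr fun i _ => hr0 i)
    have h3 : spanSingleton (𝓞 k)⁰ (∏ i, r i) * cont (φ.map (algebraMap K k) *
        (u.map (algebraMap N k) * G)) = extendedHom k (𝓞 k) (cont P) := by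
      rw [← Matrix.mul_assoc, hPk, cont_mul, cont_map, ← mul_assoc,
        spanSingleton_mul_spanSingleton, hG, Finset.prod_inv_distrib, mul_inv_cancel₀,
        spanSingleton_one, one_mul]
      exact Finset.prod_ne_zero_iff.mpr fun i _ => hr0 i
    have h4 := congrArg logN h3
    rw [logN_mul h2 (cont_ne_zero_of_leftInv hφ huG),
      logN_extendedHom (cont_ne_zero_of_leftInv hφ hu), hcont] at h4
    have h5 : logN (∏ i, c i) = ∑ i, logN (c i) := logN_prod fun i _ => hc i
    have h6 : logN (spanSingleton (𝓞 k)⁰ (∏ i, r i)) = ∑ i, logN (spanSingleton (𝓞 k)⁰ (r i)) := by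
      rw [← logN_prod fun i _ => h1 i, spanSingleton_prod]
    rw [h5, h6, Finset.mul_sum] at h4
    simp only [hlog] at h4
    linarith
  have h1 := deg_le_of_integral hH hconj hφ hM huG hint hzero
  rw [deg_mul hφ hH huk hG0] at h1
  have h2 : deg φ H (u.map (algebraMap N k)) = finrank N k * deg φ H u := deg_map hφ hu
  have h3 : (0 : ℝ) < finrank N k := by exact_mod_cast finrank_pos
  have h4 : (finrank K k : ℝ) = finrank K N * finrank N k := by
    exact_mod_cast (finrank_mul_finrank K N k).symm
  have h5 : (finrank ℚ k : ℝ) = finrank ℚ K * (finrank K N * finrank N k) := by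
    rw [← h4]
    exact_mod_cast (finrank_mul_finrank ℚ K k).symm
  rw [h2, h4, h5] at h1
  refine le_of_mul_le_mul_left (h1.trans (le_of_eq ?_)) h3
  ring

end AbsoluteSiegel

section TensorLines
open Matrix Module FractionalIdeal
open scoped nonZeroDivisors Kronecker
variable {A B ι κ β : Type} [Fintype A] [Fintype B] [Fintype ι] [Fintype κ] [Fintype β]
variable {K N : Type} [Field K] [NumberField K] [Field N] [NumberField N] [Algebra K N]
variable {φ : Matrix A ι K} {H : (K →+* ℂ) → Matrix ι ι ℂ}
variable {ψ : Matrix B κ K} {H₂ : (K →+* ℂ) → Matrix κ κ ℂ}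

/-- The vector of a tensor product with the given matrix of coordinates. -/
def vecOf {R : Type} (X : Matrix ι κ R) : Matrix (ι × κ) Unit R := Matrix.of fun p _ => X p.1 p.2

theorem kronecker_mul_vecOf {R : Type} [CommRing R] (P : Matrix A ι R) (Q : Matrix B κ R)
    (X : Matrix ι κ R) : P ⊗ₖ Q * vecOf X = vecOf (P * X * Qᵀ) := by
  ext ⟨a, b⟩ ⟨⟩
  simp only [vecOf, Matrix.mul_apply, kroneckerMap_apply, of_apply, Fintype.sum_prod_type,
    transpose_apply, Finset.sum_mul]
  rw [Finset.sum_comm]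
  exact Finset.sum_congr rfl fun j _ => Finset.sum_congr rfl fun i _ => by ring

theorem gramDet_kronecker_vecOf (H : Matrix ι ι ℂ) (H₂ : Matrix κ κ ℂ) (u : Matrix ι β ℂ)
    (w : Matrix κ β ℂ) :
    gramDet (H ⊗ₖ H₂) (vecOf (u * wᵀ)) = (gram H u * (gram H₂ w)ᵀ).trace.re := by
  have h1 : (vecOf (u * wᵀ))ᴴ * vecOf (H * (u * wᵀ) * H₂ᵀ) =
      Matrix.of fun _ _ => ((u * wᵀ)ᴴ * (H * (u * wᵀ) * H₂ᵀ)).trace := by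
    ext i j
    simp only [vecOf, Matrix.mul_apply, Fintype.sum_prod_type, trace, diag_apply, of_apply,
      conjTranspose_apply]
    rw [Finset.sum_comm]
  rw [gramDet, gram, Matrix.mul_assoc, kronecker_mul_vecOf, h1, det_unit, of_apply]
  congr 1
  rw [gram, gram, transpose_mul, transpose_mul, conjTranspose_mul, Matrix.mul_assoc, trace_mul_comm]
  have h2 : wᵀᴴ = wᴴᵀ := rfl
  simp only [Matrix.mul_assoc, h2]

theorem gramDet_mul_gramDet_le [Nonempty β] {H : Matrix ι ι ℂ} (hH : H.PosDef) {H₂ : Matrix κ κ ℂ}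
    (hH₂ : H₂.PosDef) {u : Matrix ι β ℂ} {w : Matrix κ β ℂ} (hu : LeftInv u) (hw : LeftInv w) :
    gramDet H u * gramDet H₂ w ≤
      (gramDet (H ⊗ₖ H₂) (vecOf (u * wᵀ)) / Fintype.card β) ^ Fintype.card β := by
  obtain ⟨T, -, hT⟩ := exists_conjTranspose_mul_self (gram_posDef hH hu)
  have hG := gram_posDef hH₂ hw
  have h1 : (T * (gram H₂ w)ᵀ * Tᴴ).PosSemidef :=
    hG.transpose.posSemidef.mul_mul_conjTranspose_same T
  have h2 := det_le_trace_div_card_pow h1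
  have h3 : 0 = (gram H u).det.im := (Complex.lt_def.1 (gram_posDef hH hu).det_pos).2
  have h4 : (T * (gram H₂ w)ᵀ * Tᴴ).det = (gram H u).det * (gram H₂ w).det := by
    rw [hT, det_mul, det_mul, det_mul, det_transpose]
    ring
  have h5 : (T * (gram H₂ w)ᵀ * Tᴴ).trace = (gram H u * (gram H₂ w)ᵀ).trace := by
    rw [hT, Matrix.trace_mul_comm, Matrix.mul_assoc]
  rw [h4, h5, Complex.mul_re, ← h3, zero_mul, sub_zero] at h2
  rw [gramDet_kronecker_vecOf]
  exact h2

theorem leftInv_vecOf {X : Matrix ι κ N} (hX : X ≠ 0) : LeftInv (vecOf X) := by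
  by_contra h
  refine hX (Matrix.ext fun i j => ?_)
  by_contra hij
  exact h (leftInv_col (b := (i, j)) hij)

theorem card_mul_deg_vecOf_le [Nonempty β] (hφ : LeftInv φ) (hψ : LeftInv ψ)
    (hH : ∀ σ, (H σ).PosDef) (hH₂ : ∀ σ, (H₂ σ).PosDef) {u : Matrix ι β N} {w : Matrix κ β N}
    (hu : LeftInv u) (hw : LeftInv w) (hX : u * wᵀ ≠ 0) :
    Fintype.card β * deg (φ ⊗ₖ ψ) (fun σ => H σ ⊗ₖ H₂ σ) (vecOf (u * wᵀ)) ≤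
      deg φ H u + deg ψ H₂ w -
        Fintype.card β / 2 * (finrank ℚ N * Real.log (Fintype.card β)) := by
  have hx : LeftInv (vecOf (u * wᵀ)) := leftInv_vecOf hX
  have hcard : (0 : ℝ) < Fintype.card β := by exact_mod_cast Fintype.card_pos
  have h1 : cont (φ.map (algebraMap K N) * u) * cont (ψ.map (algebraMap K N) * w) ≤
      cont ((φ ⊗ₖ ψ).map (algebraMap K N) * vecOf (u * wᵀ)) ^ Fintype.card β := by
    refine cont_mul_cont_le _ _ fun i j => ?_
    have h2 : (φ ⊗ₖ ψ).map (algebraMap K N) = φ.map (algebraMap K N) ⊗ₖ ψ.map (algebraMap K N) := by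
      ext ⟨a, b⟩ ⟨c, d⟩
      simp
    have h3 := det_mem_cont ((φ ⊗ₖ ψ).map (algebraMap K N) * vecOf (u * wᵀ)) fun _ => (i, j)
    rw [det_unit] at h3
    convert h3 using 1
    rw [h2, kronecker_mul_vecOf, transpose_mul]
    simp [vecOf, Matrix.mul_assoc]
  have h2 := logN_mono (mul_ne_zero (cont_ne_zero_of_leftInv hφ hu)
    (cont_ne_zero_of_leftInv hψ hw)) h1
  rw [logN_pow, logN_mul (cont_ne_zero_of_leftInv hφ hu) (cont_ne_zero_of_leftInv hψ hw)] at h2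
  have h3 : ∀ σ : N →+* ℂ, Real.log (gramDet (H (σ.comp (algebraMap K N))) (u.map σ)) +
      Real.log (gramDet (H₂ (σ.comp (algebraMap K N))) (w.map σ)) ≤ Fintype.card β *
        (Real.log (gramDet (H (σ.comp (algebraMap K N)) ⊗ₖ H₂ (σ.comp (algebraMap K N)))
          ((vecOf (u * wᵀ)).map σ)) - Real.log (Fintype.card β)) := fun σ => by
    have hu' := gramDet_pos (hH (σ.comp (algebraMap K N))) (hu.map σ)
    have hw' := gramDet_pos (hH₂ (σ.comp (algebraMap K N))) (hw.map σ)
    have hx' := gramDet_pos ((hH (σ.comp (algebraMap K N))).kronecker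
      (hH₂ (σ.comp (algebraMap K N)))) (hx.map σ)
    have h4 := gramDet_mul_gramDet_le (hH (σ.comp (algebraMap K N)))
      (hH₂ (σ.comp (algebraMap K N))) (hu.map σ) (hw.map σ)
    have h5 : vecOf (u.map σ * (w.map σ)ᵀ) = (vecOf (u * wᵀ)).map σ := by
      rw [← transpose_map, ← Matrix.map_mul]
      rfl
    rw [h5] at h4
    have h6 := Real.log_le_log (mul_pos hu' hw') h4
    rwa [Real.log_mul hu'.ne' hw'.ne', Real.log_pow, Real.log_div hx'.ne' hcard.ne'] at h6
  have h4 := Finset.sum_le_sum fun σ (_ : σ ∈ (Finset.univ : Finset (N →+* ℂ))) => h3 σ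
  rw [Finset.sum_add_distrib, ← Finset.mul_sum, Finset.sum_sub_distrib, Finset.sum_const,
    Finset.card_univ, NumberField.Embeddings.card, nsmul_eq_mul] at h4
  rw [deg, deg, deg]
  linarith

theorem leftInv_transpose_of_factor {X : Matrix ι κ N} {u : Matrix ι β N} (hu : LeftInv u)
    {J : Matrix β κ N} {J' : Matrix κ β N} (hJ : X = u * J) (hJ' : u = X * J') : LeftInv Jᵀ := by
  obtain ⟨y, hy⟩ := hu
  have h1 : J * J' = 1 := by
    rw [← Matrix.one_mul (J * J'), ← hy, Matrix.mul_assoc, ← Matrix.mul_assoc _ J, ← hJ, ← hJ']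
  exact ⟨J'ᵀ, by rw [← transpose_mul, h1, transpose_one]⟩

theorem exists_rank_factorization {X : Matrix ι κ N} (hX : X ≠ 0) :
    ∃ (ρ : ℕ) (u : Matrix ι (Fin ρ) N) (w : Matrix κ (Fin ρ) N), 0 < ρ ∧ LeftInv u ∧ LeftInv w ∧
      X = u * wᵀ := by
  have h := colSpan_colBasis (colSpan X)
  obtain ⟨J, hJ⟩ := exists_mul_of_colSpan_le h.ge
  obtain ⟨J', hJ'⟩ := exists_mul_of_colSpan_le h.le
  have hu := colBasis_leftInv (colSpan X)
  refine ⟨_, colBasis (colSpan X), Jᵀ, ?_, hu, leftInv_transpose_of_factor hu hJ hJ', hJ⟩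
  refine Nat.pos_of_ne_zero fun h0 => hX ?_
  rw [hJ]
  ext i j
  rw [Matrix.mul_apply, Finset.sum_eq_zero fun k _ => ?_, Matrix.zero_apply]
  exact absurd k.2 (by omega)

theorem AbsBound.kronecker (hφ : LeftInv φ) (hψ : LeftInv ψ)
    (hH : ∀ σ, (H σ).PosDef) (hH₂ : ∀ σ, (H₂ σ).PosDef)
    (hconj : ∀ σ, H ((starRingEnd ℂ).comp σ) = (H σ).map (starRingEnd ℂ)) {M M₂ : ℝ}
    (hM : AbsBound φ H M)
    (hM₂ : ∀ (N : Type) [Field N] [NumberField N] [Algebra K N] (β : Type) [Fintype β]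
      (w : Matrix κ β N), LeftInv w → deg ψ H₂ w ≤ Fintype.card β * (finrank K N * M₂)) :
    AbsBound (φ ⊗ₖ ψ) (fun σ => H σ ⊗ₖ H₂ σ) (M + M₂) := by
  intro N _ _ _ x hx
  obtain ⟨X, rfl⟩ : ∃ X : Matrix ι κ N, x = vecOf X := ⟨Matrix.of fun i j => x (i, j) (), rfl⟩
  have hX : X ≠ 0 := by
    rintro rfl
    obtain ⟨y, hy⟩ := hx
    have := congrFun₂ hy () ()
    simp [Matrix.mul_apply, vecOf] at this
  obtain ⟨ρ, u, w, hρ, hu, hw, rfl⟩ := exists_rank_factorization hX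
  have : Nonempty (Fin ρ) := ⟨⟨0, hρ⟩⟩
  have h1 := card_mul_deg_vecOf_le hφ hψ hH hH₂ hu hw hX
  have h2 := deg_le_of_absBound hH hconj hφ hM hu
  have h3 := hM₂ N (Fin ρ) w hw
  have h4 : (0 : ℝ) < Fintype.card (Fin ρ) := by exact_mod_cast Fintype.card_pos
  have h5 : (finrank ℚ N : ℝ) = finrank ℚ K * finrank K N := by
    exact_mod_cast (finrank_mul_finrank ℚ K N).symm
  rw [h5] at h1
  refine le_of_mul_le_mul_left ?_ h4
  linarith

end TensorLines

section Index
open Matrix Module FractionalIdeal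
open scoped nonZeroDivisors
variable {β : Type} [Fintype β]
variable {N : Type} [Field N] [NumberField N]

theorem index_range_mulVecLin (M : Matrix β β (𝓞 N)) (hM : M.det ≠ 0) :
    (LinearMap.range M.mulVecLin).toAddSubgroup.index = (Algebra.norm ℤ M.det).natAbs := by
  let f : (β → 𝓞 N) →ₗ[ℤ] (β → 𝓞 N) := M.mulVecLin.restrictScalars ℤ
  have hf : Function.Injective f := mulVec_injective_of_det_ne_zero hM
  have h := Submodule.natAbs_det_equiv (LinearMap.range f) (LinearEquiv.ofInjective f hf)
  have h1 : (LinearMap.range f).subtype ∘ₗ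
      AddMonoidHom.toIntLinearMap (LinearEquiv.ofInjective f hf : (β → 𝓞 N) →+ LinearMap.range f) =
        f := rfl
  rw [h1, LinearMap.det_restrictScalars, ← Matrix.toLin'_apply', LinearMap.det_toLin'] at h
  rw [h]
  rfl

theorem index_pi (I : β → Ideal (𝓞 N)) :
    (Submodule.pi Set.univ I : Submodule (𝓞 N) (β → 𝓞 N)).toAddSubgroup.index =
      ∏ i, Ideal.absNorm (I i) := by
  have h := Nat.card_congr (Submodule.quotientPi I).toEquiv
  rw [Nat.card_pi] at h
  exact h

/-- The lattice of integral coordinate vectors. -/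
def intLattice (β N : Type) [Field N] [NumberField N] : Submodule (𝓞 N) (β → N) where
  carrier := {w | ∀ i, ∃ t : 𝓞 N, algebraMap (𝓞 N) N t = w i}
  add_mem' {a b} ha hb i := by
    obtain ⟨t, ht⟩ := ha i
    obtain ⟨u, hu⟩ := hb i
    exact ⟨t + u, by rw [map_add, ht, hu, Pi.add_apply]⟩
  zero_mem' i := ⟨0, map_zero _⟩
  smul_mem' c a ha i := by
    obtain ⟨t, ht⟩ := ha i
    exact ⟨c * t, by rw [map_mul, ht, Pi.smul_apply, Algebra.smul_def]⟩

/-- The lattice of vectors `w` with `h w` in the product of the fractional ideals `d i`. -/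
def prodLattice (h : Matrix β β N) (d : β → FractionalIdeal (𝓞 N)⁰ N) :
    Submodule (𝓞 N) (β → N) where
  carrier := {w | ∀ i, (h *ᵥ w) i ∈ d i}
  add_mem' {a b} ha hb i := by
    rw [mulVec_add]
    exact (d i : Submodule (𝓞 N) N).add_mem (ha i) (hb i)
  zero_mem' i := by
    rw [mulVec_zero]
    exact (d i : Submodule (𝓞 N) N).zero_mem
  smul_mem' c a ha i := by
    rw [mulVec_smul]
    exact (d i : Submodule (𝓞 N) N).smul_mem c (ha i)

/-- A common denominator. -/
theorem exists_common_denominator (h : Matrix β β N) (d : β → FractionalIdeal (𝓞 N)⁰ N) :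
    ∃ D : 𝓞 N, D ≠ 0 ∧ (∃ M : Matrix β β (𝓞 N), M.map (algebraMap (𝓞 N) N) =
      algebraMap (𝓞 N) N D • h) ∧
      ∀ i, ∃ I : Ideal (𝓞 N), (I : FractionalIdeal (𝓞 N)⁰ N) =
        spanSingleton (𝓞 N)⁰ (algebraMap (𝓞 N) N D) * d i := by
  obtain ⟨a, ha⟩ := IsLocalization.exist_integer_multiples_of_finite (𝓞 N)⁰
    fun p : β × β => h p.1 p.2
  choose t ht using ha
  refine ⟨a * ∏ i, ((d i).den : 𝓞 N), ?_, ?_, fun i => ?_⟩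
  · exact mul_ne_zero (nonZeroDivisors.coe_ne_zero a)
      (Finset.prod_ne_zero_iff.2 fun i _ => nonZeroDivisors.coe_ne_zero _)
  · refine ⟨Matrix.of fun i j => t (i, j) * ∏ i, ((d i).den : 𝓞 N), ?_⟩
    ext i j
    have := ht (i, j)
    rw [Algebra.smul_def] at this
    rw [map_apply, of_apply, map_mul, this, Matrix.smul_apply, map_mul, smul_eq_mul]
    ring
  · rw [← Finset.mul_prod_erase _ _ (Finset.mem_univ i)]
    refine ⟨Ideal.span {(a : 𝓞 N) * ∏ j ∈ Finset.univ.erase i, ((d j).den : 𝓞 N)} * (d i).num, ?_⟩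
    have h1 := den_mul_self_eq_num' (𝓞 N)⁰ N (d i)
    rw [coeIdeal_mul, coeIdeal_span_singleton, ← h1, ← mul_assoc, spanSingleton_mul_spanSingleton,
      ← map_mul]
    congr 3
    ring

theorem log_relIndex {h : Matrix β β N} (hdet : h.det = 1)
    {d : β → FractionalIdeal (𝓞 N)⁰ N} (hd : ∀ i, d i ≠ 0)
    (hO : intLattice β N ≤ prodLattice h d) :
    (intLattice β N).toAddSubgroup.relIndex (prodLattice h d).toAddSubgroup ≠ 0 ∧
    Real.log ((intLattice β N).toAddSubgroup.relIndex (prodLattice h d).toAddSubgroup) =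
      -∑ i, logN (d i) := by
  obtain ⟨D, hD, ⟨M, hM⟩, hI⟩ := exists_common_denominator h d
  choose I hI using hI
  have hD' : algebraMap (𝓞 N) N D ≠ 0 := by simpa using hD
  have hMdet : M.det = D ^ Fintype.card β := by
    apply FaithfulSMul.algebraMap_injective (𝓞 N) N
    rw [RingHom.map_det, RingHom.mapMatrix_apply, hM, det_smul, hdet, mul_one, map_pow]
  let f : (β → N) →+ (β → N) := (M.map (algebraMap (𝓞 N) N)).mulVecLin.toAddMonoidHom
  have hf : Function.Injective f := by
    refine mulVec_injective_of_det_ne_zero ?_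
    rw [hM, det_smul, hdet, mul_one]
    exact pow_ne_zero _ hD'
  let c : (β → 𝓞 N) →+ (β → N) :=
    { toFun := fun v i => algebraMap (𝓞 N) N (v i)
      map_zero' := funext fun i => map_zero _
      map_add' := fun v w => funext fun i => map_add _ _ _ }
  have hc : Function.Injective c := fun v w hvw => funext fun i =>
    FaithfulSMul.algebraMap_injective (𝓞 N) N (congrFun hvw i)
  have h1 : (intLattice β N).toAddSubgroup = (⊤ : AddSubgroup (β → 𝓞 N)).map c := by
    ext w
    constructor
    · intro hw
      choose t ht using hw
      exact ⟨t, trivial, funext ht⟩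
    · rintro ⟨t, -, rfl⟩ i
      exact ⟨t i, rfl⟩
  have h2 : (intLattice β N).toAddSubgroup.map f =
      (LinearMap.range M.mulVecLin).toAddSubgroup.map c := by
    have h3 : ∀ t, f (c t) = c (M *ᵥ t) := fun t => funext fun i => by
      change (M.map (algebraMap (𝓞 N) N) *ᵥ (algebraMap (𝓞 N) N ∘ t)) i = _
      exact (RingHom.map_mulVec (algebraMap (𝓞 N) N) M t i).symm
    rw [h1, AddSubgroup.map_map]
    ext w
    constructor
    · rintro ⟨t, -, rfl⟩
      exact ⟨M *ᵥ t, ⟨t, rfl⟩, (h3 t).symm⟩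
    · rintro ⟨_, ⟨t, rfl⟩, rfl⟩
      exact ⟨t, trivial, h3 t⟩
  have h3 : (prodLattice h d).toAddSubgroup.map f =
      (Submodule.pi Set.univ I : Submodule (𝓞 N) (β → 𝓞 N)).toAddSubgroup.map c := by
    have hf' : ∀ w, f w = algebraMap (𝓞 N) N D • (h *ᵥ w) := fun w => by
      change M.map (algebraMap (𝓞 N) N) *ᵥ w = _
      rw [hM, smul_mulVec]
    have key : ∀ i y, (∃ t ∈ I i, algebraMap (𝓞 N) N t = algebraMap (𝓞 N) N D * y) ↔ y ∈ d i := by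
      intro i y
      rw [← mem_coeIdeal (𝓞 N)⁰, hI, mem_singleton_mul]
      constructor
      · rintro ⟨z, hz, h⟩
        rwa [mul_left_cancel₀ hD' h]
      · exact fun hy => ⟨y, hy, rfl⟩
    ext w
    constructor
    · rintro ⟨v, hv, rfl⟩
      choose t ht ht' using fun i => (key i _).2 (hv i)
      exact ⟨t, fun i _ => ht i, by rw [hf']; exact funext ht'⟩
    · rintro ⟨t, ht, rfl⟩
      have hu : IsUnit h.det := by simp [hdet]
      refine ⟨h⁻¹ *ᵥ ((algebraMap (𝓞 N) N D)⁻¹ • c t), fun i => ?_, ?_⟩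
      · rw [mulVec_mulVec, mul_nonsing_inv _ hu, one_mulVec]
        refine (key i _).1 ⟨t i, ht i trivial, ?_⟩
        rw [Pi.smul_apply, smul_eq_mul, mul_inv_cancel_left₀ hD']
        rfl
      · rw [hf', mulVec_mulVec, mul_nonsing_inv _ hu, one_mulVec, smul_smul, mul_inv_cancel₀ hD',
          one_smul]
  have h4 : (intLattice β N).toAddSubgroup.relIndex (prodLattice h d).toAddSubgroup *
      ∏ i, Ideal.absNorm (I i) = (Algebra.norm ℤ M.det).natAbs := by
    have hle : (LinearMap.range M.mulVecLin).toAddSubgroup ≤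
        (Submodule.pi Set.univ I : Submodule (𝓞 N) (β → 𝓞 N)).toAddSubgroup := by
      rw [← AddSubgroup.map_le_map_iff_of_injective hc, ← h2, ← h3]
      exact AddSubgroup.map_mono hO
    rw [← AddSubgroup.relIndex_map_map_of_injective _ _ hf, h2, h3,
      AddSubgroup.relIndex_map_map_of_injective _ _ hc, ← index_pi,
      AddSubgroup.relIndex_mul_index hle, index_range_mulVecLin M]
    rw [hMdet]
    exact pow_ne_zero _ hD
  have h5 : (Algebra.norm ℤ M.det).natAbs = Ideal.absNorm (Ideal.span {D}) ^ Fintype.card β := by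
    rw [hMdet, map_pow, Int.natAbs_pow, Ideal.absNorm_span_singleton]
  have h6 : Ideal.absNorm (Ideal.span {D}) ≠ 0 := by
    rw [Ne, Ideal.absNorm_eq_zero_iff]
    simpa using hD
  have h7 := h5 ▸ pow_ne_zero (Fintype.card β) h6
  rw [← h4] at h7
  obtain ⟨h8, h9⟩ := mul_ne_zero_iff.1 h7
  refine ⟨h8, ?_⟩
  have h10 := congrArg (fun n : ℕ => Real.log (n : ℝ)) (h4.trans h5)
  have h11 : ∀ i, Real.log (Ideal.absNorm (I i)) =
      Real.log (Ideal.absNorm (Ideal.span {D})) + logN (d i) := fun i => by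
    rw [← logN_coeIdeal, ← logN_coeIdeal, hI, coeIdeal_span_singleton, logN_mul _ (hd i)]
    rwa [Ne, spanSingleton_eq_zero_iff]
  simp only [Nat.cast_mul, Nat.cast_prod, Nat.cast_pow, Real.log_pow] at h10
  rw [Real.log_mul (by exact_mod_cast h8) (by exact_mod_cast h9), Real.log_prod
    (fun i _ => by exact_mod_cast (Finset.prod_ne_zero_iff.1 h9) i (Finset.mem_univ i)),
    Finset.sum_congr rfl fun i _ => h11 i, Finset.sum_add_distrib, Finset.sum_const,
    Finset.card_univ, nsmul_eq_mul] at h10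
  linarith

end Index

section DualLattice
open Matrix Module FractionalIdeal
open scoped nonZeroDivisors
variable {A ι β : Type} [Fintype A] [Fintype ι] [Fintype β]
variable {K : Type} [Field K] [NumberField K]
variable {φ : Matrix A ι K} {H : (K →+* ℂ) → Matrix ι ι ℂ}

/-- The lattice on which the rows of `φ` take integral values. -/
def latOf (φ : Matrix A ι K) : Submodule (𝓞 K) (ι → K) :=
  (intLattice A K).comap (φ.mulVecLin.restrictScalars (𝓞 K))

theorem mem_latOf {v : ι → K} :
    v ∈ latOf φ ↔ ∀ a, ∃ t : 𝓞 K, algebraMap (𝓞 K) K t = (φ *ᵥ v) a := Iff.rfl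

theorem mem_one_iff_exists {x : K} :
    x ∈ (1 : FractionalIdeal (𝓞 K)⁰ K) ↔ ∃ t : 𝓞 K, algebraMap (𝓞 K) K t = x :=
  mem_one_iff _

theorem mem_latOf_iff_forall_span {v : ι → K} :
    v ∈ latOf φ ↔ ∀ y ∈ Submodule.span (𝓞 K) (Set.range φ),
      y ⬝ᵥ v ∈ (1 : FractionalIdeal (𝓞 K)⁰ K) := by
  simp only [mem_latOf, ← mem_one_iff_exists]
  constructor
  · intro h y hy
    induction hy using Submodule.span_induction with
    | mem y hy =>
      obtain ⟨a, rfl⟩ := hy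
      exact h a
    | zero =>
      rw [zero_dotProduct]
      exact (1 : FractionalIdeal (𝓞 K)⁰ K).coeToSubmodule.zero_mem
    | add y z _ _ hy hz =>
      rw [add_dotProduct]
      exact (1 : FractionalIdeal (𝓞 K)⁰ K).coeToSubmodule.add_mem hy hz
    | smul c y _ hy =>
      rw [smul_dotProduct]
      exact (1 : FractionalIdeal (𝓞 K)⁰ K).coeToSubmodule.smul_mem c hy
  · exact fun h a => h (φ a) (Submodule.subset_span ⟨a, rfl⟩)

theorem exists_latOf_eq_prodLattice {P : Matrix A β K} (hP : LeftInv P) :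
    ∃ (h : Matrix β β K) (d : β → FractionalIdeal (𝓞 K)⁰ K), h.det = 1 ∧ (∀ i, d i ≠ 0) ∧
      latOf P = prodLattice h d ∧ -∑ i, logN (d i) = logN (cont P) := by
  obtain ⟨g, c, hg, hc, h⟩ := exists_pseudoBasis_span_range hP
  have hu : IsUnit g.det := by simp [hg]
  have hinv : ∀ i, logN (c i)⁻¹ = -logN (c i) := fun i => by
    have := logN_mul (hc i) (inv_ne_zero (hc i))
    rw [mul_inv_cancel₀ (hc i), logN_one] at this
    linarith
  refine ⟨(g⁻¹)ᵀ, fun i => (c i)⁻¹, ?_, fun i => inv_ne_zero (hc i), ?_, ?_⟩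
  · rw [det_transpose, det_nonsing_inv, hg, Ring.inverse_one]
  · ext w
    rw [mem_latOf_iff_forall_span]
    have key : (∀ y ∈ Submodule.span (𝓞 K) (Set.range P), y ⬝ᵥ w ∈
        (1 : FractionalIdeal (𝓞 K)⁰ K)) ↔ ∀ u : β → K, (∀ i, u i ∈ c i) →
          u ⬝ᵥ ((g⁻¹)ᵀ *ᵥ w) ∈ (1 : FractionalIdeal (𝓞 K)⁰ K) := by
      constructor
      · intro hw u hcu
        have h1 := hw (g⁻¹ *ᵥ u) ((h _).2 fun i => by
          rw [mulVec_mulVec, mul_nonsing_inv _ hu, one_mulVec]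
          exact hcu i)
        rwa [mulVec_transpose, dotProduct_comm, ← dotProduct_mulVec, dotProduct_comm]
      · intro hw y hy
        have h1 := hw (g *ᵥ y) ((h y).1 hy)
        rwa [mulVec_transpose, dotProduct_comm, ← dotProduct_mulVec, mulVec_mulVec,
          nonsing_inv_mul _ hu, one_mulVec, dotProduct_comm] at h1
    rw [key]
    constructor
    · intro hw i
      refine (mem_inv_iff (hc i)).2 fun y hy => ?_
      have := hw (Pi.single i y) fun j => by
        by_cases hj : j = i
        · subst hj
          rwa [Pi.single_eq_same]
        · rw [Pi.single_eq_of_ne hj]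
          exact (c j).coeToSubmodule.zero_mem
      rwa [single_dotProduct, mul_comm] at this
    · intro hw u hcu
      refine (1 : FractionalIdeal (𝓞 K)⁰ K).coeToSubmodule.sum_mem fun i _ => ?_
      rw [mul_comm]
      exact (mem_inv_iff (hc i)).1 (hw i) _ (hcu i)
  · rw [cont_eq_prod P hg h, logN_prod fun i _ => hc i]
    simp [hinv]

theorem exists_smul_mem_latOf (v : ι → K) : ∃ d : 𝓞 K, d ≠ 0 ∧ d • v ∈ latOf φ := by
  obtain ⟨a, ha⟩ := IsLocalization.exist_integer_multiples_of_finite (𝓞 K)⁰ (φ *ᵥ v)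
  refine ⟨a, nonZeroDivisors.coe_ne_zero a, fun i => ?_⟩
  obtain ⟨t, ht⟩ := ha i
  refine ⟨t, ht.trans ?_⟩
  exact (congrFun ((φ.mulVecLin.restrictScalars (𝓞 K)).map_smul (a : 𝓞 K) v) i).symm

theorem exists_eq_latOf {s : ℕ} {E : Submodule (𝓞 K) (Fin s → K)} (hfg : E.FG)
    (hfull : Submodule.span K (E : Set (Fin s → K)) = ⊤) :
    ∃ (A : Type) (_ : Fintype A) (φ : Matrix A (Fin s) K), LeftInv φ ∧ E = latOf φ := by
  obtain ⟨g, c, hg, hc, h⟩ := exists_pseudoBasis hfg fun v =>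
    exists_smul_mem_of_le (hfull ▸ Submodule.mem_top)
  have h1 : ∀ i, ∃ (n : ℕ) (γ : Fin n → K), Submodule.span (𝓞 K) (Set.range γ) =
      ((c i)⁻¹).coeToSubmodule := fun i =>
    Submodule.fg_iff_exists_fin_generating_family.1 (fg_of_isNoetherianRing le_rfl _)
  choose n γ hγ using h1
  let φ : Matrix (Σ i, Fin (n i)) (Fin s) K := Matrix.of fun p j => γ p.1 p.2 * g p.1 j
  have hφ : ∀ v p, (φ *ᵥ v) p = γ p.1 p.2 * (g *ᵥ v) p.1 := fun v p => by
    simp only [φ, mulVec, dotProduct, of_apply, Finset.mul_sum, mul_assoc]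
  refine ⟨_, inferInstance, φ, leftInv_of_injective ?_, ?_⟩
  · intro v w hvw
    refine mulVec_injective_of_det_ne_zero (M := g) (by simp [hg]) (funext fun i => ?_)
    obtain ⟨k, hk⟩ : ∃ k, γ i k ≠ 0 := by
      by_contra! h0
      refine inv_ne_zero (hc i) (coeToSubmodule_eq_bot.1 ?_)
      rw [← hγ, Submodule.span_eq_bot]
      rintro _ ⟨k, rfl⟩
      exact h0 k
    have := congrFun hvw ⟨i, k⟩
    rw [hφ, hφ] at this
    exact mul_left_cancel₀ hk this
  · ext v
    rw [h, mem_latOf]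
    simp only [hφ, ← mem_one_iff_exists]
    constructor
    · intro hv p
      have h2 : γ p.1 p.2 ∈ ((c p.1)⁻¹).coeToSubmodule := hγ p.1 ▸ Submodule.subset_span ⟨p.2, rfl⟩
      exact (mem_inv_iff (hc _)).1 h2 _ (hv _)
    · intro hv i
      rw [← inv_inv (c i)]
      refine (mem_inv_iff (inv_ne_zero (hc i))).2 fun y hy => ?_
      change y ∈ ((c i)⁻¹).coeToSubmodule at hy
      rw [← hγ] at hy
      induction hy using Submodule.span_induction with
      | mem y hy =>
        obtain ⟨k, rfl⟩ := hy
        rw [mul_comm]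
        exact hv ⟨i, k⟩
      | zero =>
        rw [mul_zero]
        exact (1 : FractionalIdeal (𝓞 K)⁰ K).coeToSubmodule.zero_mem
      | add y z _ _ hy hz =>
        rw [mul_add]
        exact (1 : FractionalIdeal (𝓞 K)⁰ K).coeToSubmodule.add_mem hy hz
      | smul c y _ hy =>
        rw [mul_smul_comm]
        exact (1 : FractionalIdeal (𝓞 K)⁰ K).coeToSubmodule.smul_mem c hy

end DualLattice

section Slopes
open Matrix Module FractionalIdeal
open scoped nonZeroDivisors
variable {A ι β : Type} [Fintype A] [Fintype ι] [Fintype β]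
variable {K : Type} [Field K] [NumberField K]
variable {φ : Matrix A ι K} {H : (K →+* ℂ) → Matrix ι ι ℂ}

theorem log_relIndex_latOf {P : Matrix A β K} (hP : LeftInv P)
    (hO : intLattice β K ≤ latOf P) :
    (intLattice β K).toAddSubgroup.relIndex (latOf P).toAddSubgroup ≠ 0 ∧
    Real.log ((intLattice β K).toAddSubgroup.relIndex (latOf P).toAddSubgroup) =
      logN (cont P) := by
  obtain ⟨h, d, hdet, hd, he, hs⟩ := exists_latOf_eq_prodLattice hP
  rw [he] at hO ⊢
  rw [← hs]
  exact log_relIndex hdet hd hO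

theorem range_transpose_eq_map (x : Matrix ι β K) : Submodule.span (𝓞 K) (Set.range xᵀ) =
    (intLattice β K).map (x.mulVecLin.restrictScalars (𝓞 K)) := by
  apply le_antisymm
  · rw [Submodule.span_le]
    rintro _ ⟨b, rfl⟩
    refine ⟨Pi.single b 1, fun i => ?_, ?_⟩
    · by_cases h : i = b
      · subst h
        exact ⟨1, by rw [map_one, Pi.single_eq_same]⟩
      · exact ⟨0, by rw [map_zero, Pi.single_eq_of_ne h]⟩
    · exact mulVec_single_one x b
  · rintro _ ⟨w, hw, rfl⟩
    choose t ht using hw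
    have : x *ᵥ w = ∑ b, t b • xᵀ b := by
      ext i
      rw [Finset.sum_apply]
      refine Finset.sum_congr rfl fun b _ => ?_
      rw [Pi.smul_apply, Algebra.smul_def, ht, mul_comm]
      rfl
    change x *ᵥ w ∈ _
    rw [this]
    exact Submodule.sum_mem _ fun b _ => Submodule.smul_mem _ _ (Submodule.subset_span ⟨b, rfl⟩)

theorem log_card_quotient {x : Matrix ι β K} (hφ : LeftInv φ) (hx : LeftInv x)
    {F : Submodule (𝓞 K) (ι → K)} (hxF : ∀ b, xᵀ b ∈ F) (hF : F ≤ latOf φ)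
    (hFx : ∀ y ∈ F, y ∈ colSpan x) :
    Real.log (Nat.card (↥F ⧸ Submodule.comap F.subtype
      (Submodule.span (𝓞 K) (Set.range xᵀ)))) ≤ logN (cont (φ * x)) ∧
    ((∀ y ∈ latOf φ, y ∈ colSpan x → y ∈ F) →
      Real.log (Nat.card (↥F ⧸ Submodule.comap F.subtype
        (Submodule.span (𝓞 K) (Set.range xᵀ)))) = logN (cont (φ * x))) := by
  let f : (β → K) →ₗ[𝓞 K] (ι → K) := x.mulVecLin.restrictScalars (𝓞 K)
  have hf : Function.Injective f := hx.mulVec_injective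
  have hO : intLattice β K ≤ F.comap f := by
    rw [← Submodule.map_le_iff_le_comap, ← range_transpose_eq_map, Submodule.span_le]
    rintro _ ⟨b, rfl⟩
    exact hxF b
  have hlat : (latOf φ).comap f = latOf (φ * x) := by
    ext w
    change φ *ᵥ (x *ᵥ w) ∈ intLattice A K ↔ (φ * x) *ᵥ w ∈ intLattice A K
    rw [mulVec_mulVec]
  have hle : F.comap f ≤ latOf (φ * x) := hlat ▸ Submodule.comap_mono hF
  obtain ⟨h1, h2⟩ := log_relIndex_latOf (hφ.mul hx) (hO.trans hle)
  have h3 : Nat.card (↥F ⧸ Submodule.comap F.subtype (Submodule.span (𝓞 K) (Set.range xᵀ))) =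
      (intLattice β K).toAddSubgroup.relIndex (F.comap f).toAddSubgroup := by
    have h4 : ((F.comap f).map f) = F := by
      refine le_antisymm (Submodule.map_comap_le _ _) fun y hy => ?_
      obtain ⟨w, rfl⟩ := hFx y hy
      exact ⟨w, hy, rfl⟩
    have h5 := AddSubgroup.relIndex_map_map_of_injective (f := f.toAddMonoidHom)
      (intLattice β K).toAddSubgroup (F.comap f).toAddSubgroup hf
    rw [← h5, range_transpose_eq_map]
    have h6 : (F.comap f).toAddSubgroup.map f.toAddMonoidHom = F.toAddSubgroup :=
      congrArg Submodule.toAddSubgroup h4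
    rw [h6]
    rfl
  rw [h3, ← h2]
  constructor
  · have h4 := AddSubgroup.relIndex_le_of_le_right (H := (intLattice β K).toAddSubgroup)
      (K := (F.comap f).toAddSubgroup) (L := (latOf (φ * x)).toAddSubgroup) hle h1
    have h5 : (intLattice β K).toAddSubgroup.relIndex (F.comap f).toAddSubgroup ≠ 0 := fun h0 =>
      h1 (AddSubgroup.relIndex_eq_zero_of_le_right hle h0)
    refine Real.log_le_log (by exact_mod_cast Nat.pos_of_ne_zero h5) (by exact_mod_cast h4)
  · intro h
    have h6 : F.comap f = latOf (φ * x) := by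
      refine le_antisymm hle (hlat ▸ fun w hw => h _ hw ⟨w, rfl⟩)
    rw [h6]

theorem eForm_eq_gram {σ : K →+* ℂ} (M : Matrix ι ι ℂ) (x : Matrix ι β K) (a b : β) :
    eForm M σ (xᵀ a) (xᵀ b) = gram M (x.map σ) a b := by
  simp only [eForm, cForm, gram, Matrix.mul_apply, conjTranspose_apply, map_apply, transpose_apply,
    Finset.sum_mul]
  rw [Finset.sum_comm]
  rfl

theorem log_sqrt_eForm {M : Matrix ι ι ℂ} (hM : M.PosDef) (σ : K →+* ℂ) {x : Matrix ι β K}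
    (hx : LeftInv x) {d : DecidableEq β} :
    Real.log (Real.sqrt (Matrix.of fun a b => eForm M σ (xᵀ a) (xᵀ b)).det.re) =
      Real.log (gramDet M (x.map σ)) / 2 := by
  obtain rfl : d = fun a b => Classical.propDecidable (a = b) := Subsingleton.elim _ _
  have : (Matrix.of fun a b => eForm M σ (xᵀ a) (xᵀ b)) = gram M (x.map σ) :=
    Matrix.ext fun a b => eForm_eq_gram M x a b
  rw [this]
  exact Real.log_sqrt (gramDet_pos hM (hx.map σ)).le

theorem deg_self (x : Matrix ι β K) : deg φ H x = logN (cont (φ * x)) -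
    (∑ σ : K →+* ℂ, Real.log (gramDet (H σ) (x.map σ))) / 2 := by
  have h : φ.map (algebraMap K K) = φ := Matrix.ext fun _ _ => rfl
  rw [deg, h]
  rfl

theorem colSpan_eq_span (x : Matrix ι β K) : colSpan x = Submodule.span K (Set.range xᵀ) :=
  Matrix.range_mulVecLin x

theorem degree_of_basis (hφ : LeftInv φ) (hH : ∀ σ, (H σ).PosDef)
    {F : Submodule (𝓞 K) (ι → K)} (hF : F ≤ latOf φ) {s : ℕ} {p : Fin s → ι → K}
    (hmem : ∀ a, p a ∈ F) (hli : LinearIndependent K p)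
    (hspan : ∀ y ∈ F, y ∈ Submodule.span K (Set.range p)) :
    Real.log (Nat.card (↥F ⧸ Submodule.comap F.subtype (Submodule.span (𝓞 K) (Set.range p)))) -
        ∑ᶠ σ : K →+* ℂ, Real.log (Real.sqrt
          ((Matrix.of fun a b => eForm (H σ) σ (p a) (p b)).det.re)) ≤
      degS φ H (Submodule.span K (F : Set (ι → K))) ∧
    ((∀ y ∈ latOf φ, y ∈ Submodule.span K (F : Set (ι → K)) → y ∈ F) →
      Real.log (Nat.card (↥F ⧸ Submodule.comap F.subtype (Submodule.span (𝓞 K) (Set.range p)))) -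
        ∑ᶠ σ : K →+* ℂ, Real.log (Real.sqrt
          ((Matrix.of fun a b => eForm (H σ) σ (p a) (p b)).det.re)) =
      degS φ H (Submodule.span K (F : Set (ι → K)))) := by
  let x : Matrix ι (Fin s) K := (Matrix.of p)ᵀ
  have hx : LeftInv x := leftInv_of_injective (mulVec_injective_iff.2 hli)
  have hcol : colSpan x = Submodule.span K (F : Set (ι → K)) := by
    rw [colSpan_eq_span]
    refine le_antisymm (Submodule.span_mono ?_) (Submodule.span_le.2 hspan)
    rintro _ ⟨a, rfl⟩
    exact hmem a
  have h1 := log_card_quotient hφ hx (F := F) hmem hF fun y hy =>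
    hcol ▸ Submodule.subset_span hy
  have h2 : ∑ᶠ σ : K →+* ℂ, Real.log (Real.sqrt
      ((Matrix.of fun a b => eForm (H σ) σ (p a) (p b)).det.re)) =
        (∑ σ : K →+* ℂ, Real.log (gramDet (H σ) (x.map σ))) / 2 := by
    rw [finsum_eq_sum_of_fintype, Finset.sum_div]
    exact Finset.sum_congr rfl fun σ _ => log_sqrt_eForm (hH σ) σ hx
  rw [← deg_congr hφ hH hx hcol, deg_self, h2, ← hcol]
  exact ⟨sub_le_sub_right h1.1 _, fun h => congrArg (· - _) (h1.2 h)⟩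

theorem hDeg_le_degS (hφ : LeftInv φ) (hH : ∀ σ, (H σ).PosDef) {F : Submodule (𝓞 K) (ι → K)}
    (hF0 : F ≠ ⊥) (hF : F ≤ latOf φ) :
    hDeg K H F ≤ degS φ H (Submodule.span K (F : Set (ι → K))) ∧
    ((∀ y ∈ latOf φ, y ∈ Submodule.span K (F : Set (ι → K)) → y ∈ F) →
      hDeg K H F = degS φ H (Submodule.span K (F : Set (ι → K)))) := by
  have h : ∃ p : (s : ℕ) × (Fin s → ι → K), 0 < p.1 ∧ (∀ a, p.2 a ∈ F) ∧
      LinearIndependent K p.2 ∧ ∀ y ∈ F, y ∈ Submodule.span K (Set.range p.2) := by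
    obtain ⟨b, hb, hb', hli⟩ := exists_linearIndependent K (F : Set (ι → K))
    have : Fintype b := hli.setFinite.fintype
    let e := (Fintype.equivFin b).symm
    have hr : Set.range (fun a => (e a : ι → K)) = b := by
      exact (e.surjective.range_comp fun z : b => (z : ι → K)).trans Subtype.range_coe
    refine ⟨⟨Fintype.card b, fun a => (e a : ι → K)⟩, ?_, fun a => hb (e a).2,
      hli.comp _ e.injective, fun y hy => ?_⟩
    · refine Fintype.card_pos_iff.2 ?_
      by_contra hne
      rw [not_nonempty_iff, Set.isEmpty_coe_sort] at hne
      refine hF0 ((Submodule.eq_bot_iff _).2 fun y hy => ?_)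
      have hy' := Submodule.subset_span (R := K) hy
      rwa [← hb', hne, Submodule.span_empty] at hy'
    · change y ∈ Submodule.span K (Set.range fun a => (e a : ι → K))
      rw [hr, hb']
      exact Submodule.subset_span hy
  rw [hDeg, dif_pos h]
  obtain ⟨hpos, hmem, hli, hspan⟩ := h.choose_spec
  exact degree_of_basis hφ hH hF hmem hli hspan

end Slopes

section MaxSlope
open Matrix Module
variable {A ι β : Type} [Fintype A] [Fintype ι] [Fintype β]
variable {K : Type} [Field K] [NumberField K]
variable {φ : Matrix A ι K} {H : (K →+* ℂ) → Matrix ι ι ℂ}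

theorem hRank_pos {F : Submodule (𝓞 K) (ι → K)} (hF : F ≠ ⊥) : 0 < hRank K F := by
  rw [hRank, finrank_pos_iff, Submodule.nontrivial_iff_ne_bot]
  intro h
  refine hF ((Submodule.eq_bot_iff _).2 fun y hy => ?_)
  have hy' := Submodule.subset_span (R := K) (SetLike.mem_coe.2 hy)
  rwa [h] at hy'

theorem hMu_le (hφ : LeftInv φ) (hH : ∀ σ, (H σ).PosDef) {F : Submodule (𝓞 K) (ι → K)}
    (hF0 : F ≠ ⊥) (hF : F ≤ latOf φ) : ∃ (s : ℕ) (x : Matrix ι (Fin s) K), 0 < s ∧ LeftInv x ∧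
      hMu K H F ≤ deg φ H x / s := by
  refine ⟨_, colBasis (Submodule.span K (F : Set (ι → K))), hRank_pos hF0, colBasis_leftInv _, ?_⟩
  exact div_le_div_of_nonneg_right (hDeg_le_degS hφ hH hF0 hF).1 (Nat.cast_nonneg _)

theorem bddAbove_hMu (hφ : LeftInv φ) (hH : ∀ σ, (H σ).PosDef) :
    BddAbove {m : ℝ | ∃ F : Submodule (𝓞 K) (ι → K), F ≠ ⊥ ∧ F ≤ latOf φ ∧ m = hMu K H F} := by
  obtain ⟨C, hC⟩ := exists_deg_le K hφ hH
  refine ⟨max C 0, ?_⟩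
  rintro _ ⟨F, hF0, hF, rfl⟩
  obtain ⟨s, x, hs, hx, h⟩ := hMu_le hφ hH hF0 hF
  have hs' : (1 : ℝ) ≤ s := by exact_mod_cast hs
  refine h.trans ((div_le_iff₀ (by positivity)).2 ?_)
  refine (hC (Fin s) x hx).trans ((le_max_left C 0).trans ?_)
  exact le_mul_of_one_le_right (le_max_right _ _) hs'

theorem deg_le_card_mul_hMuMax (hφ : LeftInv φ) (hH : ∀ σ, (H σ).PosDef) (s : ℕ)
    (x : Matrix ι (Fin s) K) (hx : LeftInv x) :
    deg φ H x ≤ s * hMuMax K H (latOf φ) := by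
  have hcard : finrank K (colSpan x) = s := by rw [finrank_colSpan hx, Fintype.card_fin]
  rw [deg_eq_degS hφ hH hx]
  rcases Nat.eq_zero_or_pos s with rfl | hs
  · rw [Submodule.finrank_eq_zero.1 hcard, degS_bot]
    simp
  let F : Submodule (𝓞 K) (ι → K) := latOf φ ⊓ (colSpan x).restrictScalars (𝓞 K)
  have hspan : Submodule.span K (F : Set (ι → K)) = colSpan x := by
    refine le_antisymm (Submodule.span_le.2 fun y hy => hy.2) fun y hy => ?_
    obtain ⟨d, hd, hdy⟩ := exists_smul_mem_latOf (φ := φ) y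
    have h1 : d • y ∈ F := ⟨hdy, ((colSpan x).restrictScalars (𝓞 K)).smul_mem d hy⟩
    have hd' : algebraMap (𝓞 K) K d ≠ 0 := by simpa using hd
    have h2 := (Submodule.span K (F : Set (ι → K))).smul_mem (algebraMap (𝓞 K) K d)⁻¹
      (Submodule.subset_span h1)
    rwa [← algebraMap_smul K d y, smul_smul, inv_mul_cancel₀ hd', one_smul] at h2
  have hF0 : F ≠ ⊥ := by
    intro h
    rw [h, Submodule.bot_coe, Submodule.span_zero_singleton] at hspan
    rw [← hspan, finrank_bot] at hcard
    omega
  have h1 : hDeg K H F = degS φ H (colSpan x) := by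
    rw [← hspan]
    exact (hDeg_le_degS hφ hH hF0 inf_le_left).2 fun y hy hy' => ⟨hy, hspan.le hy'⟩
  have h2 : hMu K H F ≤ hMuMax K H (latOf φ) :=
    le_csSup (bddAbove_hMu hφ hH) ⟨F, hF0, inf_le_left, rfl⟩
  rw [hMu, hRank, hspan, hcard, h1, div_le_iff₀ (by exact_mod_cast hs)] at h2
  rwa [mul_comm]

end MaxSlope

section Reindex
open Matrix Module
variable {A A' ι ι' β : Type} [Fintype A] [Fintype A'] [Fintype ι] [Fintype ι'] [Fintype β]
variable {K N : Type} [Field K] [NumberField K] [Field N] [NumberField N] [Algebra K N]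
variable {φ : Matrix A ι K} {H : (K →+* ℂ) → Matrix ι ι ℂ}

theorem mul_submatrix_reindex {R : Type} [CommRing R] (φ : Matrix A ι R) (eA : A' → A) (e : ι' ≃ ι)
    (x : Matrix ι' β R) :
    φ.submatrix eA e * x = (φ * x.submatrix e.symm id).submatrix eA id := by
  ext i j
  simp only [Matrix.mul_apply, submatrix_apply, id]
  exact Fintype.sum_equiv e _ _ fun k => by rw [e.symm_apply_apply]

theorem gram_submatrix_reindex (M : Matrix ι ι ℂ) (e : ι' ≃ ι) (x : Matrix ι' β ℂ) :
    gram (M.submatrix e e) x = gram M (x.submatrix e.symm id) := by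
  rw [gram, gram, Matrix.mul_assoc, mul_submatrix_reindex, Matrix.mul_assoc]
  ext i j
  simp only [Matrix.mul_apply, submatrix_apply, id, conjTranspose_apply]
  exact Fintype.sum_equiv e _ _ fun k => by rw [e.symm_apply_apply]

theorem deg_submatrix_reindex (eA : A' ≃ A) (e : ι' ≃ ι) (x : Matrix ι' β N) :
    deg (φ.submatrix eA e) (fun σ => (H σ).submatrix e e) x = deg φ H (x.submatrix e.symm id) := by
  have h1 : (φ.submatrix eA e).map (algebraMap K N) = (φ.map (algebraMap K N)).submatrix eA e := rfl
  rw [deg, h1, mul_submatrix_reindex, cont_submatrix_left, deg]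
  simp only [gramDet, gram_submatrix_reindex, submatrix_map]

theorem LeftInv.submatrix {R : Type} [CommRing R] {x : Matrix A ι R} (hx : LeftInv x)
    (eA : A' ≃ A) (e : ι' ≃ ι) : LeftInv (x.submatrix eA e) := by
  obtain ⟨y, hy⟩ := hx
  exact ⟨y.submatrix e eA, by rw [submatrix_mul_equiv, hy, submatrix_one_equiv]⟩

theorem LeftInv.submatrix_left {R : Type} [CommRing R] {x : Matrix A ι R} (hx : LeftInv x)
    (eA : A' ≃ A) : LeftInv (x.submatrix eA id) :=
  hx.submatrix eA (Equiv.refl ι)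

theorem AbsBound.submatrix {M : ℝ} (hM : AbsBound φ H M) (eA : A' ≃ A) (e : ι' ≃ ι) :
    AbsBound (φ.submatrix eA e) (fun σ => (H σ).submatrix e e) M := by
  intro N _ _ _ x hx
  rw [deg_submatrix_reindex]
  exact hM N _ (hx.submatrix_left e.symm)

end Reindex

section Tensor
open Matrix Module
open scoped Kronecker
variable {K : Type} [Field K] [NumberField K]

/-- The Kronecker product of a finite family of matrices. -/
def piKron {R : Type} [CommRing R] {n : ℕ} {α γ : Fin n → Type} (M : ∀ i, Matrix (α i) (γ i) R) :
    Matrix (∀ i, α i) (∀ i, γ i) R :=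
  Matrix.of fun a x => ∏ i, M i (a i) (x i)

/-- Splitting off the first coordinate. -/
def headEquiv {n : ℕ} (α : Fin (n + 1) → Type) : (∀ i, α i) ≃ (∀ i : Fin n, α i.succ) × α 0 :=
  (Fin.consEquiv α).symm.trans (Equiv.prodComm _ _)

theorem piKron_succ {R : Type} [CommRing R] {n : ℕ} {α γ : Fin (n + 1) → Type}
    (M : ∀ i, Matrix (α i) (γ i) R) : piKron M =
      ((piKron fun i : Fin n => M i.succ) ⊗ₖ M 0).submatrix (headEquiv α) (headEquiv γ) := by
  ext a x
  rw [piKron, of_apply, Fin.prod_univ_succ, mul_comm]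
  rfl

theorem piKron_eq_one {R : Type} [CommRing R] {α γ : Fin 0 → Type}
    (M : ∀ i, Matrix (α i) (γ i) R) (a : ∀ i, α i) (x : ∀ i, γ i) : piKron M a x = 1 :=
  Fin.prod_univ_zero fun i => M i (a i) (x i)

theorem LeftInv.kronecker {R A B ι κ : Type} [CommRing R] [Fintype A] [Fintype B] [Fintype ι]
    [Fintype κ] {φ : Matrix A ι R} {ψ : Matrix B κ R} (hφ : LeftInv φ) (hψ : LeftInv ψ) :
    LeftInv (φ ⊗ₖ ψ) := by
  obtain ⟨y, hy⟩ := hφ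
  obtain ⟨z, hz⟩ := hψ
  refine ⟨y ⊗ₖ z, ?_⟩
  rw [← mul_kronecker_mul, hy, hz]
  ext ⟨i, j⟩ ⟨k, l⟩
  simp only [kroneckerMap_apply, one_apply, Prod.mk.injEq]
  split_ifs <;> simp_all

theorem deg_unique {A ι N : Type} [Fintype A] [Fintype ι] [Unique A] [Unique ι] [Field N]
    [NumberField N] [Algebra K N] {φ : Matrix A ι K} (hφ : ∀ a i, φ a i = 1)
    {H : (K →+* ℂ) → Matrix ι ι ℂ} (hH : ∀ σ i j, H σ i j = 1) {x : Matrix ι Unit N}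
    (hx : LeftInv x) : deg φ H x = 0 := by
  have hx0 : x default () ≠ 0 := by
    intro h
    obtain ⟨y, hy⟩ := hx
    have := congrFun₂ hy () ()
    simp [Matrix.mul_apply, h] at this
  have h1 : cont (φ.map (algebraMap K N) * x) =
      FractionalIdeal.spanSingleton _ (x default ()) := by
    have h {_ : DecidableEq Unit} (f : Unit → A) :
        ((φ.map (algebraMap K N) * x).submatrix f id).det = x default () := by
      rw [det_unique]
      simp [Matrix.mul_apply, hφ]
    refine le_antisymm (cont_le_iff.2 fun f => ?_) (FractionalIdeal.spanSingleton_le_iff_mem.2 ?_)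
    · rw [h]
      exact FractionalIdeal.mem_spanSingleton_self _ _
    · have := det_mem_cont (φ.map (algebraMap K N) * x) fun _ => default
      rwa [h] at this
  have h2 : ∀ σ : N →+* ℂ, Real.log (gramDet (H (σ.comp (algebraMap K N))) (x.map σ)) =
      2 * Real.log ‖σ (x default ())‖ := fun σ => by
    rw [gramDet, det_unit]
    simp only [gram, Matrix.mul_apply, Fintype.sum_unique, hH, mul_one, conjTranspose_apply,
      map_apply, Complex.star_def, Complex.conj_mul', ← Complex.ofReal_pow, Complex.ofReal_re,
      Real.log_pow, Nat.cast_ofNat]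
  rw [deg, h1, logN_spanSingleton hx0, Finset.sum_congr rfl fun σ _ => h2 σ, ← Finset.mul_sum]
  ring

theorem leftInv_of_unique {A ι R : Type} [CommRing R] [Fintype A] [Fintype ι] [Unique A] [Unique ι]
    {φ : Matrix A ι R} (hφ : ∀ a i, φ a i = 1) : LeftInv φ := by
  refine ⟨Matrix.of fun _ _ => 1, ?_⟩
  ext a b
  rw [Subsingleton.elim a b, one_apply_eq]
  simp [Matrix.mul_apply, hφ]

theorem posDef_of_unique {ι : Type} [Fintype ι] [Unique ι] {M : Matrix ι ι ℂ}
    (h : ∀ i j, M i j = 1) : M.PosDef := by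
  obtain rfl : M = 1 := by
    ext i j
    rw [h, Subsingleton.elim i j, one_apply_eq]
  exact PosDef.one

theorem piKron_bounds (n : ℕ) (A ι : Fin n → Type) [∀ i, Fintype (A i)] [∀ i, Fintype (ι i)]
    (φ : ∀ i, Matrix (A i) (ι i) K) (H : ∀ i, (K →+* ℂ) → Matrix (ι i) (ι i) ℂ) (M : Fin n → ℝ)
    (hφ : ∀ i, LeftInv (φ i)) (hH : ∀ i σ, (H i σ).PosDef)
    (hconj : ∀ i σ, H i ((starRingEnd ℂ).comp σ) = (H i σ).map (starRingEnd ℂ))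
    (hM : ∀ i (s : ℕ) (x : Matrix (ι i) (Fin s) K), LeftInv x → deg (φ i) (H i) x ≤ s * M i) :
    LeftInv (piKron φ) ∧ (∀ σ, (piKron fun i => H i σ).PosDef) ∧
      AbsBound (piKron φ) (fun σ => piKron fun i => H i σ) (∑ i, M i) := by
  induction n with
  | zero =>
    have h : LeftInv (piKron φ) := leftInv_of_unique (piKron_eq_one φ)
    refine ⟨h, fun σ => posDef_of_unique fun i j => piKron_eq_one _ i j, fun N _ _ _ x hx => ?_⟩
    rw [deg_unique (piKron_eq_one φ) (fun σ i j => piKron_eq_one _ i j) hx]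
    simp
  | succ n ih =>
    obtain ⟨h1, h2, h3⟩ := ih (fun i => A i.succ) (fun i => ι i.succ) (fun i => φ i.succ)
      (fun i => H i.succ) (fun i => M i.succ) (fun i => hφ i.succ) (fun i => hH i.succ)
      (fun i => hconj i.succ) fun i => hM i.succ
    have hconj' : ∀ σ, (piKron fun i : Fin n => H i.succ ((starRingEnd ℂ).comp σ)) =
        (piKron fun i : Fin n => H i.succ σ).map (starRingEnd ℂ) := fun σ => by
      ext x y
      simp only [piKron, hconj, of_apply, map_apply, map_prod]
    refine ⟨?_, fun σ => ?_, ?_⟩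
    · rw [piKron_succ]
      exact (h1.kronecker (hφ 0)).submatrix _ _
    · rw [piKron_succ]
      exact ((h2 σ).kronecker (hH 0 σ)).submatrix (headEquiv ι).injective
    · have h4 := (AbsBound.kronecker h1 (hφ 0) h2 (hH 0) hconj' h3
        fun N _ _ _ β _ w hw => deg_le_of_base (hφ 0) (hH 0) (hM 0) hw).submatrix
          (headEquiv A) (headEquiv ι)
      have h5 : ∑ i, M i = ∑ i : Fin n, M i.succ + M 0 := by rw [Fin.sum_univ_succ, add_comm]
      rw [h5, piKron_succ φ, show (fun σ => piKron fun i => H i σ) = _ from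
        funext fun σ => piKron_succ fun i => H i σ]
      exact h4

end Tensor

section Main
open Matrix Module

theorem piKron_mulVec_prod {R : Type} [CommRing R] {n : ℕ} {α γ : Fin n → Type}
    [∀ i, Fintype (γ i)] (M : ∀ i, Matrix (α i) (γ i) R) (e : ∀ i, γ i → R) (a : ∀ i, α i) :
    (piKron M *ᵥ fun t => ∏ i, e i (t i)) a = ∏ i, (M i *ᵥ e i) (a i) := by
  simp only [mulVec, dotProduct, piKron, of_apply, ← Finset.prod_mul_distrib]
  rw [Finset.prod_univ_sum, Fintype.piFinset_univ]

end Main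

end TensorSlope
end

open TensorSlope in
/-- Let `K` be a number field.  For any finite family of nonzero hermitian
`𝒪_K`-lattices `Ē i` (each presented as a finitely generated full `𝒪_K`-lattice `E i` in
`K^(r i)`, `r i ≥ 1`, with positive definite conjugation-compatible metrics `H i`), the
maximal slope of their tensor product (the `𝒪_K`-span of the pure tensors, with the tensor
product metrics) satisfies
`μ_max(⊗ Ē_i) ≤ ∑ i (μ_max(Ē_i) + ([K:ℚ]/2) · log rk Ē_i)`. -/
theorem hMuMax_tensor_le (K : Type) [Field K] [NumberField K]
    (n : ℕ) (r : Fin n → ℕ) (hr : ∀ i, 0 < r i)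
    (E : ∀ i, Submodule (𝓞 K) (Fin (r i) → K)) (hfg : ∀ i, (E i).FG)
    (hfull : ∀ i, Submodule.span K ((E i : Set (Fin (r i) → K))) = ⊤)
    (H : ∀ i, (K →+* ℂ) → Matrix (Fin (r i)) (Fin (r i)) ℂ)
    (hpos : ∀ i σ, (H i σ).PosDef) (hconj : ∀ i, ConjCompatible K (H i)) :
    hMuMax K (fun σ => Matrix.of fun x y : (∀ i, Fin (r i)) => ∏ i, H i σ (x i) (y i))
        (Submodule.span (𝓞 K) { v : (∀ i, Fin (r i)) → K |
          ∃ e : ∀ i, Fin (r i) → K, (∀ i, e i ∈ E i) ∧ v = fun t => ∏ i, e i (t i) }) ≤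
      ∑ i, (hMuMax K (H i) (E i) + ((Module.finrank ℚ K : ℝ) / 2) * Real.log (r i)) := by
  choose A hA φ hφ hE using fun i => exists_eq_latOf (hfg i) (hfull i)
  obtain ⟨h1, h2, h3⟩ := piKron_bounds n A (fun i => Fin (r i)) φ H (fun i => hMuMax K (H i) (E i))
    hφ hpos hconj fun i s x hx => by
      rw [hE i]
      exact deg_le_card_mul_hMuMax (hφ i) (hpos i) s x hx
  have hlat : Submodule.span (𝓞 K) {v : (∀ i, Fin (r i)) → K |
      ∃ e : ∀ i, Fin (r i) → K, (∀ i, e i ∈ E i) ∧ v = fun t => ∏ i, e i (t i)} ≤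
        latOf (piKron φ) := by
    rw [Submodule.span_le]
    rintro _ ⟨e, he, rfl⟩ a
    have h4 : ∀ i, ∃ t : 𝓞 K, algebraMap (𝓞 K) K t = (φ i).mulVec (e i) (a i) := fun i => by
      have := he i
      rw [hE i] at this
      exact this (a i)
    choose t ht using h4
    refine ⟨∏ i, t i, ?_⟩
    rw [map_prod, Finset.prod_congr rfl fun i _ => ht i]
    exact (piKron_mulVec_prod φ e a).symm
  have hconj' : ∀ σ, (piKron fun i => H i ((starRingEnd ℂ).comp σ)) =
      (piKron fun i => H i σ).map (starRingEnd ℂ) := fun σ => by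
    ext x y
    simp only [piKron, hconj _ σ, Matrix.of_apply, Matrix.map_apply, map_prod]
  refine csSup_le ?_ ?_
  · refine ⟨_, _, fun hbot => ?_, le_rfl, rfl⟩
    have h4 : ∀ i, ∃ v ∈ E i, ∃ j, v j ≠ 0 := fun i => by
      by_contra! h0
      have h5 : (E i : Set (Fin (r i) → K)) ⊆ {0} := fun v hv => funext (h0 v hv)
      have h6 := Submodule.span_mono (R := K) h5
      rw [hfull, Submodule.span_zero_singleton, top_le_iff] at h6
      have h7 := (Submodule.mem_bot K).1 (h6 ▸ Submodule.mem_top :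
        (Pi.single ⟨0, hr i⟩ 1 : Fin (r i) → K) ∈ (⊥ : Submodule K (Fin (r i) → K)))
      have h8 := congrFun h7 ⟨0, hr i⟩
      rw [Pi.single_eq_same] at h8
      exact one_ne_zero h8
    choose v hv j hj using h4
    have h5 := Submodule.subset_span (R := 𝓞 K) (s := {v : (∀ i, Fin (r i)) → K |
      ∃ e : ∀ i, Fin (r i) → K, (∀ i, e i ∈ E i) ∧ v = fun t => ∏ i, e i (t i)}) ⟨v, hv, rfl⟩
    rw [hbot] at h5
    exact Finset.prod_ne_zero_iff.2 (fun i _ => hj i) (congrFun h5 j)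
  · rintro _ ⟨F, hF0, hF, rfl⟩
    obtain ⟨s, x, hs, hx, hle⟩ := hMu_le h1 h2 hF0 (hF.trans hlat)
    have : Nonempty (Fin s) := ⟨⟨0, hs⟩⟩
    have hs' : (0 : ℝ) < s := by exact_mod_cast hs
    have h4 := deg_le_of_absBound h2 hconj' h1 h3 hx
    have h5 := hx.card_le
    rw [Module.finrank_self, Nat.cast_one, one_mul, Fintype.card_fin, mul_comm] at h4
    refine hle.trans ((div_le_iff₀ hs').2 h4 |>.trans ?_)
    rw [Finset.sum_add_distrib, ← Finset.mul_sum]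
    have h6 : Real.log s ≤ ∑ i, Real.log (r i) := by
      rw [← Real.log_prod fun i _ => by exact_mod_cast (hr i).ne']
      refine Real.log_le_log hs' ?_
      rw [Fintype.card_fin, Fintype.card_pi] at h5
      simp only [Fintype.card_fin] at h5
      exact_mod_cast h5
    gcongr
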